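/- For all integers k ≥ 1, s ≥ 0, r ≥ 0 with s even, r odd and s + r = k, GR_k((k−s−r)P3, sK3, rH3) = 4·5^(s/2)·17^((r−1)/2) + 1. -/

import Mathlib

open SimpleGraph

/-- A rainbow triangle in an edge-coloring of a complete graph: three distinct
vertices whose three pairwise edges receive three pairwise distinct colors. -/
def HasRainbowTriangle {n k : ℕ} (c : Fin n → Fin n → Fin k) : Prop :=
  ∃ u v w : Fin n, u ≠ v ∧ u ≠ w ∧ v ≠ w ∧
    c u v ≠ c u w ∧ c u v ≠ c v w ∧ c u w ≠ c v w

/-- A Gallai `k`-coloring of `K_n`: a symmetric edge-coloring with no rainbow triangle. -/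
def IsGallaiColoring {n k : ℕ} (c : Fin n → Fin n → Fin k) : Prop :=
  (∀ u v, c u v = c v u) ∧ ¬ HasRainbowTriangle c

/-- A monochromatic copy of the graph `F` in color `i`: an injection of the vertices
of `F` into the vertices of `K_n` mapping every edge of `F` to an edge colored `i`. -/
def HasMonoCopy {V : Type} (F : SimpleGraph V) {n k : ℕ}
    (c : Fin n → Fin n → Fin k) (i : Fin k) : Prop :=
  ∃ f : V → Fin n, Function.Injective f ∧ ∀ a b, F.Adj a b → c (f a) (f b) = i

/-- The Gallai-Ramsey number `GR(F₁, …, F_k)`: the least `n` such that every Gallai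
`k`-coloring of `K_n` contains, for some color `i`, a monochromatic copy of `Fᵢ`
in color `i`. -/
noncomputable def GR (k : ℕ) (F : Fin k → Σ V : Type, SimpleGraph V) : ℕ :=
  sInf {n : ℕ | ∀ c : Fin n → Fin n → Fin k, IsGallaiColoring c →
    ∃ i : Fin k, HasMonoCopy (F i).2 c i}

/-- The triangle `K₃`. -/
def GK3 : SimpleGraph (Fin 3) := ⊤

/-- The path `P₃` on three vertices (edges 0–1 and 1–2). -/
def GP3 : SimpleGraph (Fin 3) := SimpleGraph.fromRel (fun a _ => a = 1)

/-- `H₁`: a `K₄` on `{0,1,2,3}` together with the extra vertex `4` adjacent to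
exactly the vertex `3`. -/
def GH1 : SimpleGraph (Fin 5) :=
  SimpleGraph.fromRel (fun a b => (a ≠ 4 ∧ b ≠ 4) ∨ (a = 3 ∧ b = 4))

/-- `H₂`: `K₅` minus the two edges 0–1 and 1–2 of a path on three vertices. -/
def GH2 : SimpleGraph (Fin 5) :=
  (⊤ : SimpleGraph (Fin 5)) \
    SimpleGraph.fromRel (fun a b => (a = 0 ∧ b = 1) ∨ (a = 1 ∧ b = 2))

/-- `H₃`: `K₅` minus the edge 0–1. -/
def GH3 : SimpleGraph (Fin 5) :=
  (⊤ : SimpleGraph (Fin 5)) \ SimpleGraph.fromRel (fun a b => a = 0 ∧ b = 1)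
/-- The family of graphs for `GR_k((k-s-r)P₃, sK₃, rH₃)`: the graph `H₃` in each of
the first `r` colors, the triangle `K₃` in each of the next `s` colors, and the path
`P₃` in each of the remaining `k - s - r` colors. -/
def mixPKH (k s r : ℕ) : Fin k → Σ V : Type, SimpleGraph V :=
  fun i =>
    if (i : ℕ) < r then ⟨Fin 5, GH3⟩
    else if (i : ℕ) < r + s then ⟨Fin 3, GK3⟩
    else ⟨Fin 3, GP3⟩

namespace RE
variable {V : Type*}

/-- number of pairs of `l` in relation `A` -/
def ec (A : V → V → Bool) : List V → ℕ
  | [] => 0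
  | x :: l => ec A l + l.countP (A x)

/-- every `k+1` distinct vertices of `R` span between `lo` and `hi` edges -/
def Good (A : V → V → Bool) (P : List (ℕ × ℕ × ℕ)) (R : Finset V) : Prop :=
  ∀ q ∈ P, ∀ l : List V, l.Nodup → (∀ x ∈ l, x ∈ R) → l.length = q.1 + 1 →
    q.2.1 ≤ ec A l ∧ ec A l ≤ q.2.2

/-- adjacency (0 or 1) in the coded graph `g`, for `a < b` -/
def ad (g a b : ℕ) : ℕ := (g >>> (b * (b - 1) / 2 + a)) % 2

def adS (g a b : ℕ) : ℕ := bif Nat.ble b a then ad g b a else ad g a b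

/-- the vertices `m-1, …, 0` with the bitmaps of the subsets containing them -/
def vlist : ℕ → List (ℕ × ℕ)
  | 0 => []
  | m + 1 => (m, (2 ^ 2 ^ m - 1) <<< 2 ^ m) ::
      (vlist m).map (fun p => (p.1, p.2 ||| p.2 <<< 2 ^ m))

def full (m : ℕ) : ℕ := 2 ^ 2 ^ m - 1

/-- bitmap of the subsets containing at least `t` elements of a list -/
def th (F : ℕ) : ℕ → List (ℕ × ℕ) → ℕ
  | 0, _ => F
  | _ + 1, [] => 0
  | t + 1, v :: vs => (v.2 &&& th F t vs) ||| th F (t + 1) vs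

def sumad (g x : ℕ) : List (ℕ × ℕ) → ℕ
  | [] => 0
  | y :: l => sumad g x l + ad g x y.1

def leaf (F lo hi : ℕ) (ch : List (ℕ × ℕ)) (e : ℕ) : ℕ :=
  (th F (lo - e) ch) &&&
    (bif Nat.ble (e + ch.length) hi then F else F ^^^ (th F (hi + 1 - e) ch))

def cmb (F g lo hi : ℕ) : List (ℕ × ℕ) → ℕ → List (ℕ × ℕ) → ℕ → ℕ
  | [], 0, ch, e => leaf F lo hi ch e
  | [], _ + 1, _, _ => F
  | _ :: _, 0, ch, e => leaf F lo hi ch e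
  | x :: xs, k + 1, ch, e =>
      cmb F g lo hi xs (k + 1) ch e &&&
      (bif Nat.ble lo (e + sumad g x.1 ch) && Nat.ble 10 hi then F
        else cmb F g lo hi xs k (x :: ch) (e + sumad g x.1 ch))

/-- bitmap of the neighbourhoods of a new vertex compatible with the conditions -/
def extMap (g m : ℕ) : List (ℕ × ℕ × ℕ) → ℕ
  | [] => full m
  | q :: P => cmb (full m) g q.2.1 q.2.2 (vlist m) q.1 [] 0 &&& extMap g m P

/-- bitmap of the sets with at least `k` elements -/
def geb : ℕ → ℕ → ℕ
  | m, 0 => full m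
  | 0, _ + 1 => 0
  | m + 1, k + 1 => geb m (k + 1) ||| (geb m k) <<< 2 ^ m

/-- degree in the coded graph -/
def dg (g u : ℕ) : List (ℕ × ℕ) → ℕ
  | [] => 0
  | y :: l => (bif Nat.beq y.1 u then 0 else adS g u y.1) + dg g u l

def dsum (g : ℕ) (vs : List (ℕ × ℕ)) : List (ℕ × ℕ) → ℕ
  | [] => 0
  | y :: l => dg g y.1 vs + dsum g vs l

/-- minimum degree condition -/
def mdMap (g m : ℕ) : List (ℕ × ℕ) → ℕ
  | [] => full m
  | u :: l => ((full m ^^^ geb m (dg g u.1 (vlist m) + 1)) |||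
      ((full m ^^^ geb m (dg g u.1 (vlist m) + 2)) &&& u.2)) &&& mdMap g m l

def orS : List (ℕ × ℕ × ℕ) → ℕ
  | [] => 0
  | c :: l => (1 <<< c.1) ||| orS l

def ext (g m S : ℕ) : ℕ := g % 2 ^ (m * (m - 1) / 2) ||| (S <<< (m * (m - 1) / 2))

def nib (p i : ℕ) : ℕ := (p >>> (4 * i)) % 16

/-- check of one row of a permutation certificate -/
def rowOK (G h p j : ℕ) : ℕ → Bool
  | 0 => true
  | i + 1 => rowOK G h p j i &&
     (Nat.beq (ad h i j) (adS G (nib p i) (nib p j)) &&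
      !Nat.beq (nib p i) (nib p j))

def permOK (G h n p : ℕ) : ℕ → Bool
  | 0 => true
  | j + 1 => permOK G h n p j && (Nat.ble (nib p j + 1) n && rowOK G h p j j)

def certOK (g m : ℕ) (L : List ℕ) (c : ℕ × ℕ × ℕ) : Bool :=
  match L[c.2.1]? with
  | none => false
  | some h => permOK (ext g m c.1) h (m + 1) c.2.2 (m + 1)

def stepOK (P : List (ℕ × ℕ × ℕ)) (m thr2 : ℕ) (L : List ℕ)
    (d : ℕ × List (ℕ × ℕ × ℕ)) : Bool :=
  Nat.beq ((extMap d.1 m P &&& (mdMap d.1 m (vlist m) &&&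
      geb m ((thr2 + 1 - dsum d.1 (vlist m) (vlist m)) / 2))) ||| orS d.2) (orS d.2) &&
    d.2.all (certOK d.1 m L)

def levelOK (P : List (ℕ × ℕ × ℕ)) (m thr2 : ℕ) (D : List (ℕ × List (ℕ × ℕ × ℕ)))
    (L : List ℕ) : Bool := D.all (stepOK P m thr2 L)

/-! ### Soundness of the enumeration engine -/

theorem ad_eq (g a b : ℕ) : ad g a b = (g.testBit (b * (b - 1) / 2 + a)).toNat := by
  rw [Nat.toNat_testBit, ad, Nat.shiftRight_eq_div_pow]

theorem full_testBit {m S : ℕ} (h : S < 2 ^ m) : (full m).testBit S = true := by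
  rw [full, Nat.testBit_two_pow_sub_one]; simpa using h

theorem full_testBit' {m S : ℕ} : (full m).testBit S = decide (S < 2 ^ m) := by
  rw [full, Nat.testBit_two_pow_sub_one]

/-- the list of bitmaps is correct -/
def VOK (S : ℕ) (vs : List (ℕ × ℕ)) : Prop := ∀ p ∈ vs, p.2.testBit S = S.testBit p.1

theorem vlist_fst (m : ℕ) : (vlist m).map Prod.fst = (List.range m).reverse := by
  induction m with
  | zero => rfl
  | succ m ih =>
    rw [vlist, List.range_succ, List.reverse_append, List.map_cons, List.map_map]
    simp only [List.reverse_cons, List.reverse_nil, List.nil_append, List.cons_append,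
      List.cons.injEq, true_and]
    rw [← ih]; rfl

theorem vlist_lt {m : ℕ} {p : ℕ × ℕ} (h : p ∈ vlist m) : p.1 < m := by
  have : p.1 ∈ (vlist m).map Prod.fst := List.mem_map_of_mem h
  rw [vlist_fst] at this; simpa using this

theorem vlist_small {m : ℕ} : ∀ p ∈ vlist m, p.2 < 2 ^ 2 ^ m := by
  induction m with
  | zero => simp [vlist]
  | succ m ih =>
    intro p hp
    have e : 2 ^ 2 ^ (m + 1) = 2 ^ 2 ^ m * 2 ^ 2 ^ m := by rw [← pow_add]; congr 1; ring
    have h1 : 1 ≤ 2 ^ 2 ^ m := Nat.one_le_two_pow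
    rw [vlist, List.mem_cons, List.mem_map] at hp
    rcases hp with rfl | ⟨q, hq, rfl⟩
    · simp only [Nat.shiftLeft_eq]; rw [e]
      exact Nat.mul_lt_mul_of_pos_right (by omega) (by omega)
    · have := ih q hq
      apply Nat.or_lt_two_pow
      · exact this.trans_le (by rw [e]; nlinarith)
      · simp only [Nat.shiftLeft_eq]; rw [e]
        exact Nat.mul_lt_mul_of_pos_right this (by omega)

theorem vlist_ok {m : ℕ} : ∀ {S : ℕ}, S < 2 ^ m → VOK S (vlist m) := by
  induction m with
  | zero => intro S _ p hp; simp [vlist] at hp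
  | succ m ih =>
    intro S hS p hp
    rw [vlist, List.mem_cons, List.mem_map] at hp
    have e : 2 ^ (m + 1) = 2 ^ m + 2 ^ m := by ring
    rcases hp with rfl | ⟨q, hq, rfl⟩
    · simp only [Nat.testBit_shiftLeft, Nat.testBit_two_pow_sub_one]
      by_cases h : 2 ^ m ≤ S
      · have h2 : S - 2 ^ m < 2 ^ m := by omega
        have : S.testBit m = true := by
          obtain ⟨T, rfl⟩ := Nat.exists_eq_add_of_le h
          rw [Nat.testBit_two_pow_add_eq]
          simp at h2
          simp [Nat.testBit_lt_two_pow h2]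
        simp [h, h2, this]
      · have := Nat.testBit_lt_two_pow (not_le.1 h)
        simp [h, this]
    · have hq1 := vlist_lt hq
      have hs := vlist_small q hq
      simp only [Nat.testBit_or, Nat.testBit_shiftLeft]
      by_cases h : 2 ^ m ≤ S
      · have h2 : S - 2 ^ m < 2 ^ m := by omega
        have h3 := ih h2 q hq
        obtain ⟨T, rfl⟩ := Nat.exists_eq_add_of_le h
        have : q.2.testBit (2 ^ m + T) = false :=
          Nat.testBit_lt_two_pow (hs.trans_le (Nat.pow_le_pow_right (by norm_num) h))
        simp at h3 
        simp [this, h3, Nat.testBit_two_pow_add_gt hq1]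
      · simp [h, ih (not_le.1 h) q hq]

theorem th_testBit {m S : ℕ} (h : S < 2 ^ m) (vs : List (ℕ × ℕ)) (hv : VOK S vs) (t : ℕ) :
    (th (full m) t vs).testBit S = decide (t ≤ vs.countP (fun p => S.testBit p.1)) := by
  induction vs generalizing t with
  | nil => cases t <;> simp [th, full_testBit h]
  | cons v vs ih =>
    have hv' : VOK S vs := fun p hp => hv p (List.mem_cons_of_mem _ hp)
    have h1 := hv v List.mem_cons_self
    cases t with
    | zero => simp [th, full_testBit h]
    | succ t =>
      rw [th, Nat.testBit_or, Nat.testBit_and, ih hv', ih hv', h1, List.countP_cons]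
      cases hb : S.testBit v.1 <;> simp
      omega

/-- edges within a list of coded vertices -/
def tot (g : ℕ) : List (ℕ × ℕ) → ℕ
  | [] => 0
  | x :: l => tot g l + sumad g x.1 l

theorem leaf_sound {m S lo hi e : ℕ} {ch : List (ℕ × ℕ)} (h : S < 2 ^ m) (hv : VOK S ch)
    (h1 : lo ≤ e + ch.countP (fun p => S.testBit p.1))
    (h2 : e + ch.countP (fun p => S.testBit p.1) ≤ hi) :
    (leaf (full m) lo hi ch e).testBit S = true := by
  rw [leaf, Nat.testBit_and, th_testBit h _ hv]
  have : lo - e ≤ ch.countP (fun p => S.testBit p.1) := by omega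
  cases Nat.ble (e + ch.length) hi
  · simp only [cond_false, Nat.testBit_xor, th_testBit h _ hv, full_testBit h, this]
    simp; omega
  · simp [this, full_testBit h]

theorem cmb_sound {m S g lo hi : ℕ} (h : S < 2 ^ m) (xs : List (ℕ × ℕ)) :
    ∀ (k : ℕ) (ch : List (ℕ × ℕ)) (e : ℕ), VOK S xs → VOK S ch → e = tot g ch →
    (∀ l : List (ℕ × ℕ), l.Sublist xs → l.length = k →
      lo ≤ tot g (l.reverse ++ ch) + (l.reverse ++ ch).countP (fun p => S.testBit p.1) ∧
      tot g (l.reverse ++ ch) + (l.reverse ++ ch).countP (fun p => S.testBit p.1) ≤ hi) →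
    (cmb (full m) g lo hi xs k ch e).testBit S = true := by
  induction xs with
  | nil =>
    intro k ch e hx hc he H
    cases k with
    | zero =>
      have := H [] (List.Sublist.refl _) rfl
      simp at this
      subst he
      rw [cmb]; exact leaf_sound h hc this.1 this.2
    | succ k => rw [cmb]; exact full_testBit h
  | cons x xs ih =>
    intro k ch e hx hc he H
    have hx' : VOK S xs := fun p hp => hx p (List.mem_cons_of_mem _ hp)
    cases k with
    | zero =>
      have := H [] (List.nil_sublist _) rfl
      simp at this
      subst he
      rw [cmb]; exact leaf_sound h hc this.1 this.2
    | succ k =>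
      rw [cmb, Nat.testBit_and, Bool.and_eq_true]
      refine ⟨ih _ _ _ hx' hc he (fun l hl hk => H l (hl.cons _) hk), ?_⟩
      cases (Nat.ble lo (e + sumad g x.1 ch) && Nat.ble 10 hi)
      · rw [cond_false]
        refine ih _ _ _ hx' ?_ (by rw [tot, he]) ?_
        · intro p hp
          rcases List.mem_cons.1 hp with rfl | hp
          · exact hx _ List.mem_cons_self
          · exact hc p hp
        · intro l hl hk
          have := H (x :: l) (hl.cons_cons _) (by simp [hk])
          simpa [List.reverse_cons, List.append_assoc] using this
      · exact full_testBit h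

/-- number of elements of the coded set -/
def bc (S m : ℕ) : ℕ := (List.range m).countP (fun i => S.testBit i)

theorem geb_testBit {m : ℕ} : ∀ {S : ℕ} (k : ℕ),
    (geb m k).testBit S = decide (S < 2 ^ m ∧ k ≤ bc S m) := by
  induction m with
  | zero =>
    intro S k
    cases k with
    | zero => simp [geb, full_testBit']
    | succ k => simp [geb, bc]
  | succ m ih =>
    intro S k
    cases k with
    | zero => simp [geb, full_testBit']
    | succ k =>
      have e : 2 ^ (m + 1) = 2 ^ m + 2 ^ m := by ring
      rw [geb, Nat.testBit_or, Nat.testBit_shiftLeft, ih, ih]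
      by_cases h : 2 ^ m ≤ S
      · obtain ⟨T, rfl⟩ := Nat.exists_eq_add_of_le h
        by_cases hT : T < 2 ^ m
        · have h1 : bc (2 ^ m + T) (m + 1) = bc T m + 1 := by
            unfold bc
            rw [List.range_succ, List.countP_append]
            congr 1
            · apply List.countP_congr
              intro i hi; rw [List.mem_range] at hi
              rw [Nat.testBit_two_pow_add_gt hi]
            · simp [Nat.testBit_two_pow_add_eq, Nat.testBit_lt_two_pow hT]
          simp [h1, hT, e]
        · simp [hT, e]
      · have h0 := not_le.1 h
        have h1 : bc S (m + 1) = bc S m := by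
          unfold bc
          rw [List.range_succ, List.countP_append]
          simp [Nat.testBit_lt_two_pow h0]
        have : S < 2 ^ m + 2 ^ m := by omega
        simp [h, h1, e, h0, this]

theorem orS_testBit (l : List (ℕ × ℕ × ℕ)) {S : ℕ} (h : (orS l).testBit S = true) :
    ∃ c ∈ l, c.1 = S := by
  induction l with
  | nil => simp [orS] at h
  | cons c l ih =>
    rw [orS, Nat.testBit_or, Bool.or_eq_true] at h
    rcases h with h | h
    · refine ⟨c, List.mem_cons_self, ?_⟩
      rw [Nat.shiftLeft_eq, one_mul, Nat.testBit_two_pow] at h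
      simpa using h
    · obtain ⟨d, hd, e⟩ := ih h
      exact ⟨d, List.mem_cons_of_mem _ hd, e⟩

/-- `f` realizes the coded graph `g` on `m` vertices inside `R` -/
structure Realizes (A : V → V → Bool) (R : Finset V) (g m : ℕ) (f : ℕ → V) : Prop where
  mem : ∀ i < m, f i ∈ R
  inj : ∀ i < m, ∀ j < m, f i = f j → i = j
  adj : ∀ a b, a < b → b < m → ad g a b = (A (f a) (f b)).toNat

theorem sumad_eq {A : V → V → Bool} {R : Finset V} {g m : ℕ} {f : ℕ → V}
    (hf : Realizes A R g m f) (x : ℕ) (l : List (ℕ × ℕ)) (h : ∀ p ∈ l, x < p.1 ∧ p.1 < m) :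
    sumad g x l = (l.map (fun p => f p.1)).countP (A (f x)) := by
  induction l with
  | nil => rfl
  | cons y l ih =>
    rw [sumad, ih (fun p hp => h p (List.mem_cons_of_mem _ hp)), List.map_cons, List.countP_cons]
    have := h y List.mem_cons_self
    rw [hf.adj _ _ this.1 this.2]
    cases A (f x) (f y.1) <;> rfl

theorem tot_eq {A : V → V → Bool} {R : Finset V} {g m : ℕ} {f : ℕ → V}
    (hf : Realizes A R g m f) (l : List (ℕ × ℕ)) (h : ∀ p ∈ l, p.1 < m)
    (hl : l.Pairwise (fun p q => p.1 < q.1)) :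
    tot g l = ec A (l.map (fun p => f p.1)) := by
  induction l with
  | nil => rfl
  | cons y l ih =>
    rw [List.pairwise_cons] at hl
    rw [tot, List.map_cons, ec, ih (fun p hp => h p (List.mem_cons_of_mem _ hp)) hl.2,
      sumad_eq hf y.1 l (fun p hp => ⟨hl.1 p hp, h p (List.mem_cons_of_mem _ hp)⟩)]

theorem vlist_pairwise (m : ℕ) : (vlist m).Pairwise (fun p q => q.1 < p.1) := by
  have : ((vlist m).map Prod.fst).Pairwise (fun a b => b < a) := by
    rw [vlist_fst, List.pairwise_reverse]
    exact List.pairwise_lt_range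
  rwa [List.pairwise_map] at this

theorem extMap_sound {A : V → V → Bool} {R R' : Finset V} {g m S : ℕ} {f : ℕ → V}
    (hf : Realizes A R' g m f) (hRR : R' ⊆ R) {x : V} (hx : x ∈ R) (hxf : ∀ i < m, f i ≠ x)
    (hS : S < 2 ^ m) (hb : ∀ i < m, S.testBit i = A x (f i))
    (P : List (ℕ × ℕ × ℕ)) (hP : Good A P R) : (extMap g m P).testBit S = true := by
  induction P with
  | nil => exact full_testBit hS
  | cons q P ih =>
    rw [extMap, Nat.testBit_and, Bool.and_eq_true]
    refine ⟨?_, ih (fun q hq => hP q (List.mem_cons_of_mem _ hq))⟩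
    refine cmb_sound hS _ _ _ _ (vlist_ok hS) (by intro p hp; simp at hp) rfl ?_
    intro l hl hlen
    have hlt : ∀ p ∈ l.reverse, p.1 < m := fun p hp =>
      vlist_lt (hl.subset (List.mem_reverse.1 hp))
    have hpw : l.reverse.Pairwise (fun p q => p.1 < q.1) := by
      rw [List.pairwise_reverse]; exact (vlist_pairwise m).sublist hl
    have key := hP q List.mem_cons_self (x :: l.reverse.map (fun p => f p.1)) ?_ ?_ ?_
    · rw [ec, ← tot_eq hf _ hlt hpw, List.countP_map] at key
      rw [List.append_nil]
      have : l.reverse.countP (fun p => S.testBit p.1) =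
          l.reverse.countP (A x ∘ fun p => f p.1) := by
        apply List.countP_congr
        intro p hp
        rw [hb _ (hlt p hp)]; rfl
      rw [this]; exact key
    · rw [List.nodup_cons]
      constructor
      · intro h
        obtain ⟨p, hp, e⟩ := List.mem_map.1 h
        exact hxf _ (hlt p hp) e
      · rw [List.Nodup, List.pairwise_map]
        refine hpw.imp_of_mem ?_
        intro a b ha hb hab e
        have := hf.inj _ (hlt a ha) _ (hlt b hb) e
        omega
    · intro y hy
      rcases List.mem_cons.1 hy with rfl | hy
      · exact hx
      · obtain ⟨p, hp, rfl⟩ := List.mem_map.1 hy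
        exact hRR (hf.mem _ (hlt p hp))
    · simp [hlen]

/-- degree inside `R` -/
def deg (A : V → V → Bool) (R : Finset V) (x : V) : ℕ := (R.filter (fun y => A x y = true)).card

def degsum (A : V → V → Bool) (R : Finset V) : ℕ := ∑ x ∈ R, deg A R x

theorem Realizes.surj {A : V → V → Bool} {R : Finset V} {g m : ℕ} {f : ℕ → V}
    (hf : Realizes A R g m f) (hc : R.card = m) {y : V} (hy : y ∈ R) : ∃ i < m, f i = y := by
  classical
  have h1 : (Finset.range m).image f ⊆ R := by
    intro z hz
    obtain ⟨i, hi, rfl⟩ := Finset.mem_image.1 hz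
    exact hf.mem _ (Finset.mem_range.1 hi)
  have h2 : ((Finset.range m).image f).card = m := by
    rw [Finset.card_image_of_injOn, Finset.card_range]
    intro i hi j hj e
    exact hf.inj i (by simpa using hi) j (by simpa using hj) e
  have h3 := Finset.eq_of_subset_of_card_le h1 (by omega)
  rw [← h3] at hy
  obtain ⟨i, hi, e⟩ := Finset.mem_image.1 hy
  exact ⟨i, Finset.mem_range.1 hi, e⟩

theorem Realizes.sum {A : V → V → Bool} {R : Finset V} {g m : ℕ} {f : ℕ → V}
    (hf : Realizes A R g m f) (hc : R.card = m) (F : V → ℕ) :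
    ∑ y ∈ R, F y = ∑ i ∈ Finset.range m, F (f i) := by
  symm
  apply Finset.sum_bij (fun i _ => f i)
  · intro i hi; exact hf.mem i (Finset.mem_range.1 hi)
  · intro i hi j hj e; exact hf.inj i (by simpa using hi) j (by simpa using hj) e
  · intro y hy; obtain ⟨i, hi, e⟩ := hf.surj hc hy; exact ⟨i, by simpa using hi, e⟩
  · intro i hi; rfl

theorem countP_range (p : ℕ → Bool) (m : ℕ) :
    (List.range m).countP p = ∑ i ∈ Finset.range m, (p i).toNat := by
  induction m with
  | zero => rfl
  | succ m ih =>
    rw [List.range_succ, List.countP_append, ih, Finset.sum_range_succ]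
    cases h : p m <;> simp [h]

theorem deg_eq (A : V → V → Bool) (R : Finset V) (x : V) :
    deg A R x = ∑ y ∈ R, (A x y).toNat := by
  rw [deg, Finset.card_filter]
  apply Finset.sum_congr rfl
  intro y _; cases A x y <;> rfl

theorem list_sum_vlist (F : ℕ → ℕ) (m : ℕ) :
    ((vlist m).map (fun p => F p.1)).sum = ∑ i ∈ Finset.range m, F i := by
  have : (vlist m).map (fun p => F p.1) = ((vlist m).map Prod.fst).map F := by
    rw [List.map_map]; rfl
  rw [this, vlist_fst, List.map_reverse, List.sum_reverse]
  induction m with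
  | zero => rfl
  | succ m ih =>
    rw [List.range_succ, List.map_append, List.sum_append, Finset.sum_range_succ, ih (by
      rw [List.map_map]; rfl)]
    simp

theorem adS_eq {A : V → V → Bool} (hs : ∀ x y, A x y = A y x) {R : Finset V}
    {g m : ℕ} {f : ℕ → V} (hf : Realizes A R g m f) {a b : ℕ} (ha : a < m) (hb : b < m)
    (hab : a ≠ b) : adS g a b = (A (f a) (f b)).toNat := by
  rw [adS]
  rcases h : Nat.ble b a with _ | _
  · rw [cond_false]
    have : ¬ b ≤ a := fun h' => by rw [Nat.ble_eq_true_of_le h'] at h; cases h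
    exact hf.adj _ _ (by omega) hb
  · rw [cond_true, hs]
    have := Nat.le_of_ble_eq_true h
    exact hf.adj _ _ (by omega) ha

theorem dg_list (g u : ℕ) (l : List (ℕ × ℕ)) : dg g u l =
    (l.map (fun p => bif Nat.beq p.1 u then 0 else adS g u p.1)).sum := by
  induction l with
  | nil => rfl
  | cons y l ih => rw [dg, ih, List.map_cons, List.sum_cons]

theorem dg_eq {A : V → V → Bool} (hs : ∀ x y, A x y = A y x) (hi : ∀ x, A x x = false)
    {R : Finset V} {g m : ℕ} {f : ℕ → V} (hf : Realizes A R g m f) (hc : R.card = m)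
    {u : ℕ} (hu : u < m) : dg g u (vlist m) = deg A R (f u) := by
  rw [dg_list, list_sum_vlist (fun i => bif Nat.beq i u then 0 else adS g u i), deg_eq,
    hf.sum hc]
  apply Finset.sum_congr rfl
  intro i h
  rw [Finset.mem_range] at h
  by_cases e : i = u
  · subst e; simp [hi]
  · have : Nat.beq i u = false := by
      rw [Bool.eq_false_iff]; intro h'; exact e (Nat.eq_of_beq_eq_true h')
    rw [this, cond_false, adS_eq hs hf hu h (Ne.symm e)]

theorem dsum_eq {A : V → V → Bool} (hs : ∀ x y, A x y = A y x) (hi : ∀ x, A x x = false)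
    {R : Finset V} {g m : ℕ} {f : ℕ → V} (hf : Realizes A R g m f) (hc : R.card = m) :
    dsum g (vlist m) (vlist m) = degsum A R := by
  have : ∀ l vs, dsum g vs l = (l.map (fun p => dg g p.1 vs)).sum := by
    intro l vs
    induction l with
    | nil => rfl
    | cons y l ih => rw [dsum, ih, List.map_cons, List.sum_cons]
  rw [this, list_sum_vlist (fun i => dg g i (vlist m)), degsum, hf.sum hc]
  apply Finset.sum_congr rfl
  intro i h
  exact dg_eq hs hi hf hc (Finset.mem_range.1 h)

theorem mdMap_sound {g m S : ℕ} (hS : S < 2 ^ m) (l : List (ℕ × ℕ)) (hv : VOK S l)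
    (h : ∀ u ∈ l, bc S m ≤ dg g u.1 (vlist m) + (S.testBit u.1).toNat) :
    (mdMap g m l).testBit S = true := by
  induction l with
  | nil => exact full_testBit hS
  | cons u l ih =>
    have h1 := ih (fun p hp => hv p (List.mem_cons_of_mem _ hp))
      (fun p hp => h p (List.mem_cons_of_mem _ hp))
    have h2 := h u List.mem_cons_self
    have h3 := hv u List.mem_cons_self
    rw [mdMap, Nat.testBit_and, Nat.testBit_or, Nat.testBit_and, h1, h3, Nat.testBit_xor,
      Nat.testBit_xor, geb_testBit, geb_testBit, full_testBit hS]
    cases hb : S.testBit u.1 <;> simp [hb] at h2 ⊢ <;> omega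

theorem degsum_erase [DecidableEq V] {A : V → V → Bool} (hs : ∀ x y, A x y = A y x)
    (hi : ∀ x, A x x = false) {R : Finset V} {x : V} (hx : x ∈ R) :
    degsum A R = degsum A (R.erase x) + 2 * deg A R x := by
  have h1 : ∀ y, deg A R y = deg A (R.erase x) y + (A y x).toNat := by
    intro y; rw [deg_eq, deg_eq, Finset.sum_erase_add _ _ hx]
  have h2 : degsum A R = ∑ y ∈ R.erase x, deg A R y + deg A R x := by
    rw [degsum, Finset.sum_erase_add _ _ hx]
  have h3 : ∑ y ∈ R.erase x, (A y x).toNat = deg A R x := by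
    rw [deg_eq, ← Finset.sum_erase_add _ _ hx, hi]
    simp [hs x]
  rw [h2, Finset.sum_congr rfl (fun y _ => h1 y), Finset.sum_add_distrib, h3, degsum]
  ring

theorem degsum_even {A : V → V → Bool} (hs : ∀ x y, A x y = A y x)
    (hi : ∀ x, A x x = false) (R : Finset V) : ∃ e, degsum A R = 2 * e := by
  classical
  induction R using Finset.strongInduction with
  | H R ih =>
    rcases R.eq_empty_or_nonempty with rfl | ⟨x, hx⟩
    · exact ⟨0, rfl⟩
    · obtain ⟨e, he⟩ := ih _ (Finset.erase_ssubset hx)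
      exact ⟨e + deg A R x, by rw [degsum_erase hs hi hx, he]; ring⟩

theorem rowOK_sound {G h p j : ℕ} : ∀ {n : ℕ}, rowOK G h p j n = true → ∀ i < n,
    ad h i j = adS G (nib p i) (nib p j) ∧ nib p i ≠ nib p j := by
  intro n
  induction n with
  | zero => intro _ i hi; omega
  | succ n ih =>
    intro H i hi
    rw [rowOK, Bool.and_eq_true, Bool.and_eq_true] at H
    rcases Nat.lt_succ_iff_lt_or_eq.1 hi with h | rfl
    · exact ih H.1 i h
    · refine ⟨Nat.eq_of_beq_eq_true H.2.1, ?_⟩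
      intro e
      have := H.2.2
      rw [e] at this; simp at this

theorem permOK_sound {G h p n : ℕ} : ∀ {k : ℕ}, permOK G h n p k = true → ∀ j < k,
    nib p j < n ∧ ∀ i < j, ad h i j = adS G (nib p i) (nib p j) ∧ nib p i ≠ nib p j := by
  intro k
  induction k with
  | zero => intro _ i hi; omega
  | succ k ih =>
    intro H j hj
    rw [permOK, Bool.and_eq_true, Bool.and_eq_true] at H
    rcases Nat.lt_succ_iff_lt_or_eq.1 hj with h | rfl
    · exact ih H.1 j h
    · exact ⟨Nat.le_of_ble_eq_true H.2.1, rowOK_sound H.2.2⟩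

theorem tri_mono {b m : ℕ} (h : b < m) : b * (b - 1) / 2 + b ≤ m * (m - 1) / 2 := by
  obtain ⟨k, rfl⟩ := Nat.exists_eq_add_of_lt h
  have e1 : b * (b - 1) / 2 + b = (b + 1) * b / 2 := by
    have : (b + 1) * b = b * (b - 1) + b * 2 := by
      cases b with
      | zero => rfl
      | succ b => simp; ring
    rw [this, Nat.add_mul_div_right _ _ (by norm_num)]
  rw [e1]
  apply Nat.div_le_div_right
  exact Nat.mul_le_mul (by omega) (by omega)

/-- the catalogue claim at level `m` -/
def Cl (P : List (ℕ × ℕ × ℕ)) (m thr2 : ℕ) (L : List ℕ) : Prop :=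
  ∀ (V : Type) (A : V → V → Bool), (∀ x y, A x y = A y x) → (∀ x, A x x = false) →
    ∀ R : Finset V, R.card = m → Good A P R → thr2 ≤ degsum A R →
    ∃ g ∈ L, ∃ f, Realizes A R g m f

theorem Good.mono {A : V → V → Bool} {P : List (ℕ × ℕ × ℕ)} {R R' : Finset V}
    (h : Good A P R) (hR : R' ⊆ R) : Good A P R' :=
  fun q hq l hl hm => h q hq l hl (fun x hx => hR (hm x hx))

theorem Cl_one (P : List (ℕ × ℕ × ℕ)) : Cl P 1 0 [0] := by
  intro V A _ _ R hR _ _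
  obtain ⟨x, rfl⟩ := Finset.card_eq_one.1 hR
  refine ⟨0, by simp, fun _ => x, ⟨by simp, ?_, ?_⟩⟩
  · intro i hi j hj _; omega
  · intro a b h1 h2; omega

theorem Cl_step {P : List (ℕ × ℕ × ℕ)} {m t t' : ℕ} {D : List (ℕ × List (ℕ × ℕ × ℕ))}
    {L L' : List ℕ} (hm : Cl P m t L) (hL : D.map Prod.fst = L)
    (har : ∀ Y δ : ℕ, t' ≤ 2 * Y → (m + 1) * δ ≤ 2 * Y → t + 2 * δ ≤ 2 * Y)
    (hok : levelOK P m t' D L' = true) : Cl P (m + 1) t' L' := by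
  classical
  intro V A hs hi R hR hG ht
  have hne : R.Nonempty := Finset.card_pos.1 (by omega)
  obtain ⟨x, hx, hmin⟩ := Finset.exists_min_image R (deg A R) hne
  have hδ : (m + 1) * deg A R x ≤ degsum A R := by
    have := Finset.card_nsmul_le_sum R (deg A R) (deg A R x) hmin
    rw [hR] at this; simpa [degsum] using this
  have hc : (R.erase x).card = m := by rw [Finset.card_erase_of_mem hx]; omega
  have hds := degsum_erase hs hi hx
  obtain ⟨g, hg, f, hf⟩ := hm V A hs hi (R.erase x) hc (hG.mono (Finset.erase_subset _ _))
    (by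
      obtain ⟨Y, hY⟩ := degsum_even hs hi R
      have := har Y _ (hY ▸ ht) (hY ▸ hδ); omega)
  rw [← hL] at hg
  obtain ⟨d, hd, rfl⟩ := List.mem_map.1 hg
  have hst : stepOK P m t' L' d = true := by
    rw [levelOK, List.all_eq_true] at hok; exact hok d hd
  rw [stepOK, Bool.and_eq_true] at hst
  obtain ⟨hst1, hst2⟩ := hst
  obtain ⟨S, hS, hb⟩ : ∃ S : ℕ, S < 2 ^ m ∧ ∀ i < m, S.testBit i = A x (f i) := by
    refine ⟨Nat.ofBits (n := m) (fun i => A x (f i)), Nat.ofBits_lt_two_pow _, ?_⟩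
    intro i hi'
    rw [Nat.testBit_ofBits_lt _ _ hi']
  have hxf : ∀ i < m, f i ≠ x := fun i hi' => (Finset.mem_erase.1 (hf.mem i hi')).1
  have hbc : bc S m = deg A R x := by
    rw [bc, countP_range, deg_eq, ← Finset.sum_erase_add _ _ hx, hi, hf.sum hc]
    simp only [Bool.toNat_false, add_zero]
    apply Finset.sum_congr rfl
    intro i h'; rw [hb i (Finset.mem_range.1 h')]
  have hdeg : ∀ y, deg A R y = deg A (R.erase x) y + (A y x).toNat := by
    intro y; rw [deg_eq, deg_eq, Finset.sum_erase_add _ _ hx]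
  have hX : ((extMap d.1 m P &&& (mdMap d.1 m (vlist m) &&&
      geb m ((t' + 1 - dsum d.1 (vlist m) (vlist m)) / 2))) ||| orS d.2).testBit S = true := by
    rw [Nat.testBit_or, Nat.testBit_and, Nat.testBit_and,
      extMap_sound hf (Finset.erase_subset _ _) hx hxf hS hb P hG,
      mdMap_sound hS _ (vlist_ok hS), geb_testBit, hbc, dsum_eq hs hi hf hc]
    · have : (t' + 1 - degsum A (R.erase x)) / 2 ≤ deg A R x := by omega
      simp [hS, this]
    · intro u hu
      have hu' := vlist_lt hu
      rw [dg_eq hs hi hf hc hu', hb _ hu', hs x, ← hdeg, hbc]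
      exact hmin _ (Finset.mem_of_mem_erase (hf.mem _ hu'))
  rw [Nat.eq_of_beq_eq_true hst1] at hX
  obtain ⟨c, hc', hcS⟩ := orS_testBit _ hX
  have hco := List.all_eq_true.1 hst2 c hc'
  rw [certOK, hcS] at hco
  rcases hh : L'[c.2.1]? with _ | h
  · rw [hh] at hco; cases hco
  rw [hh] at hco
  have hpm := permOK_sound hco
  have hfx : Realizes A R (ext d.1 m S) (m + 1) (fun i => if i < m then f i else x) := by
    refine ⟨?_, ?_, ?_⟩
    · intro i hi'
      by_cases h1 : i < m
      · simpa [h1] using Finset.mem_of_mem_erase (hf.mem i h1)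
      · simpa [h1] using hx
    · intro i hi' j hj e
      by_cases h1 : i < m <;> by_cases h2 : j < m <;> simp only [h1, h2, if_true, if_false] at e
      · exact hf.inj i h1 j h2 e
      · exact absurd e (hxf i h1)
      · exact absurd e.symm (hxf j h2)
      · omega
    · intro a b hab hbm
      have ha : a < m := by omega
      rw [ad_eq, ext, Nat.testBit_or, Nat.testBit_mod_two_pow, Nat.testBit_shiftLeft]
      by_cases h2 : b < m
      · have := tri_mono h2
        have h3 : b * (b - 1) / 2 + a < m * (m - 1) / 2 := by omega
        have h4 : ¬ (m * (m - 1) / 2 ≤ b * (b - 1) / 2 + a) := by omega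
        simp only [h3, h4, ha, h2, if_true, decide_true, decide_false, Bool.true_and,
          Bool.false_and, Bool.or_false]
        rw [← ad_eq, hf.adj a b hab h2]
      · have : b = m := by omega
        subst this
        simp [ha, hb a ha, hs x]
  refine ⟨h, List.mem_of_getElem? hh, fun i => (fun i => if i < m then f i else x) (nib c.2.2 i),
    ⟨?_, ?_, ?_⟩⟩
  · intro i hi'; exact hfx.mem _ (hpm i hi').1
  · intro i hi' j hj e
    have e' := hfx.inj _ (hpm i hi').1 _ (hpm j hj).1 e
    rcases lt_trichotomy i j with h1 | h1 | h1
    · exact absurd e' ((hpm j hj).2 i h1).2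
    · exact h1
    · exact absurd e'.symm ((hpm i hi').2 j h1).2
  · intro a b hab hbm
    have h1 := (hpm b hbm).2 a hab
    rw [h1.1, adS_eq hs hfx (hpm a (by omega)).1 (hpm b hbm).1 h1.2]

/-! ### Catalogue data -/

def datA1 : List (ℕ × List (ℕ × ℕ × ℕ)) :=
  [(0, [(0, 0, 16), (1, 1, 16)])]
def datA2 : List (ℕ × List (ℕ × ℕ × ℕ)) :=
  [(0, [(0, 0, 528)]),
   (1, [(0, 1, 528), (1, 2, 528), (2, 2, 513), (3, 3, 528)])]
def datA3 : List (ℕ × List (ℕ × ℕ × ℕ)) :=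
  [(0, []),
   (1, []),
   (3, [(6, 0, 12816)]),
   (7, [(1, 1, 12816), (2, 1, 12801), (4, 1, 12546)])]
def datA4 : List (ℕ × List (ℕ × ℕ × ℕ)) :=
  [(51, [(3, 0, 274960), (5, 0, 274720), (6, 1, 274960), (9, 1, 271105), (10, 0, 270385), (12, 0, 266290)]),
   (15, [(9, 2, 274960), (10, 0, 148240), (12, 0, 82720)])]
def datA5 : List (ℕ × List (ℕ × ℕ × ℕ)) :=
  [(243, [(5, 0, 5517840), (6, 1, 5517840), (9, 1, 5513985), (10, 0, 5513985), (12, 2, 5517840), (20, 3, 5517840), (24, 3, 5513985), (28, 4, 5517840)]),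
   (435, [(3, 1, 4534800), (5, 1, 4534560), (6, 5, 5517840), (9, 6, 5517840), (10, 1, 4522515), (12, 1, 4522275), (17, 6, 5456400), (18, 1, 3473940), (20, 1, 3473700), (24, 6, 336945), (25, 7, 5517840)]),
   (591, [(10, 0, 4346640), (12, 0, 4281120), (18, 0, 3298320), (20, 0, 3232800)])]
def datA6 : List (ℕ × List (ℕ × ℕ × ℕ)) :=
  [(5363, [(6, 0, 106181136), (9, 1, 106181136), (10, 2, 106181136), (12, 2, 105197856), (20, 3, 106181136), (24, 4, 106181136), (34, 3, 105197856), (40, 4, 105197856), (48, 5, 106181136), (56, 6, 106181136)]),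
   (6387, [(5, 0, 90452496), (9, 7, 106181136), (10, 1, 90448641), (12, 8, 106181136), (20, 9, 106181136), (24, 10, 106181136), (33, 7, 104092176), (34, 1, 56894721), (36, 8, 104092176), (40, 11, 106181136), (48, 10, 104092176), (56, 12, 106181136)]),
   (12531, [(5, 2, 88486176), (6, 8, 90452496), (9, 8, 90448641), (10, 2, 88481841), (20, 13, 106181136), (24, 13, 106177281), (33, 13, 105189426), (34, 13, 105185571), (48, 14, 106181136)]),
   (20723, [(5, 3, 90452496), (6, 9, 90452496), (9, 10, 90448641), (10, 4, 90448641), (12, 13, 90452496), (20, 9, 56709696), (24, 15, 106181136), (33, 10, 56698116), (34, 15, 103895616), (36, 13, 56709696), (40, 16, 106181136), (41, 12, 90448641), (42, 6, 90448641), (48, 4, 56698116), (56, 6, 56698116)]),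
   (28915, [(1, 17, 106181136), (2, 17, 106177281), (4, 17, 105189426), (5, 18, 106181136), (6, 19, 106181136), (8, 17, 105185571), (9, 19, 106177281), (10, 18, 106177281), (16, 17, 103884036), (20, 19, 103895616), (24, 19, 102781761), (32, 17, 101909541), (33, 19, 101924946), (34, 19, 100811091), (48, 18, 103884036)]),
   (6579, [(9, 20, 106181136), (17, 20, 106119696), (24, 20, 105923091), (33, 20, 105075216), (40, 20, 104878611), (48, 20, 103830036)]),
   (9651, [(3, 7, 88486416), (5, 7, 88486176), (6, 20, 90452496), (9, 20, 73736961), (10, 7, 72753201), (12, 7, 72749106), (17, 21, 106181136), (18, 11, 87425556), (20, 11, 87425316), (24, 21, 106168851), (33, 11, 69604101), (34, 21, 105194241), (36, 21, 105190146), (40, 11, 69603381), (48, 22, 106181136), (49, 12, 69604101), (50, 12, 87425556), (52, 12, 87425316), (56, 12, 69603381)]),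
   (26035, [(1, 23, 106181136), (2, 23, 105194241), (3, 24, 106181136), (4, 23, 105190146), (5, 24, 106180896), (6, 25, 106181136), (8, 23, 106168851), (9, 25, 105194241), (10, 24, 105193521), (12, 24, 105189426), (16, 23, 106103316), (17, 25, 104145921), (18, 24, 104144961), (20, 24, 104140866), (24, 25, 101000241), (25, 26, 106181136), (32, 23, 104993541), (33, 24, 103035216), (34, 25, 103036176), (36, 25, 101987616), (38, 26, 105194241), (40, 24, 103022931), (48, 24, 102957396)])]
def datA7 : List (ℕ × List (ℕ × ℕ × ℕ)) :=
  [(201971, []),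
   (300275, [(112, 0, 1985229328)]),
   (333043, [(112, 1, 1985229328)]),
   (660723, [(104, 2, 1985229328)]),
   (791795, [(98, 2, 1732587808), (104, 3, 1985229328), (112, 1, 908162368)]),
   (1578227, [(73, 0, 1733571088), (74, 1, 1733571088), (76, 1, 1732587808), (88, 1, 924935488), (104, 1, 923952208)]),
   (1840371, [(6, 4, 1985229328), (9, 5, 1985229328), (10, 6, 1985229328), (12, 6, 1984246048), (20, 7, 1985229328), (24, 8, 1985229328), (28, 9, 1985229328), (34, 7, 1984246048), (40, 8, 1984246048), (42, 9, 1984246048), (48, 4, 1931568448), (56, 10, 1985229328), (65, 5, 1931568448), (66, 8, 1931568448), (68, 8, 1930585168), (70, 10, 1931568448), (72, 11, 1985229328), (73, 12, 1985229328), (80, 6, 1931568448), (84, 9, 1930585168), (96, 6, 1930585168), (98, 9, 1931568448)]),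
   (301299, [(112, 13, 1985229328)]),
   (399603, [(112, 14, 1985229328)]),
   (661747, [(104, 15, 1985229328)]),
   (792819, [(97, 13, 1731482128), (98, 0, 1668556033), (100, 14, 1731482128), (104, 16, 1985229328), (112, 2, 621228388)]),
   (1317107, [(84, 15, 1733571088), (88, 16, 1733571088), (112, 16, 1731482128)]),
   (1841395, [(5, 17, 1985229328), (9, 18, 1985229328), (10, 19, 1985229328), (12, 20, 1985229328), (20, 21, 1985229328), (24, 18, 1917859348), (28, 22, 1985229328), (33, 18, 1983140368), (34, 19, 1983140368), (36, 20, 1983140368), (40, 23, 1985229328), (41, 24, 1985229328), (48, 18, 1915770388), (52, 22, 1983140368), (56, 24, 1917859348), (65, 21, 1917859348), (69, 10, 1394698048), (72, 20, 1917859348), (73, 22, 1917859348), (80, 17, 1917859348), (84, 10, 1398875908), (96, 20, 1915770388), (97, 22, 1915770388)]),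
   (667891, [(97, 16, 1399924228), (98, 25, 1985229328), (112, 3, 1399924228)]),
   (1585395, [(69, 1, 1699164448), (70, 14, 1702113808), (73, 14, 1702109953), (74, 1, 1699160113), (84, 3, 1398875908), (88, 3, 1382037268), (97, 3, 1097008933), (98, 3, 1080170293)]),
   (807155, [(97, 13, 845240128), (98, 13, 592471873), (100, 25, 1668371008), (104, 25, 1383097153)]),
   (1331443, [(69, 2, 1702113808), (70, 15, 1702113808), (73, 14, 1445229313), (84, 15, 1668371008), (88, 25, 1382052673), (97, 14, 908162308), (98, 25, 845182228)]),
   (61683, []),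
   (192755, [(6, 26, 1985229328), (9, 26, 1984237618), (10, 27, 1985229328), (20, 26, 1982943808), (24, 28, 1985229328), (33, 26, 1980973138), (34, 28, 1982943808), (48, 27, 1982943808), (66, 29, 1985229328), (72, 29, 1984237618), (74, 30, 1985229328), (80, 29, 1982943808), (88, 9, 1466184208), (96, 29, 1980973138), (98, 9, 929124928), (112, 30, 829838368)]),
   (225523, [(5, 26, 1733571088), (9, 31, 1985229328), (10, 26, 1732575523), (24, 32, 1985229328), (33, 32, 1984233763), (48, 28, 1731273988), (65, 33, 1985229328), (66, 34, 1985229328), (68, 34, 1984233763), (72, 33, 1984233763), (73, 35, 1985229328), (80, 36, 1985229328), (84, 12, 74782258), (88, 22, 1466184208), (96, 36, 1984233763), (97, 22, 1197801763), (98, 12, 896804353), (112, 9, 913384708)]),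
   (301491, [(112, 37, 1985229328)]),
   (566707, [(98, 38, 1985229328), (100, 38, 1985229088), (104, 15, 1176965173), (112, 15, 891752518)]),
   (1582515, [(67, 13, 1699164688), (69, 13, 1699164448), (70, 37, 1702113808), (73, 37, 1685398273), (74, 13, 1683431473), (76, 13, 1683427378), (81, 15, 891686983), (88, 15, 86381383), (98, 15, 607519063), (100, 15, 339083863)]),
   (58803, []),
   (124339, [(5, 39, 1985229328), (10, 39, 1984242433), (12, 40, 1985229328), (18, 39, 1983194113), (20, 40, 1985167888), (33, 39, 1982084368), (40, 40, 1982084368), (48, 40, 1982022928), (68, 41, 1985229328), (72, 41, 1984242433), (76, 35, 1417032208), (80, 41, 1983194113), (84, 35, 1400259088), (88, 24, 1464218128), (96, 41, 1982084368), (100, 24, 1196827393), (104, 35, 611726608), (112, 35, 594953488)]),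
   (222643, [(9, 42, 1985229328), (17, 42, 1985167888), (24, 42, 1728390193), (65, 43, 1985229328), (72, 43, 1985217043), (73, 44, 1985229328), (80, 43, 1985151508), (81, 44, 1985167888), (88, 44, 1728390193), (97, 24, 1176965893), (104, 24, 1176965173), (112, 24, 908529733)]),
   (845235, [(6, 45, 1985229328), (34, 45, 1982084368), (36, 45, 1981035808), (38, 46, 1985229328), (66, 45, 1965307408), (68, 45, 1964258848), (70, 46, 1969500688), (96, 45, 1913927248), (98, 46, 1919169808), (100, 46, 1902392608), (102, 47, 1985229328)])]
def datA8 : List (ℕ × List (ℕ × ℕ × ℕ)) :=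
  [(235181299, [(28, 0, 36344967696), (42, 0, 36343984416), (70, 1, 36344967696), (84, 2, 36344967696), (88, 3, 36344967696), (98, 2, 36343984416), (104, 3, 36343984416), (112, 1, 35267900736), (148, 0, 35266917456), (162, 0, 35267900736), (194, 3, 35267900736), (196, 3, 35266917456)]),
   (235214067, [(28, 4, 36344967696), (56, 5, 36344967696), (84, 5, 36329235201), (112, 6, 36344967696), (140, 7, 36344967696), (148, 8, 36344967696), (152, 8, 36329235201), (162, 9, 36344967696), (168, 10, 36344967696), (193, 9, 36329235201), (196, 10, 36329235201)]),
   (218764531, [(28, 0, 6280134786), (42, 11, 36344967696), (56, 12, 36344967696), (70, 0, 19114889346), (74, 13, 36344967696), (88, 13, 36294451776), (98, 12, 36294451776), (112, 11, 36294451776), (137, 14, 36344967696), (152, 15, 36344967696), (162, 5, 14570100741), (176, 5, 26599376901), (193, 14, 36294451776), (194, 15, 36294451776)]),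
   (218895603, [(28, 9, 5469926706), (42, 9, 10050102321), (70, 16, 36344967696), (84, 17, 36344967696), (98, 15, 31814136096), (112, 10, 30910011396), (134, 16, 36092326176), (148, 15, 27788587536), (162, 17, 36092326176), (176, 10, 26599376901)]),
   (14423283, [(137, 18, 36344967696), (148, 19, 36344967696), (152, 20, 36344967696), (162, 19, 36343984416), (168, 20, 36343984416), (176, 21, 36344967696), (200, 22, 36344967696), (208, 5, 14900356416), (224, 5, 14899373136)]),
   (20714739, [(134, 18, 32318435856), (148, 23, 36344967696), (162, 23, 36343984416), (193, 24, 36344967696), (194, 25, 36344967696), (196, 25, 36343984416), (208, 26, 36344967696), (224, 26, 36343984416)]),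
   (22811891, [(148, 27, 36344967696), (176, 5, 28040245776), (193, 26, 32264774976), (196, 13, 23730594561), (208, 28, 36344967696), (224, 17, 10828669761)]),
   (43783411, [(134, 19, 32318435856), (137, 23, 32318435856), (138, 27, 32318435856), (152, 26, 23126358036), (162, 29, 36344967696), (168, 12, 28040245776), (176, 19, 32263791696), (193, 23, 32263791696), (194, 12, 15151031376), (196, 26, 5174749266), (200, 30, 36344967696), (224, 27, 32263791696)]),
   (52172019, [(134, 20, 32318435856), (148, 26, 23127406356), (162, 12, 27787604256), (193, 25, 32264774976), (194, 31, 36344967696), (196, 32, 36344967696), (224, 13, 6232884741)]),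
   (60560627, [(6, 33, 36344967696), (10, 34, 36344967696), (34, 35, 36344967696), (42, 36, 36344967696), (65, 37, 36344967696), (66, 38, 36344967696), (68, 37, 34734293106), (70, 39, 36344967696), (72, 40, 36344967696), (73, 41, 36344967696), (80, 40, 34734293106), (84, 41, 34734293106), (96, 42, 36344967696), (98, 43, 36344967696), (129, 33, 34734293106), (130, 44, 36344967696), (144, 34, 34734293106), (160, 35, 34734293106), (162, 45, 36344967696), (176, 36, 6546605826), (192, 38, 34734293106), (193, 39, 34734293106), (194, 46, 36344967696), (224, 43, 6510044466), (226, 47, 36344967696)]),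
   (119280883, [(6, 48, 36344967696), (66, 49, 36344967696), (68, 49, 36343984416), (70, 50, 36344967696), (84, 39, 32263791696), (98, 39, 32264774976), (130, 49, 36093309456), (132, 49, 36092326176), (134, 50, 36093309456), (148, 39, 27968828496), (162, 39, 27969811776), (192, 51, 36344967696), (193, 52, 36344967696), (194, 53, 36344967696), (196, 53, 36343984416), (198, 54, 36344967696)]),
   (152835315, [(134, 22, 32318435856), (148, 30, 32318435856), (162, 30, 32317452576), (176, 22, 32264774976)]),
   (154932467, [(20, 55, 36344967696), (28, 41, 32318435856), (34, 55, 36343984416), (42, 41, 32317452576), (84, 41, 32263791696), (98, 41, 32264774976), (129, 56, 36344967696), (130, 57, 36344967696), (132, 57, 36343984416), (134, 58, 36344967696), (144, 57, 36291306816), (148, 59, 36344967696), (160, 57, 36290323536), (162, 59, 36343984416), (176, 58, 36291306816)]),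
   (235182323, [(28, 60, 36344967696), (52, 61, 36344967696), (88, 61, 36329235201), (97, 23, 13543821696), (98, 23, 9517228161), (100, 62, 36344967696), (104, 62, 36329235201), (112, 63, 36344967696), (140, 64, 36344967696), (148, 12, 22382321796), (152, 12, 26391032196)]),
   (235280627, [(41, 65, 36344967696), (52, 14, 1199969586), (56, 66, 36344967696), (97, 66, 36311531811), (98, 14, 14621615361), (112, 67, 36344967696), (137, 64, 27788587536), (152, 15, 26391032196), (161, 68, 36344967696), (168, 68, 36311531811), (193, 15, 17535795846)]),
   (218765555, [(56, 69, 36344967696), (74, 25, 31512338481), (88, 32, 31465743876), (98, 25, 30975467601), (112, 32, 30962427396), (137, 66, 23155118136), (161, 66, 14565183576), (193, 67, 22399780356)]),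
   (218896627, [(28, 3, 1366443651), (52, 68, 1176007506), (69, 22, 31516275216), (84, 13, 1383600966), (98, 3, 30652327041), (100, 68, 31746162981), (112, 13, 30686064996), (133, 16, 23207620896), (161, 16, 9670497111), (176, 22, 612767031)]),
   (12327155, [(138, 70, 36344967696), (152, 20, 27253813776), (162, 70, 36342878736), (168, 71, 36344967696), (176, 20, 26716951056), (200, 16, 23730598416), (208, 6, 22383003456), (224, 16, 15140672016)]),
   (20715763, [(148, 72, 36344967696), (162, 2, 10527728961), (164, 73, 36344967696), (193, 25, 22121035536), (208, 20, 10057954836), (224, 66, 10606368276)]),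
   (22812915, [(133, 70, 32318435856), (148, 23, 27253809921), (161, 2, 10828669761), (164, 74, 36344967696), (176, 2, 28008784641), (193, 23, 10073695041), (208, 70, 32251065876), (224, 74, 36277597716)]),
   (27007219, [(161, 73, 32316346896), (162, 74, 32316346896), (176, 66, 28040245776), (193, 62, 19428495651), (208, 16, 23395841556), (224, 75, 36344967696)]),
   (43784435, [(137, 72, 32318435856), (138, 23, 27238081281), (152, 25, 23126358036), (161, 72, 32316346896), (162, 23, 26701210881), (168, 69, 28040245776), (176, 25, 14536431636), (193, 63, 22320085056), (200, 62, 1917342051), (224, 62, 1917333861)]),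
   (60561651, [(5, 76, 36344967696), (34, 77, 36344967696), (65, 78, 36344967696), (69, 39, 23463211536), (72, 77, 34450052151), (73, 59, 21751809651), (96, 79, 36344967696), (97, 80, 36344967696), (129, 81, 36344967696), (144, 76, 34450052151), (160, 78, 34450052151), (161, 82, 36344967696), (162, 59, 26701210881), (176, 39, 25862214711), (193, 82, 22152246081), (224, 80, 2216125746), (225, 83, 36344967696)]),
   (85727475, [(133, 71, 32318435856), (148, 69, 27788587536), (193, 69, 10608457236), (208, 71, 32251065876)]),
   (87824627, [(69, 52, 31459469376), (84, 53, 31463647236), (148, 84, 36344967696), (193, 52, 9989875776), (208, 53, 9988831236), (212, 54, 31463647236)]),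
   (206188787, [(73, 62, 19160989746), (74, 26, 23387661441), (88, 30, 23412680196), (112, 15, 14352983556), (133, 26, 18810434946), (137, 62, 23205282561), (161, 30, 18799007541), (176, 15, 1182930741), (193, 85, 36344967696), (200, 85, 36092313891)]),
   (12775667, [(194, 86, 36344967696), (200, 70, 22690541856), (208, 19, 22420943376), (224, 0, 19451416626)]),
   (21164275, [(208, 4, 23746327056), (224, 4, 19451416626)]),
   (50524403, [(194, 11, 23492702496), (200, 9, 5486511666), (208, 9, 22399780416), (224, 11, 6311789826)]),
   (138604787, [(134, 86, 32318435856), (137, 70, 18648273666), (148, 19, 14350910016), (152, 11, 23744360736), (161, 0, 14904545856), (162, 9, 14363686416), (176, 4, 14904545856), (200, 28, 22607435526), (208, 87, 36344967696), (224, 8, 14365651296)]),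
   (155382003, [(6, 88, 36344967696), (9, 88, 36093305601), (20, 89, 36344967696), (24, 89, 36093305601), (33, 89, 36343975986), (34, 89, 36092313891), (48, 90, 36344967696), (66, 89, 35776770336), (72, 89, 35525104386), (80, 91, 36344967696), (88, 36, 31547732496), (96, 91, 35525104386), (98, 36, 19198776066), (112, 92, 36344967696), (129, 89, 35775782961), (132, 89, 35524117011), (144, 91, 36093305601), (148, 36, 27253809921), (160, 91, 35524117011), (161, 36, 18930401811), (176, 92, 36093305601), (192, 90, 35776770336), (208, 92, 35776770336), (224, 92, 35525104386), (240, 93, 36344967696)]),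
   (19099891, [(193, 74, 22651867911), (194, 74, 22669689366), (196, 74, 18640023846), (200, 74, 18624290871), (208, 60, 23746327056), (224, 60, 19435687986)]),
   (50557171, [(193, 61, 23491535376), (194, 3, 23412876801), (196, 14, 1196954466), (200, 3, 1635927891), (208, 14, 22112907636), (224, 61, 1746039861)]),
   (136540403, [(137, 74, 22651802376), (138, 70, 18646303251), (152, 61, 23743193616), (161, 3, 14536497216), (176, 11, 14614536276), (200, 75, 22601535591), (208, 94, 36344967696), (224, 68, 14363686401)]),
   (138637555, [(133, 86, 31815119376), (137, 74, 22686401046), (152, 3, 23680263681), (161, 14, 14365958241), (176, 9, 13527709716)]),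
   (153317619, [(5, 95, 36344967696), (10, 95, 36093305601), (48, 96, 36344967696), (66, 97, 36344967696), (68, 97, 36343972131), (84, 58, 30140601906), (98, 58, 30962624001), (112, 46, 30979204356), (129, 97, 36093305601), (136, 97, 36092317746), (152, 58, 26114066211), (161, 58, 26399225616), (176, 46, 26432517396), (192, 98, 36344967696), (208, 99, 36344967696), (224, 99, 36092317746), (240, 47, 30979204356)]),
   (167997683, [(133, 19, 22406259216), (137, 60, 23494668816), (138, 0, 23463207681), (152, 14, 22112842116), (161, 61, 14615151876), (193, 94, 32318435856), (200, 68, 1192592946), (224, 85, 14269052481)]),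
   (235182515, [(81, 69, 14347015176), (88, 69, 1462113336), (97, 69, 14078579976), (104, 69, 1193678136), (112, 100, 36344967696), (137, 100, 36090958356), (145, 69, 22383366216), (152, 69, 21578060616), (161, 69, 18088398936), (168, 69, 17283093336)]),
   (206087603, []),
   (10610099, [(200, 18, 22690542096), (208, 18, 22422110736), (224, 1, 19418984976)]),
   (25290163, [(208, 65, 23744360976), (224, 65, 19450438401)]),
   (142730675, [(138, 18, 18648277761), (146, 18, 14353310721), (161, 1, 19101267216), (168, 65, 19195646721), (176, 65, 14900679681), (200, 31, 22607374086), (208, 31, 22355715846)]),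
   (19097011, []),
   (136537523, []),
   (153314739, [(240, 54, 9402914376)]),
   (13428147, []),
   (80537011, []),
   (214754739, [])]
def datA9 : List (ℕ × List (ℕ × ℕ × ℕ)) :=
  [(7751374067, []),
   (19025663219, []),
   (22783759603, []),
   (23857501427, []),
   (7751406835, []),
   (15267599603, [(452, 0, 654820258320)]),
   (30299985139, [(396, 1, 654820258320)]),
   (37816177907, [(368, 1, 590395748880)]),
   (39963661555, []),
   (43721757939, []),
   (45332370675, [(340, 0, 590380016385)]),
   (11493053683, []),
   (15251150067, [(450, 2, 654820258320)]),
   (20082988275, [(432, 0, 509314605825)]),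
   (36994422003, []),
   (41020953843, [(354, 2, 590345232960)]),
   (19009377523, [(432, 0, 447600563280)]),
   (22767473907, [(418, 3, 654820258320)]),
   (36790080755, []),
   (39742870771, []),
   (40816612595, [(480, 0, 564671964240)]),
   (47259063539, [(456, 4, 654820258320)]),
   (53701514483, [(432, 4, 590395748880)]),
   (39749162227, []),
   (51828757747, []),
   (52097193203, []),
   (55855289587, []),
   (39751259379, [(480, 3, 233959687200)]),
   (55857386739, []),
   (43530327283, [(456, 5, 654820258320)]),
   (53730874611, [(418, 5, 590395748880)]),
   (52128650483, []),
   (52665521395, [(418, 2, 577560195360)]),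
   (1671173363, []),
   (2744915187, []),
   (9187366131, []),
   (11334849779, [(73, 6, 654820258320), (193, 7, 654820258320), (194, 8, 654820258320), (224, 9, 654820258320), (321, 7, 650792743200), (324, 8, 650792743200), (336, 9, 650792743200), (385, 10, 654820258320), (400, 11, 654820258320), (416, 11, 650792743200), (448, 12, 654820258320), (449, 13, 654820258320)]),
   (17508865267, []),
   (17777300723, []),
   (18851042547, [(176, 7, 588785074290), (290, 14, 654820258320), (400, 15, 654820258320), (416, 16, 654820258320), (418, 17, 654820258320), (432, 13, 556570855170)]),
   (19387913459, []),
   (19656348915, [(42, 6, 590395748880), (98, 18, 654820258320), (162, 19, 654820258320), (262, 20, 654820258320), (290, 21, 654820258320), (385, 6, 92684093475), (386, 21, 624187277955), (400, 18, 350310909795), (416, 19, 624187277955), (418, 17, 280942183170)]),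
   (25830364403, []),
   (26367235315, [(73, 18, 590395748880), (176, 9, 588785074290), (262, 9, 520817610885), (385, 22, 654820258320), (386, 23, 654820258320), (400, 23, 650740065600)]),
   (34957169907, []),
   (43547104499, [(73, 19, 590395748880), (84, 19, 588785074290), (262, 19, 452185231410), (321, 24, 654820258320), (322, 25, 654820258320), (324, 24, 645458759730), (326, 17, 590395748880), (328, 25, 645458759730), (329, 17, 280925410050), (336, 25, 645189956160), (340, 17, 237969445920), (385, 19, 451916427840), (448, 25, 653209583730), (449, 17, 88151004930)]),
   (52137039091, [(42, 8, 590395748880), (176, 8, 588785074290), (290, 26, 654820258320), (416, 26, 653209583730)]),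
   (60726973683, [(10, 27, 654820258320), (42, 28, 654820258320), (72, 27, 624985335090), (73, 28, 624985335090), (80, 27, 650740065600), (84, 28, 650740065600), (144, 27, 645189956160), (176, 28, 645189956160), (258, 27, 633090639120), (262, 28, 633090639120), (384, 27, 637282780530), (385, 28, 637282780530)]),
   (1729893619, []),
   (17836020979, []),
   (18909762803, [(404, 13, 212441843970), (418, 13, 216736749825)]),
   (51658888435, []),
   (51927323891, []),
   (52195759347, []),
   (53269501171, []),
   (5523641587, []),
   (34783106291, []),
   (35051541747, []),
   (36125283571, [(28, 20, 582342685200), (42, 20, 582341701920), (276, 29, 654820258320), (290, 29, 654819275040), (400, 30, 654820258320), (416, 30, 654819275040), (432, 31, 654820258320)]),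
   (39883379955, [(42, 21, 582341701920), (98, 21, 582289024320), (290, 32, 654820258320), (298, 17, 353941877505), (354, 17, 86848468485), (386, 33, 654820258320), (416, 33, 654765614160), (418, 34, 654820258320)]),
   (7751375091, []),
   (14193826035, []),
   (27078727923, [(408, 2, 152564754180)]),
   (30299953395, [(396, 35, 654820258320)]),
   (37816146163, [(368, 35, 590395748880)]),
   (11241134323, []),
   (15267666163, [(449, 2, 91275561270)]),
   (30300051699, [(393, 35, 448712159760)]),
   (43453389043, []),
   (15251151091, [(449, 35, 503358515520)]),
   (37056420083, []),
   (45109483763, [(464, 1, 572138821440)]),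
   (39749163251, [(480, 2, 81679231065)]),
   (44044130547, [(464, 0, 151801720980)]),
   (44046227699, []),
   (60156549363, []),
   (1402738931, []),
   (9187367155, []),
   (17508866291, []),
   (25830365427, []),
   (26098800883, [(385, 36, 654820258320), (400, 36, 650724267540)]),
   (34688735475, []),
   (43278670067, [(321, 37, 654820258320), (328, 37, 645458755875), (329, 17, 281142633225)]),
   (60458539251, []),
   (39816272115, []),
   (52014231795, []),
   (52089254131, []),
   (55973179635, []),
   (1765994739, []),
   (5524091123, []),
   (13040283891, []),
   (21630218483, []),
   (30220153075, [(148, 11, 577026401025), (161, 11, 576758022435), (208, 38, 654820258320), (224, 38, 589575885570), (262, 11, 507770905860), (265, 11, 507234157605), (322, 38, 520521929760), (328, 38, 520018609410), (385, 39, 654820258320), (388, 39, 654819266610)]),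
   (64579891443, [(6, 40, 654820258320), (9, 40, 654568596225), (20, 40, 649370948640), (24, 40, 644790834225), (33, 40, 648867628290), (34, 40, 644287513875), (66, 40, 640797668880), (72, 40, 635932341810), (80, 40, 632743364160), (88, 41, 654820258320), (96, 40, 623851570770), (98, 41, 649370948640), (129, 40, 640546006785), (132, 40, 635680679715), (144, 40, 628464060225), (148, 41, 640797668880), (160, 40, 619572266835), (161, 41, 644790834225), (257, 40, 631988381700), (258, 40, 627960739860), (260, 40, 622844930085), (262, 41, 632743364160), (264, 40, 618817288245), (265, 41, 628464060225)]),
   (55971115251, []),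
   (1495494899, []),
   (13038219507, []),
   (17870057715, []),
   (51692925171, []),
   (55987892467, [(98, 29, 580719486465), (161, 29, 576156088080), (261, 29, 358505275920), (266, 29, 353941877505)]),
   (30299953587, [(393, 42, 654820258320)])]
def datA10 : List (ℕ × List (ℕ × ℕ × ℕ)) :=
  [(31076471084275, [(156, 0, 11649936536080)]),
   (27243212772595, []),
   (30939015681267, []),
   (28747508749555, []),
   (31383340455155, [(212, 1, 11649936536080), (226, 1, 11649935552800), (284, 1, 11640306430480), (298, 1, 11640305447200)]),
   (31379611718899, []),
   (5027856651507, [(897, 2, 11649936536080), (912, 3, 11649936536080), (928, 3, 11645909020960)]),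
   (13274193859827, [(928, 0, 2845319581825)]),
   (13342913336563, [(928, 4, 11649936536080)]),
   (15404497638643, [(897, 1, 2862419567425)]),
   (26468333393139, [(585, 2, 10619144385040), (736, 1, 2926844076865), (848, 1, 1827583058770)]),
   (27499125544179, [(585, 3, 10619144385040), (833, 0, 1814780133490), (836, 4, 10615116869920)]),
   (30797660427507, []),
   (30866379904243, []),
   (19947499295987, [(688, 0, 575948477095)]),
   (27506641736947, []),
   (28606153364723, []),
   (28743592318195, []),
   (6754165069043, [(897, 3, 10008690819715), (898, 5, 11649936536080), (912, 5, 11512980792640)]),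
   (11152211580147, [(774, 6, 11649936536080), (897, 3, 9988557178915)]),
   (18024159253747, [(674, 6, 10619144385040), (928, 6, 1414830326530)]),
   (19948304602355, [(912, 5, 10588511404675)]),
   (26483365778675, [(585, 3, 8904884224675)]),
   (26552085255411, [(585, 5, 10490295366160)]),
   (22102499136755, []),
   (22171218613491, []),
   (19980785292531, [(688, 4, 10488684691570)]),
   (747921741043, []),
   (2946944996595, [(592, 7, 11649936536080), (596, 8, 11649936536080), (656, 9, 11649936536080), (688, 10, 11649936536080), (896, 7, 11640575037490), (897, 8, 6917455155970)]),
   (19002700862707, [(554, 6, 9447422636320)]),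
   (27523915977971, [(554, 6, 2578752762625)]),
   (29722939233523, [(340, 8, 10252479628330), (354, 8, 10184028587290), (540, 8, 6975422399530), (554, 8, 6906971358490)]),
   (19968531633395, []),
   (26565601400051, [(610, 5, 2557764466945)]),
   (28764624655603, []),
   (27243212740851, []),
   (26483097344243, []),
   (22102230702323, []),
   (14323871314163, [(774, 0, 663161541685), (777, 4, 8321133707845)]),
   (26487218696435, []),
   (476896751859, []),
   (6111893844211, [(546, 11, 11649936536080), (610, 10, 9321578770960), (644, 11, 11649368338720), (660, 10, 9184674722080), (769, 11, 11635662284545), (777, 10, 5680248678145)]),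
   (27037054310835, [])]
def datA11 : List (ℕ × List (ℕ × ℕ × ℕ)) :=
  [(5519838516942067, []),
   (7490470223287539, []),
   (31565409620333811, []),
   (32093175201666291, []),
   (32664440211772659, []),
   (31602320300840179, []),
   (27243856208336115, []),
   (20832095221585139, []),
   (20972832709940467, [(1921, 0, 205163983024656)]),
   (23083895035270387, []),
   (24209794942113011, []),
   (19216779054346483, [])]
def datA12 : List (ℕ × List (ℕ × ℕ × ℕ)) :=
  [(69232291906139722995, [])]
def datDD1 : List (ℕ × List (ℕ × ℕ × ℕ)) :=
  [(0, [(0, 0, 16), (1, 1, 16)])]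
def datDD2 : List (ℕ × List (ℕ × ℕ × ℕ)) :=
  [(0, [(0, 0, 528)]),
   (1, [(0, 1, 528), (1, 2, 528), (2, 2, 513), (3, 3, 528)])]
def datDD3 : List (ℕ × List (ℕ × ℕ × ℕ)) :=
  [(0, []),
   (1, [(4, 0, 12816)]),
   (3, [(0, 1, 12816), (1, 2, 12816), (2, 3, 12816), (4, 3, 12576), (6, 4, 12816)]),
   (7, [(0, 5, 12816), (1, 6, 12816), (2, 6, 12801), (4, 6, 12546)])]
def datDD4 : List (ℕ × List (ℕ × ℕ × ℕ)) :=
  [(33, []),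
   (3, []),
   (11, []),
   (19, [(4, 0, 274960), (8, 0, 271105), (12, 1, 274960)]),
   (51, [(0, 2, 274960), (1, 3, 274960), (2, 3, 271105), (3, 4, 274960), (4, 3, 267010), (5, 4, 274720), (6, 5, 274960), (8, 3, 262675), (9, 5, 271105), (10, 4, 270385), (12, 4, 266290)]),
   (7, [(8, 6, 274960)]),
   (15, [(2, 7, 274960), (4, 7, 274720), (8, 8, 274960), (9, 9, 274960), (10, 4, 148240), (12, 4, 82720)])]
def datDD5 : List (ℕ × List (ℕ × ℕ × ℕ)) :=
  [(275, [(24, 0, 5517840)]),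
   (787, [(3, 1, 5517840), (5, 1, 5456160), (10, 1, 5390385), (20, 1, 5320770), (24, 1, 5251395)]),
   (51, []),
   (115, [(18, 2, 5517840), (20, 2, 5517600)]),
   (243, [(5, 3, 5517840), (10, 3, 5513985), (12, 4, 5517840), (16, 5, 5517840), (20, 6, 5517840), (24, 6, 5513985), (28, 7, 5517840)]),
   (435, [(9, 8, 5517840), (17, 8, 5456400), (24, 8, 336945), (25, 9, 5517840)]),
   (519, [(24, 10, 5517840)]),
   (143, [(24, 1, 2442000)]),
   (527, [(18, 1, 2380560), (20, 1, 1332000), (24, 11, 5517840)]),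
   (591, [(10, 3, 4346640), (12, 3, 4281120), (18, 3, 3298320), (20, 3, 3232800)])]
def datDD6 : List (ℕ × List (ℕ × ℕ × ℕ)) :=
  [(24851, []),
   (3859, []),
   (18547, []),
   (5363, [(48, 0, 106181136), (56, 1, 106181136)]),
   (12531, [(48, 2, 106181136)]),
   (16627, []),
   (20723, [(42, 1, 90448641), (56, 1, 56698116)]),
   (28915, [(5, 3, 106181136), (10, 3, 106177281), (48, 3, 103884036)]),
   (9651, []),
   (26035, []),
   (25095, []),
   (25103, [])]
def datDD7 : List (ℕ × List (ℕ × ℕ × ℕ)) :=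
  [(1578227, []),
   (1840371, []),
   (1585395, []),
   (192755, [(74, 0, 1985229328), (112, 0, 829838368)])]
def datDD8 : List (ℕ × List (ℕ × ℕ × ℕ)) :=
  [(155382003, [(240, 0, 36344967696)])]
def datDD9 : List (ℕ × List (ℕ × ℕ × ℕ)) :=
  [(64579891443, [])]
def datDD10 : List (ℕ × List (ℕ × ℕ × ℕ)) :=
  []
def datK3H1 : List (ℕ × List (ℕ × ℕ × ℕ)) :=
  [(0, [(0, 0, 16), (1, 1, 16)])]
def datK3H2 : List (ℕ × List (ℕ × ℕ × ℕ)) :=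
  [(0, [(0, 0, 528)]),
   (1, [(0, 1, 528), (1, 2, 528), (2, 2, 513)])]
def datK3H3 : List (ℕ × List (ℕ × ℕ × ℕ)) :=
  [(0, [(0, 0, 12816)]),
   (1, [(0, 1, 12816), (4, 2, 12816)]),
   (3, [(0, 3, 12816), (1, 4, 12816), (2, 5, 12816), (4, 5, 12576), (6, 6, 12816)])]
def datK3H4 : List (ℕ × List (ℕ × ℕ × ℕ)) :=
  [(0, []),
   (1, []),
   (33, [(0, 0, 274960), (1, 1, 274960), (2, 1, 274945), (4, 1, 266290), (8, 1, 266275)]),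
   (3, [(0, 2, 274960), (8, 1, 148240)]),
   (11, [(0, 3, 274960), (1, 4, 274960), (2, 5, 274960), (4, 5, 274720), (8, 5, 270640)]),
   (19, [(0, 6, 274960), (1, 5, 213520), (2, 5, 148225), (4, 7, 274960), (8, 7, 271105), (12, 8, 274960)]),
   (51, [(0, 9, 274960), (1, 10, 274960), (2, 10, 271105), (4, 10, 267010), (6, 11, 274960), (8, 10, 262675), (9, 11, 271105)])]
def datK3H5 : List (ℕ × List (ℕ × ℕ × ℕ)) :=
  [(33, [(16, 0, 5517840)]),
   (97, [(2, 1, 5517840), (4, 2, 5517840), (8, 2, 5514000), (16, 1, 5321280)]),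
   (3, []),
   (11, []),
   (75, []),
   (139, [(2, 3, 5517840), (4, 4, 5517840), (8, 4, 5514000), (16, 5, 5517840)]),
   (19, [(16, 1, 3298320)]),
   (275, [(0, 6, 5517840), (1, 4, 4411920), (2, 5, 4346625), (4, 5, 3232770), (8, 7, 5517840), (16, 7, 5456160), (24, 8, 5517840)]),
   (787, [(0, 9, 5517840), (1, 10, 5517840), (2, 10, 5513985), (4, 10, 5444610), (6, 11, 5517840), (8, 10, 5374995), (9, 11, 5513985), (12, 11, 5309220), (16, 10, 5309220), (17, 11, 5444610), (18, 11, 5374995)]),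
   (51, [(0, 12, 5517840), (16, 13, 5517840)]),
   (115, [(0, 14, 5517840), (1, 15, 5517840), (2, 16, 5517840), (4, 16, 5517600), (8, 17, 5517840), (16, 18, 5517840), (18, 19, 5517840), (20, 19, 5517600), (24, 11, 2441985)]),
   (435, [(0, 20, 5517840), (1, 21, 5517840), (2, 22, 5517840), (4, 22, 5517600), (6, 23, 5517840), (8, 21, 5505555), (9, 24, 5517840), (16, 21, 5440020), (17, 24, 5456400), (24, 24, 336945), (25, 25, 5517840)])]
def datK3H6 : List (ℕ × List (ℕ × ℕ × ℕ)) :=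
  [(16417, []),
   (2145, []),
   (4193, []),
   (2187, []),
   (4235, [(8, 0, 106181136)]),
   (16523, []),
   (275, []),
   (8467, [(16, 1, 106181136), (32, 1, 105194241), (48, 2, 106181136)]),
   (24851, [(0, 3, 106181136), (1, 4, 106181136), (2, 4, 105194241), (4, 4, 104141826), (6, 5, 106181136), (8, 4, 103023891), (9, 5, 105194241), (12, 6, 106181136), (16, 4, 101909796), (17, 5, 104141826), (18, 6, 106119456), (24, 5, 100799541), (32, 4, 100799541), (33, 6, 105009201), (34, 5, 103023891), (36, 5, 101909796)]),
   (787, [(32, 7, 106181136)]),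
   (1811, [(2, 8, 106181136), (4, 8, 106119456), (32, 9, 106181136), (34, 10, 106181136), (36, 10, 106119456), (40, 6, 23408706), (48, 6, 40190001)]),
   (6931, [(1, 11, 106181136), (8, 12, 106181136), (9, 13, 106181136), (12, 14, 106181136), (16, 12, 106119456), (17, 13, 106119456), (18, 14, 106119456), (32, 11, 100938261), (33, 15, 106181136), (40, 13, 6562641), (48, 13, 6493266)]),
   (51, []),
   (16435, [(16, 16, 106181136), (32, 16, 105198096)]),
   (115, []),
   (1139, [(48, 17, 106181136)]),
   (2163, [(16, 18, 106181136), (32, 18, 105194241), (48, 10, 52843536)]),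
   (8307, [(48, 5, 40190721)]),
   (16499, [(2, 18, 90452496), (4, 18, 90452256), (16, 19, 106181136), (32, 20, 106181136), (33, 17, 90452496), (34, 10, 52782096), (36, 10, 51733536), (40, 5, 39207681)]),
   (18547, [(0, 21, 106181136), (1, 22, 106181136), (2, 22, 105194241), (4, 23, 106181136), (6, 24, 106181136), (8, 23, 105194241), (9, 24, 105194241), (16, 23, 103961616), (18, 24, 103961616), (20, 25, 106181136), (24, 13, 39203856), (32, 23, 102974721), (33, 24, 102974721), (36, 13, 70668816), (40, 25, 105194241)]),
   (435, []),
   (1459, [(1, 26, 106181136), (8, 27, 106181136), (16, 27, 106119696), (32, 28, 106181136), (34, 24, 73740816), (36, 24, 73740576), (40, 15, 69620481), (48, 15, 52843521)]),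
   (2483, [(33, 24, 72757776), (40, 24, 72745491), (48, 24, 55968276)]),
   (6579, [(9, 29, 106181136), (17, 29, 106119696), (24, 29, 105923091), (33, 29, 105075216), (40, 29, 104878611), (48, 29, 103830036)]),
   (9651, [(0, 30, 106181136), (1, 31, 106181136), (2, 31, 105194241), (4, 31, 105190146), (6, 29, 90452496), (8, 31, 106168851), (9, 29, 73736961), (16, 32, 106181136), (17, 33, 106181136), (24, 33, 106168851), (32, 32, 105194241), (34, 33, 105194241), (36, 33, 105190146), (48, 34, 106181136)]),
   (26035, [(0, 35, 106181136), (1, 36, 106181136), (2, 36, 105194241), (4, 36, 105190146), (6, 37, 106181136), (8, 36, 106168851), (9, 37, 105194241), (16, 36, 106103316), (17, 37, 104145921), (24, 37, 101000241), (25, 38, 106181136), (32, 36, 104993541), (34, 37, 103036176), (36, 37, 101987616), (38, 38, 105194241)])]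
def datK3H7 : List (ℕ × List (ℕ × ℕ × ℕ)) :=
  [(266379, []),
   (532755, [(96, 0, 1985229328)]),
   (1581331, []),
   (24851, []),
   (57619, [(66, 1, 1985229328), (68, 1, 1985167648), (96, 2, 1985229328)]),
   (221459, [(9, 3, 1985229328), (17, 3, 1985167648), (24, 4, 1985229328), (65, 5, 1985229328), (72, 3, 121971553), (80, 3, 120919138)]),
   (418067, [(18, 6, 1985229328), (33, 6, 1984242433), (64, 7, 1985229328), (65, 8, 1985229328), (66, 8, 1984242433), (80, 8, 1980772948), (96, 8, 1979786053)]),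
   (1049363, []),
   (67347, [(96, 9, 1985229328)]),
   (1050387, [(66, 9, 1733571088), (68, 9, 1733509408)]),
   (1115923, [(12, 10, 1985229328), (40, 8, 1631727733), (68, 8, 1346576758)]),
   (39699, [(72, 8, 1366700098), (80, 8, 1383481393), (96, 11, 1985229328)]),
   (269075, [(65, 8, 1365717058), (80, 10, 1465917763), (96, 8, 23541058)]),
   (301843, [(16, 12, 1985229328), (17, 13, 1985229328), (18, 13, 1969496833), (48, 14, 1985229328), (80, 14, 1969496833), (96, 15, 1985229328), (112, 16, 1985229328)]),
   (400147, [(17, 13, 1702040578), (33, 17, 1985229328), (48, 13, 108082498), (65, 13, 1165170178), (80, 17, 1969230388), (96, 13, 1081284178)]),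
   (1088275, [(12, 17, 1733571088), (18, 17, 1733509408), (72, 18, 1985229328), (80, 18, 1985167648)]),
   (540723, [(96, 19, 1985229328)]),
   (1574003, [(6, 20, 1985229328), (18, 21, 1985229328), (20, 21, 1985229088), (34, 21, 1984246288), (36, 21, 1984246048), (48, 20, 1931568448)]),
   (526451, [(96, 1, 846615568)]),
   (540787, [(96, 22, 1985229328)]),
   (1065075, [(66, 1, 845509648), (68, 1, 828732448), (80, 22, 1733571088)]),
   (18547, []),
   (51315, [(66, 23, 1985229328), (68, 21, 929190928), (80, 21, 1466184208)]),
   (149619, [(65, 21, 913462288), (72, 24, 1985229328), (96, 3, 1131827728)]),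
   (215155, [(9, 25, 1985229328), (33, 26, 1985229328), (40, 27, 1985229328), (65, 25, 1934909968), (72, 28, 1985229328), (96, 27, 1934909968)]),
   (673907, [(9, 27, 1732584193), (33, 27, 1730364673), (40, 29, 1985229328), (65, 27, 1460880898), (72, 29, 1969500448), (96, 29, 1935823168), (104, 30, 1985229328)]),
   (34227, [(96, 20, 1197814288)]),
   (263603, [(96, 5, 1115050753)]),
   (1050035, [(65, 20, 1182085648), (72, 5, 1114067713), (80, 5, 845632513)]),
   (301491, [(9, 31, 1985229328), (17, 32, 1985229328), (24, 32, 1985217043), (33, 32, 1984246288), (40, 32, 1984234003), (48, 33, 1985229328), (112, 34, 1985229328)]),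
   (9651, []),
   (42419, [(66, 25, 1417032208), (68, 25, 1417031968), (96, 28, 1114051333)]),
   (533939, [(66, 28, 1400242708), (68, 28, 1400242468), (96, 35, 1985229328)]),
   (566707, [(6, 32, 1702113808), (34, 36, 1985229328), (36, 36, 1985229088), (66, 36, 1969439248), (68, 36, 1969439008), (96, 37, 1985229328), (98, 38, 1985229328), (100, 38, 1985229088)]),
   (1582515, [(48, 39, 1985229328), (64, 40, 1985229328), (65, 41, 1985229328), (66, 41, 1984242433), (68, 41, 1984238338), (70, 34, 1702113808), (72, 41, 1985217043), (73, 34, 1685398273)]),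
   (26035, []),
   (58803, [(66, 42, 1985229328), (68, 42, 1985229088), (96, 42, 1982083408)]),
   (222643, [(9, 43, 1985229328), (17, 43, 1985167888), (24, 43, 1728390193), (65, 44, 1985229328), (72, 44, 1985217043), (73, 45, 1985229328), (80, 44, 1985151508), (81, 45, 1985167888), (88, 45, 1728390193)]),
   (845235, [(6, 46, 1985229328), (34, 46, 1982084368), (36, 46, 1981035808), (38, 47, 1985229328), (66, 46, 1965307408), (68, 46, 1964258848), (70, 47, 1969500688), (96, 46, 1913927248), (98, 47, 1919169808), (100, 47, 1902392608), (102, 48, 1985229328)])]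
def datK3H8 : List (ℕ × List (ℕ × ℕ × ℕ)) :=
  [(201859347, []),
   (138469651, []),
   (201384211, []),
   (19095827, []),
   (50553107, []),
   (136536339, []),
   (38166803, [(33, 0, 36344967696), (192, 0, 1478780721)]),
   (134635795, []),
   (136732947, []),
   (201393939, []),
   (26281747, []),
   (201366291, []),
   (33856275, []),
   (35953427, [(224, 1, 36344967696)]),
   (100965139, []),
   (201628435, [(144, 2, 36344967696), (145, 1, 32318435856), (146, 1, 32302703361)]),
   (235182867, []),
   (69606163, [(208, 3, 36344967696)]),
   (152083219, [(146, 3, 31815057696)]),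
   (201867315, []),
   (14156915, []),
   (39322739, []),
   (201867379, []),
   (138463347, []),
   (151144563, []),
   (19089523, []),
   (69421171, []),
   (84101235, []),
   (151210099, []),
   (84559987, []),
   (218777715, []),
   (19175859, []),
   (35953075, []),
   (100964787, []),
   (235182515, [(112, 4, 36344967696), (137, 4, 36090958356)]),
   (201860531, []),
   (71869875, []),
   (201893299, []),
   (206087603, []),
   (102245811, [(192, 5, 36344967696), (193, 6, 36344967696), (194, 6, 36343980801), (196, 6, 36343976706), (200, 6, 36344955411)]),
   (135800243, []),
   (137897395, [(176, 6, 32318435856)]),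
   (138470835, []),
   (19097011, []),
   (136537523, []),
   (153314739, []),
   (13428147, []),
   (80537011, []),
   (214754739, [])]
def datK3H9 : List (ℕ × List (ℕ × ℕ × ℕ)) :=
  [(8896536851, [(448, 0, 654820258320)]),
   (60165495571, []),
   (38856334099, []),
   (55904181011, []),
   (30299953587, [(393, 1, 654820258320)]),
   (51641853363, []),
   (51910288819, [])]
def datK3H10 : List (ℕ × List (ℕ × ℕ × ℕ)) :=
  [(30795222114579, []),
   (27037054310835, [])]
def datK3H11 : List (ℕ × List (ℕ × ℕ × ℕ)) :=
  []
def datK341 : List (ℕ × List (ℕ × ℕ × ℕ)) :=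
  [(0, [(0, 0, 16), (1, 1, 16)])]
def datK342 : List (ℕ × List (ℕ × ℕ × ℕ)) :=
  [(0, [(0, 0, 528)]),
   (1, [(0, 1, 528), (1, 2, 528), (2, 2, 513)])]
def datK343 : List (ℕ × List (ℕ × ℕ × ℕ)) :=
  [(0, []),
   (1, [(0, 0, 12816), (4, 1, 12816)]),
   (3, [(0, 2, 12816), (1, 3, 12816), (2, 4, 12816), (4, 4, 12576), (6, 5, 12816)])]
def datK344 : List (ℕ × List (ℕ × ℕ × ℕ)) :=
  [(1, []),
   (33, [(0, 0, 274960), (1, 1, 274960), (2, 1, 274945), (4, 1, 266290), (8, 1, 266275)]),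
   (3, [(8, 1, 148240)]),
   (11, [(2, 2, 274960), (4, 2, 274720), (8, 2, 270640)]),
   (19, [(0, 3, 274960), (1, 2, 213520), (2, 2, 148225), (4, 4, 274960), (8, 4, 271105), (12, 5, 274960)]),
   (51, [(0, 6, 274960), (1, 7, 274960), (2, 7, 271105), (4, 7, 267010), (6, 8, 274960), (8, 7, 262675), (9, 8, 271105)])]
def datK345 : List (ℕ × List (ℕ × ℕ × ℕ)) :=
  [(33, [(16, 0, 5517840)]),
   (97, [(2, 1, 5517840), (16, 1, 5321280)]),
   (139, [(4, 2, 5517840), (8, 2, 5514000)]),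
   (19, [(16, 1, 3298320)]),
   (275, [(1, 2, 4411920), (8, 3, 5517840), (16, 3, 5456160), (24, 4, 5517840)]),
   (787, [(0, 5, 5517840), (1, 6, 5517840), (2, 6, 5513985), (4, 6, 5444610), (6, 7, 5517840), (8, 6, 5374995), (9, 7, 5513985), (12, 7, 5309220), (16, 6, 5309220), (17, 7, 5444610), (18, 7, 5374995)]),
   (51, [(16, 8, 5517840)]),
   (115, [(2, 9, 5517840), (4, 9, 5517600), (16, 10, 5517840), (18, 11, 5517840), (20, 11, 5517600), (24, 7, 2441985)]),
   (435, [(1, 12, 5517840), (8, 12, 5505555), (9, 13, 5517840), (16, 12, 5440020), (17, 13, 5456400), (24, 13, 336945), (25, 14, 5517840)])]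
def datK346 : List (ℕ × List (ℕ × ℕ × ℕ)) :=
  [(16417, []),
   (2145, []),
   (4235, []),
   (8467, [(48, 0, 106181136)]),
   (24851, [(12, 1, 106181136), (18, 1, 106119456), (33, 1, 105009201)]),
   (787, [(32, 2, 106181136)]),
   (1811, [(32, 3, 106181136), (34, 4, 106181136), (36, 4, 106119456), (40, 1, 23408706), (48, 1, 40190001)]),
   (6931, [(1, 5, 106181136), (9, 6, 106181136), (17, 6, 106119456), (32, 5, 100938261), (33, 7, 106181136), (40, 6, 6562641), (48, 6, 6493266)]),
   (16435, []),
   (2163, [(48, 4, 52843536)]),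
   (16499, [(34, 4, 52782096), (36, 4, 51733536)]),
   (18547, [(24, 6, 39203856), (36, 6, 70668816)]),
   (1459, [(40, 7, 69620481), (48, 7, 52843521)]),
   (9651, [(48, 8, 106181136)]),
   (26035, [])]
def datK347 : List (ℕ × List (ℕ × ℕ × ℕ)) :=
  [(1581331, []),
   (418067, []),
   (1049363, []),
   (1050387, []),
   (1115923, []),
   (39699, [(96, 0, 1985229328)]),
   (301843, [(96, 1, 1985229328), (112, 2, 1985229328)]),
   (1088275, []),
   (1582515, [])]
def datK348 : List (ℕ × List (ℕ × ℕ × ℕ)) :=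
  [(201366291, []),
   (201628435, []),
   (235182867, [])]
def datK349 : List (ℕ × List (ℕ × ℕ × ℕ)) :=
  []
def datK331 : List (ℕ × List (ℕ × ℕ × ℕ)) :=
  [(0, [(0, 0, 16), (1, 1, 16)])]
def datK332 : List (ℕ × List (ℕ × ℕ × ℕ)) :=
  [(0, []),
   (1, [(0, 0, 528), (1, 1, 528), (2, 1, 513)])]
def datK333 : List (ℕ × List (ℕ × ℕ × ℕ)) :=
  [(1, [(4, 0, 12816)]),
   (3, [(2, 1, 12816), (4, 1, 12576), (6, 2, 12816)])]
def datK334 : List (ℕ × List (ℕ × ℕ × ℕ)) :=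
  [(33, []),
   (19, [(12, 0, 274960)]),
   (51, [])]
def datK335 : List (ℕ × List (ℕ × ℕ × ℕ)) :=
  [(787, [])]
def datK336 : List (ℕ × List (ℕ × ℕ × ℕ)) :=
  []
def datM1 : List (ℕ × List (ℕ × ℕ × ℕ)) :=
  [(0, [(0, 0, 16), (1, 1, 16)])]
def datM2 : List (ℕ × List (ℕ × ℕ × ℕ)) :=
  [(0, [(0, 0, 528)]),
   (1, [(0, 1, 528)])]
def datM3 : List (ℕ × List (ℕ × ℕ × ℕ)) :=
  [(0, [(0, 0, 12816)]),
   (1, [(0, 1, 12816), (4, 2, 12816)])]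
def datM4 : List (ℕ × List (ℕ × ℕ × ℕ)) :=
  [(0, []),
   (1, []),
   (33, [(0, 0, 274960)])]
def datM5 : List (ℕ × List (ℕ × ℕ × ℕ)) :=
  [(33, [(16, 0, 5517840)])]
def datM6 : List (ℕ × List (ℕ × ℕ × ℕ)) :=
  [(16417, [])]
def datM7 : List (ℕ × List (ℕ × ℕ × ℕ)) :=
  []
def datQ1 : List (ℕ × List (ℕ × ℕ × ℕ)) :=
  [(0, [(0, 0, 16), (1, 1, 16)])]
def datQ2 : List (ℕ × List (ℕ × ℕ × ℕ)) :=
  [(0, [(0, 0, 528)]),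
   (1, [(0, 1, 528)])]
def datQ3 : List (ℕ × List (ℕ × ℕ × ℕ)) :=
  [(0, []),
   (1, [(4, 0, 12816)])]
def datQ4 : List (ℕ × List (ℕ × ℕ × ℕ)) :=
  [(33, [])]
def datQ5 : List (ℕ × List (ℕ × ℕ × ℕ)) :=
  []

set_option maxRecDepth 100000

/-- families of conditions: `K₄-e` / `K₅-e`, `K₄-e` / `K₄-e`, `K₃` / `K₅-e`, `K₃` / `K₄`, `K₃` / `K₃` -/
def PA : List (ℕ × ℕ × ℕ) := [(3, 0, 4), (4, 2, 99)]
def PDD : List (ℕ × ℕ × ℕ) := [(3, 2, 4)]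
def PK3H : List (ℕ × ℕ × ℕ) := [(2, 0, 2), (4, 2, 99)]
def PK34 : List (ℕ × ℕ × ℕ) := [(2, 0, 2), (3, 1, 99)]
def PM : List (ℕ × ℕ × ℕ) := [(2, 0, 1), (4, 2, 99)]
def PQ : List (ℕ × ℕ × ℕ) := [(2, 0, 1), (3, 2, 99)]
def PK33 : List (ℕ × ℕ × ℕ) := [(2, 1, 2)]

theorem clA1 : Cl PA 1 0 (datA1.map Prod.fst) := Cl_one _

theorem clA2 : Cl PA 2 0 (datA2.map Prod.fst) :=
  Cl_step clA1 rfl (by intro Y δ h1 h2; omega) (by decide +kernel)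

theorem clA3 : Cl PA 3 0 (datA3.map Prod.fst) :=
  Cl_step clA2 rfl (by intro Y δ h1 h2; omega) (by decide +kernel)

theorem clA4 : Cl PA 4 8 (datA4.map Prod.fst) :=
  Cl_step clA3 rfl (by intro Y δ h1 h2; omega) (by decide +kernel)

theorem clA5 : Cl PA 5 12 (datA5.map Prod.fst) :=
  Cl_step clA4 rfl (by intro Y δ h1 h2; omega) (by decide +kernel)

theorem clA6 : Cl PA 6 16 (datA6.map Prod.fst) :=
  Cl_step clA5 rfl (by intro Y δ h1 h2; omega) (by decide +kernel)

theorem clA7 : Cl PA 7 20 (datA7.map Prod.fst) :=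
  Cl_step clA6 rfl (by intro Y δ h1 h2; omega) (by decide +kernel)

theorem clA8 : Cl PA 8 26 (datA8.map Prod.fst) :=
  Cl_step clA7 rfl (by intro Y δ h1 h2; omega) (by decide +kernel)

theorem clA9 : Cl PA 9 32 (datA9.map Prod.fst) :=
  Cl_step clA8 rfl (by intro Y δ h1 h2; omega) (by decide +kernel)

theorem clA10 : Cl PA 10 40 (datA10.map Prod.fst) :=
  Cl_step clA9 rfl (by intro Y δ h1 h2; omega) (by decide +kernel)

theorem clA11 : Cl PA 11 48 (datA11.map Prod.fst) :=
  Cl_step clA10 rfl (by intro Y δ h1 h2; omega) (by decide +kernel)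

theorem clA12 : Cl PA 12 60 (datA12.map Prod.fst) :=
  Cl_step clA11 rfl (by intro Y δ h1 h2; omega) (by decide +kernel)

theorem clDD1 : Cl PDD 1 0 (datDD1.map Prod.fst) := Cl_one _

theorem clDD2 : Cl PDD 2 0 (datDD2.map Prod.fst) :=
  Cl_step clDD1 rfl (by intro Y δ h1 h2; omega) (by decide +kernel)

theorem clDD3 : Cl PDD 3 0 (datDD3.map Prod.fst) :=
  Cl_step clDD2 rfl (by intro Y δ h1 h2; omega) (by decide +kernel)

theorem clDD4 : Cl PDD 4 0 (datDD4.map Prod.fst) :=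
  Cl_step clDD3 rfl (by intro Y δ h1 h2; omega) (by decide +kernel)

theorem clDD5 : Cl PDD 5 0 (datDD5.map Prod.fst) :=
  Cl_step clDD4 rfl (by intro Y δ h1 h2; omega) (by decide +kernel)

theorem clDD6 : Cl PDD 6 0 (datDD6.map Prod.fst) :=
  Cl_step clDD5 rfl (by intro Y δ h1 h2; omega) (by decide +kernel)

theorem clDD7 : Cl PDD 7 0 (datDD7.map Prod.fst) :=
  Cl_step clDD6 rfl (by intro Y δ h1 h2; omega) (by decide +kernel)

theorem clDD8 : Cl PDD 8 0 (datDD8.map Prod.fst) :=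
  Cl_step clDD7 rfl (by intro Y δ h1 h2; omega) (by decide +kernel)

theorem clDD9 : Cl PDD 9 0 (datDD9.map Prod.fst) :=
  Cl_step clDD8 rfl (by intro Y δ h1 h2; omega) (by decide +kernel)

theorem clDD10 : Cl PDD 10 0 (datDD10.map Prod.fst) :=
  Cl_step clDD9 rfl (by intro Y δ h1 h2; omega) (by decide +kernel)

theorem clK3H1 : Cl PK3H 1 0 (datK3H1.map Prod.fst) := Cl_one _

theorem clK3H2 : Cl PK3H 2 0 (datK3H2.map Prod.fst) :=
  Cl_step clK3H1 rfl (by intro Y δ h1 h2; omega) (by decide +kernel)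

theorem clK3H3 : Cl PK3H 3 0 (datK3H3.map Prod.fst) :=
  Cl_step clK3H2 rfl (by intro Y δ h1 h2; omega) (by decide +kernel)

theorem clK3H4 : Cl PK3H 4 0 (datK3H4.map Prod.fst) :=
  Cl_step clK3H3 rfl (by intro Y δ h1 h2; omega) (by decide +kernel)

theorem clK3H5 : Cl PK3H 5 0 (datK3H5.map Prod.fst) :=
  Cl_step clK3H4 rfl (by intro Y δ h1 h2; omega) (by decide +kernel)

theorem clK3H6 : Cl PK3H 6 0 (datK3H6.map Prod.fst) :=
  Cl_step clK3H5 rfl (by intro Y δ h1 h2; omega) (by decide +kernel)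

theorem clK3H7 : Cl PK3H 7 0 (datK3H7.map Prod.fst) :=
  Cl_step clK3H6 rfl (by intro Y δ h1 h2; omega) (by decide +kernel)

theorem clK3H8 : Cl PK3H 8 0 (datK3H8.map Prod.fst) :=
  Cl_step clK3H7 rfl (by intro Y δ h1 h2; omega) (by decide +kernel)

theorem clK3H9 : Cl PK3H 9 0 (datK3H9.map Prod.fst) :=
  Cl_step clK3H8 rfl (by intro Y δ h1 h2; omega) (by decide +kernel)

theorem clK3H10 : Cl PK3H 10 0 (datK3H10.map Prod.fst) :=
  Cl_step clK3H9 rfl (by intro Y δ h1 h2; omega) (by decide +kernel)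

theorem clK3H11 : Cl PK3H 11 0 (datK3H11.map Prod.fst) :=
  Cl_step clK3H10 rfl (by intro Y δ h1 h2; omega) (by decide +kernel)

theorem clK341 : Cl PK34 1 0 (datK341.map Prod.fst) := Cl_one _

theorem clK342 : Cl PK34 2 0 (datK342.map Prod.fst) :=
  Cl_step clK341 rfl (by intro Y δ h1 h2; omega) (by decide +kernel)

theorem clK343 : Cl PK34 3 0 (datK343.map Prod.fst) :=
  Cl_step clK342 rfl (by intro Y δ h1 h2; omega) (by decide +kernel)

theorem clK344 : Cl PK34 4 0 (datK344.map Prod.fst) :=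
  Cl_step clK343 rfl (by intro Y δ h1 h2; omega) (by decide +kernel)

theorem clK345 : Cl PK34 5 0 (datK345.map Prod.fst) :=
  Cl_step clK344 rfl (by intro Y δ h1 h2; omega) (by decide +kernel)

theorem clK346 : Cl PK34 6 0 (datK346.map Prod.fst) :=
  Cl_step clK345 rfl (by intro Y δ h1 h2; omega) (by decide +kernel)

theorem clK347 : Cl PK34 7 0 (datK347.map Prod.fst) :=
  Cl_step clK346 rfl (by intro Y δ h1 h2; omega) (by decide +kernel)

theorem clK348 : Cl PK34 8 0 (datK348.map Prod.fst) :=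
  Cl_step clK347 rfl (by intro Y δ h1 h2; omega) (by decide +kernel)

theorem clK349 : Cl PK34 9 0 (datK349.map Prod.fst) :=
  Cl_step clK348 rfl (by intro Y δ h1 h2; omega) (by decide +kernel)

theorem clK331 : Cl PK33 1 0 (datK331.map Prod.fst) := Cl_one _

theorem clK332 : Cl PK33 2 0 (datK332.map Prod.fst) :=
  Cl_step clK331 rfl (by intro Y δ h1 h2; omega) (by decide +kernel)

theorem clK333 : Cl PK33 3 0 (datK333.map Prod.fst) :=
  Cl_step clK332 rfl (by intro Y δ h1 h2; omega) (by decide +kernel)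

theorem clK334 : Cl PK33 4 0 (datK334.map Prod.fst) :=
  Cl_step clK333 rfl (by intro Y δ h1 h2; omega) (by decide +kernel)

theorem clK335 : Cl PK33 5 0 (datK335.map Prod.fst) :=
  Cl_step clK334 rfl (by intro Y δ h1 h2; omega) (by decide +kernel)

theorem clK336 : Cl PK33 6 0 (datK336.map Prod.fst) :=
  Cl_step clK335 rfl (by intro Y δ h1 h2; omega) (by decide +kernel)

theorem clM1 : Cl PM 1 0 (datM1.map Prod.fst) := Cl_one _

theorem clM2 : Cl PM 2 0 (datM2.map Prod.fst) :=
  Cl_step clM1 rfl (by intro Y δ h1 h2; omega) (by decide +kernel)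

theorem clM3 : Cl PM 3 0 (datM3.map Prod.fst) :=
  Cl_step clM2 rfl (by intro Y δ h1 h2; omega) (by decide +kernel)

theorem clM4 : Cl PM 4 0 (datM4.map Prod.fst) :=
  Cl_step clM3 rfl (by intro Y δ h1 h2; omega) (by decide +kernel)

theorem clM5 : Cl PM 5 0 (datM5.map Prod.fst) :=
  Cl_step clM4 rfl (by intro Y δ h1 h2; omega) (by decide +kernel)

theorem clM6 : Cl PM 6 0 (datM6.map Prod.fst) :=
  Cl_step clM5 rfl (by intro Y δ h1 h2; omega) (by decide +kernel)

theorem clM7 : Cl PM 7 0 (datM7.map Prod.fst) :=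
  Cl_step clM6 rfl (by intro Y δ h1 h2; omega) (by decide +kernel)

theorem clQ1 : Cl PQ 1 0 (datQ1.map Prod.fst) := Cl_one _

theorem clQ2 : Cl PQ 2 0 (datQ2.map Prod.fst) :=
  Cl_step clQ1 rfl (by intro Y δ h1 h2; omega) (by decide +kernel)

theorem clQ3 : Cl PQ 3 0 (datQ3.map Prod.fst) :=
  Cl_step clQ2 rfl (by intro Y δ h1 h2; omega) (by decide +kernel)

theorem clQ4 : Cl PQ 4 0 (datQ4.map Prod.fst) :=
  Cl_step clQ3 rfl (by intro Y δ h1 h2; omega) (by decide +kernel)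

theorem clQ5 : Cl PQ 5 0 (datQ5.map Prod.fst) :=
  Cl_step clQ4 rfl (by intro Y δ h1 h2; omega) (by decide +kernel)


/-! ### Consequences of the catalogues -/

section cons
variable {V : Type}

theorem Cl.bound {P : List (ℕ × ℕ × ℕ)} {m t : ℕ} {L : List ℕ} (h : Cl P m t L) (X : ℕ)
    (hX : L.all (fun g => Nat.ble (dsum g (vlist m) (vlist m)) X) = true) (ht : t ≤ X + 1)
    {A : V → V → Bool} (hs : ∀ x y, A x y = A y x) (hi : ∀ x, A x x = false)
    {R : Finset V} (hR : R.card = m) (hG : Good A P R) : degsum A R ≤ X := by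
  by_contra hc
  obtain ⟨g, hg, f, hf⟩ := h V A hs hi R hR hG (by omega)
  have h1 := Nat.le_of_ble_eq_true (List.all_eq_true.1 hX g hg)
  rw [dsum_eq hs hi hf hR] at h1
  exact hc h1

theorem Cl.empty {P : List (ℕ × ℕ × ℕ)} {m : ℕ} (h : Cl P m 0 [])
    {A : V → V → Bool} (hs : ∀ x y, A x y = A y x) (hi : ∀ x, A x x = false)
    {R : Finset V} (hG : Good A P R) : R.card < m := by
  by_contra hc
  obtain ⟨R', h1, h2⟩ := Finset.exists_subset_card_eq (not_lt.1 hc)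
  obtain ⟨g, hg, _⟩ := h V A hs hi R' h2 (hG.mono h1) (by omega)
  simp at hg

/-- the complementary colour -/
def co [DecidableEq V] (A : V → V → Bool) (x y : V) : Bool := !decide (x = y) && !A x y

theorem co_symm [DecidableEq V] {A : V → V → Bool} (hs : ∀ x y, A x y = A y x) (x y : V) :
    co A x y = co A y x := by
  unfold co; rw [hs x y]; simp [eq_comm]

theorem co_irr [DecidableEq V] (A : V → V → Bool) (x : V) : co A x x = false := by simp [co]

theorem co_ne [DecidableEq V] {A : V → V → Bool} {x y : V} (h : x ≠ y) : co A x y = !A x y := by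
  simp [co, h]

theorem co_co [DecidableEq V] {A : V → V → Bool} (hi : ∀ x, A x x = false) : co (co A) = A := by
  funext x y
  by_cases h : x = y
  · subst h; simp [co, hi]
  · simp [co, h]

theorem ec_co [DecidableEq V] (A : V → V → Bool) (l : List V) (hl : l.Nodup) :
    ec A l + ec (co A) l = l.length.choose 2 := by
  induction l with
  | nil => rfl
  | cons x l ih =>
    rw [List.nodup_cons] at hl
    have h1 : l.countP (co A x) = l.countP (fun y => !A x y) := by
      apply List.countP_congr
      intro y hy
      have hne : x ≠ y := fun h => hl.1 (by rw [h]; exact hy)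
      rw [co_ne hne]
    have h2 := List.length_eq_countP_add_countP (A x) (l := l)
    have h3 := ih hl.2
    have h4 : (l.length + 1).choose 2 = l.length + l.length.choose 2 := by
      rw [Nat.choose_succ_succ' l.length 1, Nat.choose_one_right]
    rw [ec, ec, h1, List.length_cons, h4]
    simp only [Bool.not_eq_true, Bool.decide_eq_false] at h2
    omega

/-- the neighbourhood -/
def nb (A : V → V → Bool) (R : Finset V) (x : V) : Finset V := R.filter (fun y => A x y = true)

theorem mem_nb {A : V → V → Bool} {R : Finset V} {x y : V} :
    y ∈ nb A R x ↔ y ∈ R ∧ A x y = true := by simp [nb]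

theorem nb_sub (A : V → V → Bool) (R : Finset V) (x : V) : nb A R x ⊆ R :=
  Finset.filter_subset _ _

theorem card_nb (A : V → V → Bool) (R : Finset V) (x : V) : (nb A R x).card = deg A R x := rfl

theorem cross_comm {A : V → V → Bool} (hs : ∀ x y, A x y = A y x) (N M : Finset V) :
    ∑ x ∈ N, deg A M x = ∑ x ∈ M, deg A N x := by
  simp_rw [deg_eq]
  rw [Finset.sum_comm]
  simp_rw [hs]

theorem deg_union [DecidableEq V] {A : V → V → Bool} {N M : Finset V} (h : Disjoint N M) (x : V) :
    deg A (N ∪ M) x = deg A N x + deg A M x := by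
  simp_rw [deg_eq]
  rw [Finset.sum_union h]

theorem deg_co [DecidableEq V] {A : V → V → Bool} (hi : ∀ x, A x x = false) {R : Finset V}
    {x : V} (hx : x ∈ R) : deg A R x + deg (co A) R x + 1 = R.card := by
  simp_rw [deg_eq]
  rw [← Finset.sum_add_distrib, ← Finset.sum_erase_add _ _ hx, hi, co_irr]
  have : ∑ y ∈ R.erase x, ((A x y).toNat + (co A x y).toNat) = ∑ y ∈ R.erase x, 1 := by
    apply Finset.sum_congr rfl
    intro y hy
    rw [co_ne (Finset.ne_of_mem_erase hy).symm]
    cases A x y <;> rfl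
  rw [this]
  have := Finset.card_erase_add_one hx
  simpa using this

theorem nb_disj [DecidableEq V] (A : V → V → Bool) (R : Finset V) (v : V) :
    Disjoint (nb A R v) (nb (co A) R v) := by
  rw [Finset.disjoint_left]
  intro y h1 h2
  rw [mem_nb] at h1 h2
  have := h2.2
  simp [co, h1.2] at this

theorem nb_union [DecidableEq V] {A : V → V → Bool} (hi : ∀ x, A x x = false) (R : Finset V)
    (v : V) : R.erase v = nb A R v ∪ nb (co A) R v := by
  ext y
  simp only [Finset.mem_erase, Finset.mem_union, mem_nb]
  constructor
  · rintro ⟨h1, h2⟩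
    rw [co_ne h1.symm]
    cases A v y <;> simp [h2]
  · rintro (h2 | h2)
    · exact ⟨fun e => by rw [e, hi] at h2; simp at h2, h2.1⟩
    · exact ⟨fun e => by rw [e, co_irr] at h2; simp at h2, h2.1⟩

theorem deg_split [DecidableEq V] {A : V → V → Bool} (hs : ∀ x y, A x y = A y x)
    (hi : ∀ x, A x x = false) {R : Finset V} {v : V} (x : V) (hv : v ∈ R) :
    deg A R x = deg A (nb A R v) x + deg A (nb (co A) R v) x + (A v x).toNat := by
  rw [← deg_union (nb_disj A R v), ← nb_union hi, deg_eq, deg_eq, hs v x,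
    Finset.sum_erase_add _ _ hv]

theorem degsum_co [DecidableEq V] {A : V → V → Bool} (hi : ∀ x, A x x = false) (M : Finset V) :
    degsum A M + degsum (co A) M + M.card = M.card * M.card := by
  rw [degsum, degsum, ← Finset.sum_add_distrib]
  have : ∑ x ∈ M, (deg A M x + deg (co A) M x + 1) = ∑ x ∈ M, M.card :=
    Finset.sum_congr rfl (fun x hx => deg_co hi hx)
  rw [Finset.sum_add_distrib] at this
  simpa using this

theorem goodman_local [DecidableEq V] {A : V → V → Bool} (hs : ∀ x y, A x y = A y x)
    (hi : ∀ x, A x x = false) {R : Finset V} {v : V} (hv : v ∈ R) :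
    degsum A (nb A R v) + degsum (co A) (nb (co A) R v) + deg A R v + deg (co A) R v +
      ∑ x ∈ nb (co A) R v, deg A R x =
    deg (co A) R v * deg (co A) R v + ∑ x ∈ nb A R v, deg A R x := by
  set N := nb A R v with hN
  set M := nb (co A) R v with hM
  have h1 : ∑ x ∈ N, deg A R x = degsum A N + ∑ x ∈ N, deg A M x + N.card := by
    have : ∑ x ∈ N, deg A R x = ∑ x ∈ N, (deg A N x + deg A M x + 1) := by
      apply Finset.sum_congr rfl
      intro x hx
      rw [deg_split hs hi x hv, (mem_nb.1 hx).2]; rfl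
    rw [this, Finset.sum_add_distrib, Finset.sum_add_distrib]
    simp [degsum]
  have h2 : ∑ x ∈ M, deg A R x = ∑ x ∈ M, deg A N x + degsum A M := by
    have : ∑ x ∈ M, deg A R x = ∑ x ∈ M, (deg A N x + deg A M x) := by
      apply Finset.sum_congr rfl
      intro x hx
      have hx' := (mem_nb.1 hx).2
      have : A v x = false := by
        cases h : A v x
        · rfl
        · simp [co, h] at hx'
      rw [deg_split hs hi x hv, this]; rfl
    rw [this, Finset.sum_add_distrib, degsum]
  have h3 := cross_comm hs N M
  have h4 := degsum_co hi M
  rw [show deg A R v = N.card from rfl, show deg (co A) R v = M.card from rfl]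
  omega

theorem sum_nb {A : V → V → Bool} (hs : ∀ x y, A x y = A y x) (R : Finset V) (F : V → ℕ) :
    ∑ v ∈ R, ∑ x ∈ nb A R v, F x = ∑ x ∈ R, deg A R x * F x := by
  have : ∀ v ∈ R, ∑ x ∈ nb A R v, F x = ∑ x ∈ R, (A v x).toNat * F x := by
    intro v _
    rw [nb, Finset.sum_filter]
    apply Finset.sum_congr rfl
    intro x _
    cases A v x <;> simp
  rw [Finset.sum_congr rfl this, Finset.sum_comm]
  apply Finset.sum_congr rfl
  intro x _
  rw [← Finset.sum_mul, deg_eq]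
  simp_rw [hs x]

theorem goodman [DecidableEq V] {A : V → V → Bool} (hs : ∀ x y, A x y = A y x)
    (hi : ∀ x, A x x = false) (R : Finset V) :
    ∑ v ∈ R, (degsum A (nb A R v) + degsum (co A) (nb (co A) R v) + deg A R v + deg (co A) R v +
      deg (co A) R v * deg A R v) =
    ∑ v ∈ R, (deg (co A) R v * deg (co A) R v + deg A R v * deg A R v) := by
  have := Finset.sum_congr (rfl : R = R) (fun v hv => goodman_local hs hi hv)
  simp only [Finset.sum_add_distrib] at this ⊢
  rw [sum_nb hs, sum_nb (co_symm hs)] at this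
  exact this

/-! #### R(K₄-e, K₅-e) ≤ 13 -/

theorem Good.of_ec {A : V → V → Bool} {R : Finset V} {P Q : List (ℕ × ℕ × ℕ)}
    (h : Good A P R) (H : ∀ q ∈ Q, ∃ p ∈ P, p.1 = q.1 ∧ q.2.1 ≤ p.2.1 ∧ p.2.2 ≤ q.2.2) :
    Good A Q R := by
  intro q hq l h1 h2 h3
  obtain ⟨p, hp, e1, e2, e3⟩ := H q hq
  have := h p hp l h1 h2 (by rw [e1]; exact h3)
  exact ⟨e2.trans this.1, this.2.trans e3⟩

theorem good_nil (A : V → V → Bool) (R : Finset V) : Good A [] R := by intro q hq; simp at hq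

theorem good_cons {A : V → V → Bool} {R : Finset V} {q : ℕ × ℕ × ℕ} {P : List (ℕ × ℕ × ℕ)} :
    Good A (q :: P) R ↔ (∀ l : List V, l.Nodup → (∀ x ∈ l, x ∈ R) → l.length = q.1 + 1 →
      q.2.1 ≤ ec A l ∧ ec A l ≤ q.2.2) ∧ Good A P R := by
  unfold Good
  rw [List.forall_mem_cons]

/-- adding an apex adjacent to all vertices of the list -/
theorem ec_cons_nb {A : V → V → Bool} {R : Finset V} {v : V} {l : List V}
    (h : ∀ x ∈ l, x ∈ nb A R v) : ec A (v :: l) = ec A l + l.length := by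
  rw [ec, List.countP_eq_length.2 (fun x hx => (mem_nb.1 (h x hx)).2)]

theorem ec_cons_co [DecidableEq V] {A : V → V → Bool} {R : Finset V} {v : V} {l : List V}
    (h : ∀ x ∈ l, x ∈ nb (co A) R v) : ec A (v :: l) = ec A l := by
  rw [ec, List.countP_eq_zero.2, add_zero]
  intro x hx h'
  have := (mem_nb.1 (h x hx)).2
  simp [co, h'] at this

theorem nodup_nb {A : V → V → Bool} (hi : ∀ x, A x x = false) {R : Finset V} {v : V} {l : List V}
    (hl : l.Nodup) (h : ∀ x ∈ l, x ∈ nb A R v) : (v :: l).Nodup := by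
  rw [List.nodup_cons]
  refine ⟨fun h' => ?_, hl⟩
  have := (mem_nb.1 (h v h')).2
  rw [hi] at this; cases this

theorem mem_cons_nb {A : V → V → Bool} {R : Finset V} {v : V} (hv : v ∈ R) {l : List V}
    (h : ∀ x ∈ l, x ∈ nb A R v) : ∀ x ∈ v :: l, x ∈ R := by
  intro x hx
  rcases List.mem_cons.1 hx with rfl | hx
  · exact hv
  · exact (mem_nb.1 (h x hx)).1

theorem good_co [DecidableEq V] {A : V → V → Bool} {R : Finset V} {k lo hi : ℕ} {P : List (ℕ × ℕ × ℕ)}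
    (h1 : Good A [(k, lo, hi)] R) (h2 : Good (co A) P R) (lo' hi' : ℕ)
    (e1 : lo' + hi ≤ (k + 1).choose 2)
    (e2 : (k + 1).choose 2 ≤ hi' + lo) : Good (co A) ((k, lo', hi') :: P) R := by
  rw [good_cons]
  refine ⟨?_, h2⟩
  intro l a b c
  have := (good_cons.1 h1).1 l a b c
  have h3 := ec_co A l a
  rw [c] at h3
  simp only at this c h3 ⊢
  omega

theorem good_single {A : V → V → Bool} {P : List (ℕ × ℕ × ℕ)} {R : Finset V} (h : Good A P R)
    {q : ℕ × ℕ × ℕ} (hq : q ∈ P) : Good A [q] R := by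
  intro p hp
  rw [List.mem_singleton] at hp
  subst hp
  exact h p hq
end cons

section r13
variable {V : Type}

theorem good_nb_M {A : V → V → Bool} (hi : ∀ x, A x x = false)
    {R : Finset V} (hG : Good A PA R) {v : V} (hv : v ∈ R) : Good A PM (nb A R v) := by
  unfold PM
  rw [good_cons]
  refine ⟨?_, (hG.mono (nb_sub A R v)).of_ec (by simp [PA])⟩
  intro l h1 h2 h3
  have := hG (3, 0, 4) (by simp [PA]) (v :: l) (nodup_nb hi h1 h2) (mem_cons_nb hv h2) (by simp [h3])
  rw [ec_cons_nb h2] at this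
  simp only at this h3 ⊢
  omega

theorem good_nb_DD [DecidableEq V] {A : V → V → Bool}
    {R : Finset V} (hG : Good A PA R) {v : V} (hv : v ∈ R) : Good A PDD (nb (co A) R v) := by
  unfold PDD
  rw [good_cons]
  refine ⟨?_, good_nil _ _⟩
  intro l h1 h2 h3
  have ha := hG (3, 0, 4) (by simp [PA]) l h1 (fun x hx => nb_sub _ _ _ (h2 x hx)) h3
  have := hG (4, 2, 99) (by simp [PA]) (v :: l) (nodup_nb (co_irr A) h1 h2) (mem_cons_nb hv h2)
    (by simp [h3])
  rw [ec_cons_co h2] at this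
  simp only at this h3 ha ⊢
  omega

theorem deg_le_one {A : V → V → Bool} (hi : ∀ x, A x x = false) {N : Finset V}
    (hG : Good A [(2, 0, 1)] N) {x : V} (hx : x ∈ N) : deg A N x ≤ 1 := by
  by_contra hc
  obtain ⟨y, z, hy, hz, hyz⟩ := Finset.one_lt_card_iff.1 (not_le.1 hc)
  simp only [Finset.mem_filter] at hy hz
  have hxy : x ≠ y := fun e => by rw [e, hi] at hy; simp at hy
  have hxz : x ≠ z := fun e => by rw [e, hi] at hz; simp at hz
  have := (hG (2, 0, 1) (by simp) [x, y, z] (by simp [hxy, hxz, hyz]) (by simp [hx, hy.1, hz.1]) rfl).2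
  simp [ec, hy.2, hz.2] at this

/-- R(K₄-e, K₅-e) ≤ 13 -/
theorem r13 {A : V → V → Bool} (hs : ∀ x y, A x y = A y x) (hi : ∀ x, A x x = false)
    {R : Finset V} (hG : Good A PA R) : R.card < 13 := by
  classical
  by_contra hc
  obtain ⟨R', h1, h2⟩ := Finset.exists_subset_card_eq (not_lt.1 hc)
  replace hG := hG.mono h1
  clear hc h1
  have hco := fun x y => co_symm hs x y
  have key : ∀ v ∈ R', (degsum A (nb A R' v) + degsum (co A) (nb (co A) R' v) + deg A R' v +
      deg (co A) R' v + deg (co A) R' v * deg A R' v ≤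
      deg (co A) R' v * deg (co A) R' v + deg A R' v * deg A R' v) ∧
      (deg A R' v = 6 ∨ degsum A (nb A R' v) + degsum (co A) (nb (co A) R' v) + deg A R' v +
      deg (co A) R' v + deg (co A) R' v * deg A R' v <
      deg (co A) R' v * deg (co A) R' v + deg A R' v * deg A R' v) ∧
      (deg A R' v = 6 → degsum A (nb A R' v) ≤ 6 ∧ degsum (co A) (nb (co A) R' v) ≤ 18) := by
    intro v hv
    have hd := deg_co hi hv
    have hM := good_nb_M hi hG hv
    have hD := good_nb_DD hG hv
    have a1 : deg A R' v < 7 := clM7.empty hs hi hM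
    have a2 : deg (co A) R' v < 10 := clDD10.empty hs hi hD
    have a3 : degsum A (nb A R' v) ≤ deg A R' v := by
      have : ∑ x ∈ nb A R' v, deg A (nb A R' v) x ≤ ∑ x ∈ nb A R' v, 1 :=
        Finset.sum_le_sum (fun x hx => deg_le_one hi (good_single hM (by simp [PM])) hx)
      simpa [degsum, card_nb] using this
    obtain ⟨e, he⟩ := degsum_even hs hi (nb A R' v)
    have hD' : Good (co A) PDD (nb (co A) R' v) :=
      good_co hD (good_nil _ _) 2 4 (by decide) (by decide)
    have b6 : deg (co A) R' v = 6 → degsum (co A) (nb (co A) R' v) ≤ 18 := fun h =>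
      clDD6.bound 18 (by decide +kernel) (by omega) hco (co_irr A) h hD'
    have b7 : deg (co A) R' v = 7 → degsum (co A) (nb (co A) R' v) ≤ 22 := fun h =>
      clDD7.bound 22 (by decide +kernel) (by omega) hco (co_irr A) h hD'
    have b8 : deg (co A) R' v = 8 → degsum (co A) (nb (co A) R' v) ≤ 28 := fun h =>
      clDD8.bound 28 (by decide +kernel) (by omega) hco (co_irr A) h hD'
    have b9 : deg (co A) R' v = 9 → degsum (co A) (nb (co A) R' v) ≤ 36 := fun h =>
      clDD9.bound 36 (by decide +kernel) (by omega) hco (co_irr A) h hD'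
    rw [h2] at hd
    generalize deg A R' v = d at *
    generalize deg (co A) R' v = m at *
    have : (d = 3 ∧ m = 9) ∨ (d = 4 ∧ m = 8) ∨ (d = 5 ∧ m = 7) ∨ (d = 6 ∧ m = 6) := by omega
    rcases this with ⟨rfl, rfl⟩ | ⟨rfl, rfl⟩ | ⟨rfl, rfl⟩ | ⟨rfl, rfl⟩
    · have := b9 rfl; omega
    · have := b8 rfl; omega
    · have := b7 rfl; omega
    · have := b6 rfl; omega
  have hg := goodman hs hi R'
  have hall : ∀ v ∈ R', deg A R' v = 6 := by
    by_contra hx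
    push Not at hx
    obtain ⟨v, hv, hne⟩ := hx
    exact absurd hg (ne_of_lt (Finset.sum_lt_sum (fun v hv => (key v hv).1)
      ⟨v, hv, ((key v hv).2.1).resolve_left hne⟩))
  have heq := (Finset.sum_eq_sum_iff_of_le (fun v hv => (key v hv).1)).1 hg
  obtain ⟨v, hv⟩ : R'.Nonempty := Finset.card_pos.1 (by omega)
  have h6 := hall v hv
  have hm6 : deg (co A) R' v = 6 := by have := deg_co hi hv; omega
  have hq := heq v hv
  rw [h6, hm6] at hq
  have hb := (key v hv).2.2 h6
  set N := nb A R' v with hN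
  set M := nb (co A) R' v with hM
  have hMG := good_nb_M hi hG hv
  have hN6 : degsum A N = 6 := by omega
  have hle : ∀ x ∈ N, deg A N x ≤ 1 :=
    fun x hx => deg_le_one hi (good_single hMG (by simp [PM])) hx
  have hNc : N.card = 6 := h6
  have hMc : M.card = 6 := hm6
  have h1N : ∀ x ∈ N, deg A N x = 1 := by
    have : ∑ x ∈ N, deg A N x = ∑ x ∈ N, 1 := by
      simp only [Finset.sum_const, smul_eq_mul, mul_one]; rw [hNc]; exact hN6
    exact (Finset.sum_eq_sum_iff_of_le hle).1 this
  have hcr : ∑ x ∈ N, deg A M x = 24 := by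
    have : ∑ x ∈ N, deg A M x = ∑ x ∈ N, 4 := by
      apply Finset.sum_congr rfl
      intro x hx
      have h3 := deg_split hs hi x hv
      rw [hall x (nb_sub _ _ _ hx), ← hN, ← hM, h1N x hx, (mem_nb.1 hx).2] at h3
      simp at h3; omega
    rw [this]; simp [hNc]
  rw [cross_comm hs] at hcr
  obtain ⟨b, hbM, hb4⟩ : ∃ b ∈ M, 3 < deg A N b := by
    by_contra hx
    push Not at hx
    have := Finset.sum_le_sum hx
    rw [hcr] at this
    simp [hMc] at this
  -- the neighbours of `b` in `N` are independent
  set T := nb A N b with hT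
  have hT4 : 4 ≤ T.card := hb4
  have hind : ∀ x ∈ T, ∀ y ∈ T, A x y = false := by
    intro x hx y hy
    by_contra hxy
    simp only [Bool.not_eq_false] at hxy
    have hx' := mem_nb.1 hx
    have hy' := mem_nb.1 hy
    have hxN := mem_nb.1 hx'.1
    have hyN := mem_nb.1 hy'.1
    have hbM' := mem_nb.1 hbM
    have n1 : x ≠ y := fun e => by rw [e, hi] at hxy; cases hxy
    have n2 : b ≠ v := fun e => by rw [e, co_irr] at hbM'; simp at hbM'
    have n3 : b ≠ x := fun e => by rw [e, hi] at hx'; simp at hx'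
    have n4 : b ≠ y := fun e => by rw [e, hi] at hy'; simp at hy'
    have n5 : v ≠ x := fun e => by rw [e, hi] at hxN; simp at hxN
    have n6 : v ≠ y := fun e => by rw [e, hi] at hyN; simp at hyN
    have := (hG (3, 0, 4) (by simp [PA]) [b, v, x, y] (by simp [n1, n2, n3, n4, n5, n6])
      (by simp [hv, hbM'.1, hxN.1, hyN.1]) rfl).2
    simp [ec, hxy, hx'.2, hy'.2, hxN.2, hyN.2, List.countP_cons] at this
    omega
  have hsd : Disjoint T (N \ T) := Finset.disjoint_sdiff
  have hTN : T ⊆ N := nb_sub _ _ _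
  have hsum : ∑ x ∈ T, deg A (N \ T) x = T.card := by
    have : ∑ x ∈ T, deg A (N \ T) x = ∑ x ∈ T, 1 := by
      apply Finset.sum_congr rfl
      intro x hx
      have h3 := h1N x (hTN hx)
      have h4 := deg_union (A := A) hsd x
      rw [Finset.union_sdiff_of_subset hTN, h3] at h4
      have h5 : deg A T x = 0 := by
        rw [deg, Finset.card_eq_zero, Finset.filter_eq_empty_iff]
        intro y hy; rw [hind x hx y hy]; simp
      omega
    rw [this]; simp
  rw [cross_comm hs] at hsum
  have hfin : ∑ x ∈ N \ T, deg A T x ≤ ∑ x ∈ N \ T, 1 := by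
    apply Finset.sum_le_sum
    intro x hx
    have h3 := hle x (Finset.sdiff_subset hx)
    exact (Finset.card_le_card (Finset.filter_subset_filter _ hTN)).trans h3
  have hcd := Finset.card_sdiff_add_card_eq_card hTN
  rw [hsum] at hfin
  simp at hfin
  omega
end r13

/-! #### Gluing -/

section glue
variable {V : Type}

def PH : List (ℕ × ℕ × ℕ) := [(4, 2, 8)]
def PG : List (ℕ × ℕ × ℕ) := [(3, 0, 5), (4, 2, 99)]

def andMap (F x y : ℕ) : List (ℕ × ℕ) → ℕ
  | [] => F
  | p :: l => bif Nat.beq p.1 x || Nat.beq p.1 y then p.2 &&& andMap F x y l else andMap F x y l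

def orL : List ℕ → ℕ
  | [] => 0
  | c :: l => (1 <<< c) ||| orL l

def bt (C i : ℕ) : ℕ := (C >>> i) % 2

def cnt (C : ℕ) : List (ℕ × ℕ) → ℕ
  | [] => 0
  | x :: l => bt C x.1 + cnt C l

/-- sets `D` incompatible with a set meeting the triple `vs` suitably -/
def badOne (F : ℕ) (vs : List (ℕ × ℕ)) (s : ℕ) : ℕ :=
  bif Nat.ble s 1 then F ^^^ th F (2 - s) vs else
  bif Nat.ble s 5 then 0 else th F (9 - s) vs

def tr1 (F g ε C : ℕ) (x y : ℕ × ℕ) : List (ℕ × ℕ) → ℕ → ℕ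
  | [], _ => 0
  | z :: zs, e => badOne F [z, y, x] (ad g z.1 y.1 + ad g z.1 x.1 + bt C z.1 + e) |||
      tr1 F g ε C x y zs e

def tr2 (F g ε C : ℕ) (x : ℕ × ℕ) : List (ℕ × ℕ) → ℕ → ℕ
  | [], _ => 0
  | y :: ys, e => tr1 F g ε C x y ys (ad g y.1 x.1 + bt C y.1 + e) ||| tr2 F g ε C x ys e

/-- bitmap of the sets incompatible with `C` -/
def tr3 (F g ε C : ℕ) : List (ℕ × ℕ) → ℕ
  | [] => 0
  | x :: xs => tr2 F g ε C x xs (bt C x.1 + ε) ||| tr3 F g ε C xs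

def cliqueOK (g m : ℕ) (K : List ℕ) : Bool :=
  K.all fun C => Nat.beq (orL K ||| tr3 (full m) g 0 C (vlist m)) (tr3 (full m) g 0 C (vlist m)) &&
    Nat.beq (orL K ||| tr3 (full m) g 1 C (vlist m)) (tr3 (full m) g 1 C (vlist m))

def covL (m : ℕ) (P : List (ℕ × ℕ)) (K : List (List ℕ)) : List (ℕ × ℕ) :=
  P.map (fun e => (0, andMap (full m) e.1 e.2 (vlist m))) ++ K.map (fun k => (0, orL k))

def glueOK (nB m g : ℕ) (c : ℕ × List (ℕ × ℕ) × List (List ℕ)) : Bool :=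
  Nat.beq (extMap g m PG ||| th (full m) c.1 (covL m c.2.1 c.2.2))
    (th (full m) c.1 (covL m c.2.1 c.2.2)) &&
  (c.2.1.all (fun e => Nat.ble (e.1 + 1) e.2 && Nat.ble (e.2 + 1) m && Nat.beq (ad g e.1 e.2) 1) &&
  (c.2.2.all (cliqueOK g m) &&
  Nat.ble (4 * c.2.1.length + c.2.2.length + 1) (c.1 * nB)))

def glueAll (nB m : ℕ) : List ℕ → List (ℕ × List (ℕ × ℕ) × List (List ℕ)) → Bool
  | [], _ => true
  | _ :: _, [] => false
  | g :: G, c :: cs => glueOK nB m g c && glueAll nB m G cs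

def cov11 : List (ℕ × List (ℕ × ℕ) × List (List ℕ)) :=
  [(1, [(3, 8), (8, 9)], []),
   (1, [(1, 3)], [[881], [1763, 419, 1442, 1443, 483, 1251, 1506, 1507], [1821, 812, 1324, 1836, 828, 1340, 1820, 1852], [1132, 1388], [1426, 1458]]),
   (1, [(4, 6), (4, 7)], [[1382, 1444, 1446, 1508, 1510, 1764, 1766, 1888, 1890, 1892, 1894, 1954, 1956, 1958, 2016, 2018, 2020, 2022]]),
   (1, [(5, 6), (9, 10)], [[1444, 1446]]),
   (1, [(3, 6), (4, 6)], []),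
   (1, [(0, 8), (7, 10)], [[730]]),
   (2, [(4, 6), (7, 9), (0, 8), (2, 10)], [[1362, 1392, 1394, 1488, 1490, 1520, 1522, 1888, 1892, 1904], [1888, 1889, 1928, 1936, 1944, 1952, 1960, 1968, 1976, 2016]]),
   (1, [(9, 10)], [[474], [803, 931, 1351, 1415, 1479], [1173, 1429, 1413, 1477], [1359, 1476, 1478]]),
   (1, [(7, 8)], [[1644], [761, 1681, 1688, 1689, 1720, 697, 1713, 1721], [1359, 1795, 1858, 1859, 1862, 1351, 1799, 1863], [803, 1827], [1173, 1685]]),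
   (1, [(9, 10)], [[474], [1109, 1361, 1365, 1117, 1357, 1369, 1373, 1349], [1413, 1476, 1477, 1351, 1415, 1478, 1479], [335, 1359]]),
   (1, [(1, 8), (7, 8)], [[93, 325, 333, 341, 349, 589, 605, 837, 844, 845, 853, 860, 861, 1109, 1117, 1349, 1357, 1361, 1365, 1369, 1373, 1612, 1613, 1617, 1621, 1624, 1625, 1628, 1629, 1856, 1857, 1860, 1861, 1864, 1865, 1868, 1869, 1872, 1873, 1876, 1877, 1880, 1881, 1884, 1885]]),
   (1, [(3, 9), (9, 10)], [])]

def cov12 : List (ℕ × List (ℕ × ℕ) × List (List ℕ)) :=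
  [(1, [(0, 11)], [[474], [1644], [1974]])]

set_option maxRecDepth 100000 in
theorem glue11 : glueAll 10 11 (datA11.map Prod.fst) cov11 = true := by decide +kernel
set_option maxRecDepth 100000 in
theorem glue12 : glueAll 9 12 (datA12.map Prod.fst) cov12 = true := by decide +kernel

end glue

section glue2
variable {V : Type}

theorem th_gen {F S : ℕ} (h : F.testBit S = true) (vs : List (ℕ × ℕ)) (t : ℕ) :
    (th F t vs).testBit S = decide (t ≤ vs.countP (fun p => p.2.testBit S)) := by
  induction vs generalizing t with
  | nil => cases t <;> simp [th, h]
  | cons v vs ih =>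
    cases t with
    | zero => simp [th, h]
    | succ t =>
      rw [th, Nat.testBit_or, Nat.testBit_and, ih, ih, List.countP_cons]
      cases hb : v.2.testBit S <;> simp
      omega

theorem andMap_sound {F S x y : ℕ} (l : List (ℕ × ℕ)) (h : (andMap F x y l).testBit S = true) :
    ∀ p ∈ l, p.1 = x ∨ p.1 = y → p.2.testBit S = true := by
  induction l with
  | nil => simp
  | cons q l ih =>
    rw [andMap] at h
    intro p hp hxy
    rcases List.mem_cons.1 hp with rfl | hp
    · have : (Nat.beq p.1 x || Nat.beq p.1 y) = true := by
        simpa [Nat.beq_eq] using hxy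
      rw [this] at h
      simp only [cond_true, Nat.testBit_and, Bool.and_eq_true] at h
      exact h.1
    · refine ih ?_ p hp hxy
      cases hc : (Nat.beq q.1 x || Nat.beq q.1 y) <;> rw [hc] at h
      · exact h
      · simp only [cond_true, Nat.testBit_and, Bool.and_eq_true] at h
        exact h.2

theorem orL_testBit (l : List ℕ) (S : ℕ) : (orL l).testBit S = decide (S ∈ l) := by
  induction l with
  | nil => simp [orL]
  | cons c l ih =>
    rw [orL, Nat.testBit_or, ih, Nat.one_shiftLeft, Nat.testBit_two_pow]
    simp [eq_comm]

theorem testBit_of_or_eq {a b S : ℕ} (h : Nat.beq (a ||| b) b = true) (ha : a.testBit S = true) :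
    b.testBit S = true := by
  rw [← Nat.eq_of_beq_eq_true h, Nat.testBit_or, ha, Bool.true_or]

theorem bt_eq (C i : ℕ) : bt C i = (C.testBit i).toNat := by
  rw [bt, Nat.toNat_testBit, Nat.shiftRight_eq_div_pow]

theorem badOne_sound {m D s : ℕ} (hD : D < 2 ^ m) {x y z : ℕ × ℕ}
    (hv : VOK D [z, y, x]) (h : (badOne (full m) [z, y, x] s).testBit D = true) :
    s + (D.testBit z.1).toNat + (D.testBit y.1).toNat + (D.testBit x.1).toNat ≤ 1 ∨
    9 ≤ s + (D.testBit z.1).toNat + (D.testBit y.1).toNat + (D.testBit x.1).toNat := by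
  have hc : [z, y, x].countP (fun p => D.testBit p.1) =
      (D.testBit z.1).toNat + (D.testBit y.1).toNat + (D.testBit x.1).toNat := by
    simp only [List.countP_cons, List.countP_nil]
    cases D.testBit z.1 <;> cases D.testBit y.1 <;> cases D.testBit x.1 <;> rfl
  unfold badOne at h
  by_cases h1 : s ≤ 1
  · rw [Nat.ble_eq_true_of_le h1] at h
    simp only [cond_true, Nat.testBit_xor, full_testBit hD, th_testBit hD _ hv, hc] at h
    simp at h
    omega
  · have h1' : Nat.ble s 1 = false := by
      rw [Bool.eq_false_iff]; exact fun h' => h1 (Nat.le_of_ble_eq_true h')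
    rw [h1'] at h
    by_cases h2 : s ≤ 5
    · rw [Nat.ble_eq_true_of_le h2] at h; simp at h
    · have h2' : Nat.ble s 5 = false := by
        rw [Bool.eq_false_iff]; exact fun h' => h2 (Nat.le_of_ble_eq_true h')
      rw [h2'] at h
      simp only [cond_false, th_testBit hD _ hv, hc] at h
      simp at h
      omega

theorem tr1_sound {m g ε C D e : ℕ} (hD : D < 2 ^ m) {x y : ℕ × ℕ} (zs : List (ℕ × ℕ))
    (hv : VOK D (x :: y :: zs)) (h : (tr1 (full m) g ε C x y zs e).testBit D = true) :
    ∃ z ∈ zs, ∃ s, s = ad g z.1 y.1 + ad g z.1 x.1 + bt C z.1 + e +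
      (D.testBit z.1).toNat + (D.testBit y.1).toNat + (D.testBit x.1).toNat ∧ (s ≤ 1 ∨ 9 ≤ s) := by
  induction zs with
  | nil => simp [tr1] at h
  | cons z zs ih =>
    rw [tr1, Nat.testBit_or, Bool.or_eq_true] at h
    rcases h with h | h
    · refine ⟨z, by simp, _, rfl, badOne_sound hD ?_ h⟩
      intro p hp; apply hv; simp at hp ⊢; tauto
    · obtain ⟨z', hz, hr⟩ := ih (fun p hp => hv p (by simp at hp ⊢; tauto)) h
      exact ⟨z', by simp [hz], hr⟩

theorem tr2_sound {m g ε C D e : ℕ} (hD : D < 2 ^ m) {x : ℕ × ℕ} (ys : List (ℕ × ℕ))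
    (hp : ys.Pairwise (fun p q => q.1 < p.1))
    (hv : VOK D (x :: ys)) (h : (tr2 (full m) g ε C x ys e).testBit D = true) :
    ∃ y ∈ ys, ∃ z ∈ ys, z.1 < y.1 ∧ ∃ s, s = ad g z.1 y.1 + ad g z.1 x.1 + bt C z.1 +
      (ad g y.1 x.1 + bt C y.1 + e) +
      (D.testBit z.1).toNat + (D.testBit y.1).toNat + (D.testBit x.1).toNat ∧ (s ≤ 1 ∨ 9 ≤ s) := by
  induction ys with
  | nil => simp [tr2] at h
  | cons y ys ih =>
    rw [tr2, Nat.testBit_or, Bool.or_eq_true] at h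
    rw [List.pairwise_cons] at hp
    rcases h with h | h
    · obtain ⟨z, hz, hr⟩ := tr1_sound hD ys hv h
      exact ⟨y, by simp, z, by simp [hz], hp.1 z hz, hr⟩
    · obtain ⟨y', hy, z', hz, hr⟩ := ih hp.2 (fun p hp => hv p (by simp at hp ⊢; tauto)) h
      exact ⟨y', by simp [hy], z', by simp [hz], hr⟩

theorem tr3_sound {m g ε C D : ℕ} (hD : D < 2 ^ m) (xs : List (ℕ × ℕ))
    (hp : xs.Pairwise (fun p q => q.1 < p.1))
    (hv : VOK D xs) (h : (tr3 (full m) g ε C xs).testBit D = true) :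
    ∃ x ∈ xs, ∃ y ∈ xs, ∃ z ∈ xs, z.1 < y.1 ∧ y.1 < x.1 ∧ ∃ s,
      s = ad g z.1 y.1 + ad g z.1 x.1 + bt C z.1 +
      (ad g y.1 x.1 + bt C y.1 + (bt C x.1 + ε)) +
      (D.testBit z.1).toNat + (D.testBit y.1).toNat + (D.testBit x.1).toNat ∧ (s ≤ 1 ∨ 9 ≤ s) := by
  induction xs with
  | nil => simp [tr3] at h
  | cons x xs ih =>
    rw [tr3, Nat.testBit_or, Bool.or_eq_true] at h
    rw [List.pairwise_cons] at hp
    rcases h with h | h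
    · obtain ⟨y, hy, z, hz, hzy, hr⟩ := tr2_sound hD xs hp.2 hv h
      exact ⟨x, by simp, y, by simp [hy], z, by simp [hz], hzy, hp.1 y hy, hr⟩
    · obtain ⟨x', hx, y', hy, z', hz, hr⟩ := ih hp.2 (fun p hp => hv p (by simp at hp ⊢; tauto)) h
      exact ⟨x', by simp [hx], y', by simp [hy], z', by simp [hz], hr⟩

theorem good_nb_PA {A : V → V → Bool} (hi : ∀ x, A x x = false)
    {R : Finset V} (hG : Good A PH R) {v : V} (hv : v ∈ R) : Good A PA (nb A R v) := by
  unfold PA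
  rw [good_cons]
  constructor
  · intro l h1 h2 h3
    have := hG (4, 2, 8) (by simp [PH]) (v :: l) (nodup_nb hi h1 h2) (mem_cons_nb hv h2) (by simp [h3])
    rw [ec_cons_nb h2] at this
    simp only at this h3 ⊢
    omega
  · intro q hq l h1 h2 h3
    simp only [List.mem_singleton] at hq
    subst hq
    have := hG (4, 2, 8) (by simp [PH]) l h1 (fun x hx => nb_sub _ _ _ (h2 x hx)) h3
    simp only at this h3 ⊢
    omega

theorem good_insert_PG [DecidableEq V] {A : V → V → Bool} 
    {R : Finset V} (hG : Good A PH R) {v b : V} (hv : v ∈ R) (hb : b ∈ R) (hbv : b ≠ v)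
    (hi : ∀ x, A x x = false) :
    Good A PG (insert b (nb A R v)) := by
  have hsub : insert b (nb A R v) ⊆ R := by
    intro x hx
    rcases Finset.mem_insert.1 hx with rfl | hx
    · exact hb
    · exact nb_sub _ _ _ hx
  unfold PG
  rw [good_cons]
  constructor
  · intro l h1 h2 h3
    have hvl : v ∉ l := by
      intro hvl
      rcases Finset.mem_insert.1 (h2 v hvl) with h | h
      · exact hbv h.symm
      · have := (mem_nb.1 h).2; rw [hi] at this; cases this
    have := (hG (4, 2, 8) (by simp [PH]) (v :: l) (by simp [hvl, h1])
      (by intro x hx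
          rcases List.mem_cons.1 hx with rfl | hx
          · exact hv
          · exact hsub (h2 x hx)) (by simp [h3])).2
    rw [ec] at this
    have hc : l.length ≤ l.countP (A v) + l.count b := by
      rw [List.length_eq_countP_add_countP (A v), List.count]
      apply Nat.add_le_add_left
      apply List.countP_mono_left
      intro x hx hxv
      rcases Finset.mem_insert.1 (h2 x hx) with h | h
      · simp [h]
      · have := (mem_nb.1 h).2; simp [this] at hxv
    have := List.nodup_iff_count_le_one.1 h1 b
    simp only at *
    omega
  · intro q hq l h1 h2 h3
    simp only [List.mem_singleton] at hq
    subst hq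
    have := hG (4, 2, 8) (by simp [PH]) l h1 (fun x hx => hsub (h2 x hx)) h3
    simp only at this h3 ⊢
    omega

theorem card_common [DecidableEq V] {A : V → V → Bool} (hs : ∀ x y, A x y = A y x) (hi : ∀ x, A x x = false)
    {R : Finset V} (hG : Good A PH R) {v x y : V} (hv : v ∈ R) (hx : x ∈ nb A R v) (hy : y ∈ nb A R v)
    (hxy : A x y = true) :
    ((nb (co A) R v).filter (fun b => A x b = true ∧ A y b = true)).card ≤ 4 := by
  have : Good A PQ ((nb (co A) R v).filter (fun b => A x b = true ∧ A y b = true)) := by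
    unfold PQ
    rw [good_cons]
    constructor
    · intro l h1 h2 h3
      have hxl : x ∉ l := by
        intro h; have := (Finset.mem_filter.1 (h2 x h)).2.1; rw [hi] at this; cases this
      have hyl : y ∉ l := by
        intro h; have := (Finset.mem_filter.1 (h2 y h)).2.2; rw [hi] at this; cases this
      have hne : x ≠ y := by rintro rfl; rw [hi] at hxy; cases hxy
      have := (hG (4, 2, 8) (by simp [PH]) (x :: y :: l) (by simp [hxl, hyl, h1, hne])
        (by intro z hz
            simp only [List.mem_cons] at hz
            rcases hz with rfl | rfl | hz
            · exact nb_sub _ _ _ hx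
            · exact nb_sub _ _ _ hy
            · exact nb_sub _ _ _ (Finset.mem_filter.1 (h2 z hz)).1) (by simp [h3])).2
      rw [ec, ec, List.countP_cons, List.countP_eq_length.2, List.countP_eq_length.2, hxy] at this
      · simp only [if_true] at this h3 ⊢
        omega
      · intro z hz; exact (Finset.mem_filter.1 (h2 z hz)).2.1
      · intro z hz; exact (Finset.mem_filter.1 (h2 z hz)).2.2
    · intro q hq l h1 h2 h3
      simp only [List.mem_singleton] at hq
      subst hq
      have h2' : ∀ z ∈ l, z ∈ nb (co A) R v := fun z hz => (Finset.mem_filter.1 (h2 z hz)).1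
      have := hG (4, 2, 8) (by simp [PH]) (v :: l) (nodup_nb (co_irr A) h1 h2') (mem_cons_nb hv h2')
        (by simp [h3])
      rw [ec_cons_co h2'] at this
      simp only at this h3 ⊢
      refine ⟨this.1, ?_⟩
      omega
  have := clQ5.empty hs hi this
  omega

theorem glue_sound {A : V → V → Bool} (hs : ∀ x y, A x y = A y x) (hi : ∀ x, A x x = false)
    [DecidableEq V] {R : Finset V} (hG : Good A PH R) {v : V} (hv : v ∈ R) {g m nB : ℕ} {f : ℕ → V}
    (hf : Realizes A (nb A R v) g m f) (hB : (nb (co A) R v).card = nB)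
    {c : ℕ × List (ℕ × ℕ) × List (List ℕ)} (hc : glueOK nB m g c = true) : False := by
  obtain ⟨W, P1, K⟩ := c
  simp only [glueOK, Bool.and_eq_true] at hc
  obtain ⟨h1, h2, h3, h4⟩ := hc
  set M := nb (co A) R v with hM
  let S : V → ℕ := fun b => Nat.ofBits (n := m) (fun i => A b (f i))
  have hS : ∀ b, S b < 2 ^ m := fun b => Nat.ofBits_lt_two_pow _
  have hbit : ∀ b, ∀ i < m, (S b).testBit i = A b (f i) := fun b i h => Nat.testBit_ofBits_lt _ _ h
  have hMv : ∀ b ∈ M, b ∈ R ∧ b ≠ v ∧ A v b = false := by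
    intro b hb
    have := mem_nb.1 hb
    simp [co] at this
    exact ⟨this.1, fun e => this.2.1 e.symm, this.2.2⟩
  have hMf : ∀ b ∈ M, ∀ i < m, f i ≠ b := by
    intro b hb i hi' e
    have := (mem_nb.1 (hf.mem i hi')).2
    rw [e, (hMv b hb).2.2] at this; cases this
  have hW : ∀ b ∈ M, W ≤ (covL m P1 K).countP (fun p => p.2.testBit (S b)) := by
    intro b hb
    have hx := extMap_sound hf (Finset.subset_insert b _) (Finset.mem_insert_self b _)
      (hMf b hb) (hS b) (hbit b) PG (good_insert_PG hG hv (hMv b hb).1 (hMv b hb).2.1 hi)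
    have := testBit_of_or_eq h1 hx
    rw [th_gen (full_testBit (hS b))] at this
    simpa using this
  have hsum : ∀ L : List (ℕ × ℕ), ∑ b ∈ M, L.countP (fun p => p.2.testBit (S b)) =
      (L.map (fun p => (M.filter (fun b => p.2.testBit (S b) = true)).card)).sum := by
    intro L
    induction L with
    | nil => simp
    | cons p L ih =>
      simp only [List.countP_cons, Finset.sum_add_distrib, ih, List.map_cons, List.sum_cons,
        Finset.card_filter]
      rw [add_comm]
  have hP : ((P1.map (fun e => (0, andMap (full m) e.1 e.2 (vlist m)))).map
      (fun p : ℕ × ℕ => (M.filter (fun b => p.2.testBit (S b) = true)).card)).sum ≤ P1.length * 4 := by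
    rw [List.map_map]
    refine (List.sum_le_card_nsmul _ 4 ?_).trans (by simp)
    intro n hn
    obtain ⟨e, he, rfl⟩ := List.mem_map.1 hn
    have := List.all_eq_true.1 h2 e he
    simp only [Bool.and_eq_true] at this
    have a1 := Nat.le_of_ble_eq_true this.1.1
    have a2 := Nat.le_of_ble_eq_true this.1.2
    have a3 := Nat.eq_of_beq_eq_true this.2
    have hadj : A (f e.1) (f e.2) = true := by
      rw [hf.adj _ _ a1 a2] at a3
      simpa using a3
    refine (Finset.card_le_card ?_).trans
      (card_common hs hi hG hv (hf.mem e.1 (by omega)) (hf.mem e.2 a2) hadj)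
    intro b hb
    obtain ⟨hb, hb2⟩ := Finset.mem_filter.1 hb
    refine Finset.mem_filter.2 ⟨hb, ?_⟩
    have hand := andMap_sound _ hb2
    have hmem : ∀ i < m, (i = e.1 ∨ i = e.2) → A (f i) b = true := by
      intro i him hie
      have : i ∈ (vlist m).map Prod.fst := by rw [vlist_fst]; simpa using him
      obtain ⟨p, hp, rfl⟩ := List.mem_map.1 this
      have := hand p hp hie
      rw [vlist_ok (hS b) p hp, hbit b _ him] at this
      rw [hs]; exact this
    exact ⟨hmem _ (by omega) (Or.inl rfl), hmem _ a2 (Or.inr rfl)⟩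
  have hK : ((K.map (fun k => (0, orL k))).map
      (fun p : ℕ × ℕ => (M.filter (fun b => p.2.testBit (S b) = true)).card)).sum ≤ K.length * 1 := by
    rw [List.map_map]
    refine (List.sum_le_card_nsmul _ 1 ?_).trans (by simp)
    intro n hn
    obtain ⟨k, hk, rfl⟩ := List.mem_map.1 hn
    have hck := List.all_eq_true.1 h3 k hk
    simp only [Function.comp]
    rw [Finset.card_le_one]
    intro b hb b' hb'
    by_contra hne
    simp only [Finset.mem_filter, orL_testBit, decide_eq_true_eq] at hb hb'
    have := List.all_eq_true.1 hck (S b) hb.2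
    simp only [Bool.and_eq_true] at this
    have hD : (orL k).testBit (S b') = true := by simp [orL_testBit, hb'.2]
    have htr : (tr3 (full m) g (A b b').toNat (S b) (vlist m)).testBit (S b') = true := by
      cases A b b'
      · exact testBit_of_or_eq this.1 hD
      · exact testBit_of_or_eq this.2 hD
    obtain ⟨x, hx, y, hy, z, hz, hzy, hyx, s, hs1, hs2⟩ :=
      tr3_sound (hS b') _ (vlist_pairwise m) (vlist_ok (hS b')) htr
    have hx := vlist_lt hx
    have hy := vlist_lt hy
    have hz := vlist_lt hz
    rw [hf.adj _ _ hzy hy, hf.adj _ _ (hzy.trans hyx) hx, hf.adj _ _ hyx hx, bt_eq, bt_eq, bt_eq,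
      hbit _ _ hx, hbit _ _ hy, hbit _ _ hz, hbit _ _ hx, hbit _ _ hy, hbit _ _ hz] at hs1
    have n1 : f z.1 ≠ f y.1 := fun e => by have := hf.inj _ hz _ hy e; omega
    have n2 : f z.1 ≠ f x.1 := fun e => by have := hf.inj _ hz _ hx e; omega
    have n3 : f y.1 ≠ f x.1 := fun e => by have := hf.inj _ hy _ hx e; omega
    have := hG (4, 2, 8) (by simp [PH]) [b, b', f z.1, f y.1, f x.1]
      (by simp [hne, n1, n2, n3, (hMf b hb.1 _ hx).symm, (hMf b hb.1 _ hy).symm,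
            (hMf b hb.1 _ hz).symm, (hMf b' hb'.1 _ hx).symm, (hMf b' hb'.1 _ hy).symm,
            (hMf b' hb'.1 _ hz).symm])
      (by intro w hw
          simp only [List.mem_cons, List.not_mem_nil, or_false] at hw
          rcases hw with rfl | rfl | rfl | rfl | rfl
          · exact (hMv _ hb.1).1
          · exact (hMv _ hb'.1).1
          · exact nb_sub _ _ _ (hf.mem _ hz)
          · exact nb_sub _ _ _ (hf.mem _ hy)
          · exact nb_sub _ _ _ (hf.mem _ hx)) rfl
    have hite : ∀ q : Bool, (if q = true then 1 else 0) = q.toNat := by decide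
    simp only [ec, List.countP_cons, List.countP_nil, hite] at this
    omega
  have h5 : ∑ b ∈ M, W ≤ ∑ b ∈ M, (covL m P1 K).countP (fun p => p.2.testBit (S b)) :=
    Finset.sum_le_sum hW
  rw [hsum, covL, List.map_append, List.sum_append] at h5
  have h6 := Nat.le_of_ble_eq_true h4
  simp only [Finset.sum_const, smul_eq_mul] at h5
  rw [hB, mul_comm] at h5
  omega

theorem glueAll_sound {nB m : ℕ} {G : List ℕ} : ∀ {C : List (ℕ × List (ℕ × ℕ) × List (List ℕ))},
    glueAll nB m G C = true → ∀ g ∈ G, ∃ c, glueOK nB m g c = true := by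
  induction G with
  | nil => simp
  | cons g G ih =>
    intro C h
    cases C with
    | nil => simp [glueAll] at h
    | cons c C =>
      rw [glueAll, Bool.and_eq_true] at h
      intro g' hg
      rcases List.mem_cons.1 hg with rfl | hg
      · exact ⟨c, h.1⟩
      · exact ih h.2 g' hg

end glue2

section ram
variable {V : Type}

theorem nb_lemma {A : V → V → Bool} (hs : ∀ x y, A x y = A y x) (hi : ∀ x, A x x = false)
    [DecidableEq V] {R : Finset V} (hR : R.card = 22) (hG : Good A PH R) {v : V} (hv : v ∈ R) :
    deg A R v ≤ 12 ∧ (deg A R v = 9 → degsum A (nb A R v) ≤ 36) ∧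
    (deg A R v = 10 → degsum A (nb A R v) ≤ 42) ∧ (deg A R v = 11 → degsum A (nb A R v) ≤ 47) ∧
    (deg A R v = 12 → degsum A (nb A R v) ≤ 59) := by
  have hN := good_nb_PA hi hG hv
  have hd := deg_co hi hv
  rw [hR] at hd
  refine ⟨Nat.lt_succ_iff.1 (r13 hs hi hN), fun h => ?_, fun h => ?_, fun h => ?_, fun h => ?_⟩
  · exact clA9.bound 36 (by decide +kernel) (by omega) hs hi h hN
  · exact clA10.bound 42 (by decide +kernel) (by omega) hs hi h hN
  · by_contra hc
    obtain ⟨g, hg, f, hf⟩ := clA11 V A hs hi (nb A R v) h hN (by omega)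
    obtain ⟨c, hc⟩ := glueAll_sound glue11 g hg
    exact glue_sound hs hi hG hv hf (show deg (co A) R v = 10 by omega) hc
  · by_contra hc
    obtain ⟨g, hg, f, hf⟩ := clA12 V A hs hi (nb A R v) h hN (by omega)
    obtain ⟨c, hc⟩ := glueAll_sound glue12 g hg
    exact glue_sound hs hi hG hv hf (show deg (co A) R v = 9 by omega) hc

/-- R(K₅-e, K₅-e) ≤ 22 -/
theorem r22 {A : V → V → Bool} (hs : ∀ x y, A x y = A y x) (hi : ∀ x, A x x = false)
    {R : Finset V} (hG : Good A PH R) : R.card < 22 := by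
  classical
  by_contra hc
  obtain ⟨R', h1, h2⟩ := Finset.exists_subset_card_eq (not_lt.1 hc)
  replace hG := hG.mono h1
  clear hc h1
  have hGc : Good (co A) PH R' := good_co hG (good_nil _ _) 2 8 (by decide) (by decide)
  have hg := goodman hs hi R'
  have hne : R'.Nonempty := Finset.card_pos.1 (by omega)
  refine absurd hg (ne_of_lt (Finset.sum_lt_sum_of_nonempty hne ?_))
  intro v hv
  obtain ⟨a0, a1, a2, a3, a4⟩ := nb_lemma hs hi h2 hG hv
  obtain ⟨b0, b1, b2, b3, b4⟩ := nb_lemma (co_symm hs) (co_irr A) h2 hGc hv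
  have hd := deg_co hi hv
  rw [h2] at hd
  generalize deg A R' v = d at *
  generalize deg (co A) R' v = m at *
  have : (d = 9 ∧ m = 12) ∨ (d = 10 ∧ m = 11) ∨ (d = 11 ∧ m = 10) ∨ (d = 12 ∧ m = 9) := by omega
  rcases this with ⟨rfl, rfl⟩ | ⟨rfl, rfl⟩ | ⟨rfl, rfl⟩ | ⟨rfl, rfl⟩ <;> omega

theorem r18 {A : V → V → Bool} (hs : ∀ x y, A x y = A y x) (hi : ∀ x, A x x = false)
    {R : Finset V} (hG : Good A [(3, 1, 5)] R) : R.card < 18 := by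
  classical
  have key : ∀ (B : V → V → Bool), (∀ x y, B x y = B y x) → (∀ x, B x x = false) →
      Good B [(3, 1, 5)] R → ∀ v ∈ R, deg B R v < 9 := by
    intro B hs hi hG v hv
    refine clK349.empty hs hi (R := nb B R v) ?_
    unfold PK34
    rw [good_cons]
    constructor
    · intro l h1 h2 h3
      have := (good_cons.1 hG).1 (v :: l) (nodup_nb hi h1 h2) (mem_cons_nb hv h2) (by simp [h3])
      rw [ec_cons_nb h2] at this
      simp only at this h3 ⊢
      omega
    · exact (hG.mono (nb_sub _ _ _)).of_ec (by simp)
  have hGc : Good (co A) [(3, 1, 5)] R := good_co hG (good_nil _ _) 1 5 (by decide) (by decide)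
  rcases R.eq_empty_or_nonempty with rfl | ⟨v, hv⟩
  · simp
  · have := key A hs hi hG v hv
    have := key (co A) (co_symm hs) (co_irr A) hGc v hv
    have := deg_co hi hv
    omega

end ram

section famW
set_option maxRecDepth 100000

def datW1 : List (ℕ × List (ℕ × ℕ × ℕ)) :=
  [(0, [(0, 0, 16), (1, 1, 16)])]
def datW2 : List (ℕ × List (ℕ × ℕ × ℕ)) :=
  [(0, [(0, 0, 528)]),
   (1, [(0, 1, 528), (1, 2, 528), (2, 2, 513)])]
def datW3 : List (ℕ × List (ℕ × ℕ × ℕ)) :=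
  [(0, []),
   (1, [(4, 0, 12816)]),
   (3, [(0, 1, 12816), (1, 2, 12816), (2, 3, 12816), (4, 3, 12576), (6, 4, 12816)])]
def datW4 : List (ℕ × List (ℕ × ℕ × ℕ)) :=
  [(33, []),
   (3, []),
   (11, []),
   (19, [(4, 0, 274960), (8, 0, 271105), (12, 1, 274960)]),
   (51, [(0, 2, 274960), (1, 3, 274960), (2, 3, 271105), (4, 3, 267010), (6, 4, 274960), (8, 3, 262675), (9, 4, 271105)])]
def datW5 : List (ℕ × List (ℕ × ℕ × ℕ)) :=
  [(275, [(24, 0, 5517840)]),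
   (787, []),
   (51, []),
   (115, [(18, 1, 5517840), (20, 1, 5517600)]),
   (435, [(9, 2, 5517840), (17, 2, 5456400), (24, 2, 336945), (25, 3, 5517840)])]
def datW6 : List (ℕ × List (ℕ × ℕ × ℕ)) :=
  [(24851, []),
   (18547, []),
   (9651, []),
   (26035, [])]
def datW7 : List (ℕ × List (ℕ × ℕ × ℕ)) :=
  []

/-- `K₃` / `K₄-e` -/
def PW : List (ℕ × ℕ × ℕ) := [(2, 0, 2), (3, 2, 99)]

theorem clW1 : Cl PW 1 0 (datW1.map Prod.fst) := Cl_one _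

theorem clW2 : Cl PW 2 0 (datW2.map Prod.fst) :=
  Cl_step clW1 rfl (by intro Y δ h1 h2; omega) (by decide +kernel)

theorem clW3 : Cl PW 3 0 (datW3.map Prod.fst) :=
  Cl_step clW2 rfl (by intro Y δ h1 h2; omega) (by decide +kernel)

theorem clW4 : Cl PW 4 0 (datW4.map Prod.fst) :=
  Cl_step clW3 rfl (by intro Y δ h1 h2; omega) (by decide +kernel)

theorem clW5 : Cl PW 5 0 (datW5.map Prod.fst) :=
  Cl_step clW4 rfl (by intro Y δ h1 h2; omega) (by decide +kernel)

theorem clW6 : Cl PW 6 0 (datW6.map Prod.fst) :=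
  Cl_step clW5 rfl (by intro Y δ h1 h2; omega) (by decide +kernel)

theorem clW7 : Cl PW 7 0 (datW7.map Prod.fst) :=
  Cl_step clW6 rfl (by intro Y δ h1 h2; omega) (by decide +kernel)

end famW

section num
set_option linter.unusedSimpArgs false

def f0 (r s : ℕ) : ℕ :=
  (if r = 0 then (if s % 2 = 0 then 5 else 10) else
   if r % 2 = 1 then (if s % 2 = 0 then 20 else 50) * 17 ^ ((r - 1) / 2) else
   (if s % 2 = 0 then 105 else 210) * 17 ^ ((r - 2) / 2)) * 5 ^ (s / 2)

def f1 (r s : ℕ) : ℕ :=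
  (if r % 2 = 0 then (if s % 2 = 0 then 10 else 20) * 17 ^ (r / 2) else
   (if s % 2 = 0 then 32 else 80) * 17 ^ ((r - 1) / 2)) * 5 ^ (s / 2)

/-- five times the bound -/
def phi (p r s : ℕ) : ℕ := if p = 0 then f0 r s else f1 r s

theorem tab (r s : ℕ) : ∃ X, 1 ≤ X ∧ (
    (r = 0 ∧ f0 (r) (s) = 5 * X ∧ f0 (r) (s+1) = 10 * X ∧ f0 (r) (s+2) = 25 * X ∧ f0 (r+1) (s) =
      20 * X ∧ f0 (r+1) (s+1) = 50 * X ∧ f0 (r+1) (s+2) = 100 * X ∧ f0 (r+2) (s) = 105 * X ∧ f0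
      (r+2) (s+1) = 210 * X ∧ f0 (r+2) (s+2) = 525 * X ∧ f1 (r) (s) = 10 * X ∧ f1 (r) (s+1) = 20 * X
      ∧ f1 (r) (s+2) = 50 * X ∧ f1 (r+1) (s) = 32 * X ∧ f1 (r+1) (s+1) = 80 * X ∧ f1 (r+1) (s+2) =
      160 * X ∧ f1 (r+2) (s) = 170 * X ∧ f1 (r+2) (s+1) = 340 * X ∧ f1 (r+2) (s+2) = 850 * X) ∨
    (r = 0 ∧ f0 (r) (s) = 10 * X ∧ f0 (r) (s+1) = 25 * X ∧ f0 (r) (s+2) = 50 * X ∧ f0 (r+1)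
      (s) = 50 * X ∧ f0 (r+1) (s+1) = 100 * X ∧ f0 (r+1) (s+2) = 250 * X ∧ f0 (r+2) (s) = 210 * X ∧
      f0 (r+2) (s+1) = 525 * X ∧ f0 (r+2) (s+2) = 1050 * X ∧ f1 (r) (s) = 20 * X ∧ f1 (r) (s+1) = 50
      * X ∧ f1 (r) (s+2) = 100 * X ∧ f1 (r+1) (s) = 80 * X ∧ f1 (r+1) (s+1) = 160 * X ∧ f1 (r+1)
      (s+2) = 400 * X ∧ f1 (r+2) (s) = 340 * X ∧ f1 (r+2) (s+1) = 850 * X ∧ f1 (r+2) (s+2) = 1700 *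
      X) ∨
    (1 ≤ r ∧ f0 (r) (s) = 20 * X ∧ f0 (r) (s+1) = 50 * X ∧ f0 (r) (s+2) = 100 * X ∧ f0 (r+1)
      (s) = 105 * X ∧ f0 (r+1) (s+1) = 210 * X ∧ f0 (r+1) (s+2) = 525 * X ∧ f0 (r+2) (s) = 340 * X ∧
      f0 (r+2) (s+1) = 850 * X ∧ f0 (r+2) (s+2) = 1700 * X ∧ f1 (r) (s) = 32 * X ∧ f1 (r) (s+1) = 80
      * X ∧ f1 (r) (s+2) = 160 * X ∧ f1 (r+1) (s) = 170 * X ∧ f1 (r+1) (s+1) = 340 * X ∧ f1 (r+1)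
      (s+2) = 850 * X ∧ f1 (r+2) (s) = 544 * X ∧ f1 (r+2) (s+1) = 1360 * X ∧ f1 (r+2) (s+2) = 2720 *
      X) ∨
    (1 ≤ r ∧ f0 (r) (s) = 50 * X ∧ f0 (r) (s+1) = 100 * X ∧ f0 (r) (s+2) = 250 * X ∧ f0 (r+1)
      (s) = 210 * X ∧ f0 (r+1) (s+1) = 525 * X ∧ f0 (r+1) (s+2) = 1050 * X ∧ f0 (r+2) (s) = 850 * X
      ∧ f0 (r+2) (s+1) = 1700 * X ∧ f0 (r+2) (s+2) = 4250 * X ∧ f1 (r) (s) = 80 * X ∧ f1 (r) (s+1) =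
      160 * X ∧ f1 (r) (s+2) = 400 * X ∧ f1 (r+1) (s) = 340 * X ∧ f1 (r+1) (s+1) = 850 * X ∧ f1
      (r+1) (s+2) = 1700 * X ∧ f1 (r+2) (s) = 1360 * X ∧ f1 (r+2) (s+1) = 2720 * X ∧ f1 (r+2) (s+2)
      = 6800 * X) ∨
    (1 ≤ r ∧ f0 (r) (s) = 105 * X ∧ f0 (r) (s+1) = 210 * X ∧ f0 (r) (s+2) = 525 * X ∧ f0 (r+1)
      (s) = 340 * X ∧ f0 (r+1) (s+1) = 850 * X ∧ f0 (r+1) (s+2) = 1700 * X ∧ f0 (r+2) (s) = 1785 * X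
      ∧ f0 (r+2) (s+1) = 3570 * X ∧ f0 (r+2) (s+2) = 8925 * X ∧ f1 (r) (s) = 170 * X ∧ f1 (r) (s+1)
      = 340 * X ∧ f1 (r) (s+2) = 850 * X ∧ f1 (r+1) (s) = 544 * X ∧ f1 (r+1) (s+1) = 1360 * X ∧ f1
      (r+1) (s+2) = 2720 * X ∧ f1 (r+2) (s) = 2890 * X ∧ f1 (r+2) (s+1) = 5780 * X ∧ f1 (r+2) (s+2)
      = 14450 * X) ∨
    (1 ≤ r ∧ f0 (r) (s) = 210 * X ∧ f0 (r) (s+1) = 525 * X ∧ f0 (r) (s+2) = 1050 * X ∧ f0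
      (r+1) (s) = 850 * X ∧ f0 (r+1) (s+1) = 1700 * X ∧ f0 (r+1) (s+2) = 4250 * X ∧ f0 (r+2) (s) =
      3570 * X ∧ f0 (r+2) (s+1) = 8925 * X ∧ f0 (r+2) (s+2) = 17850 * X ∧ f1 (r) (s) = 340 * X ∧ f1
      (r) (s+1) = 850 * X ∧ f1 (r) (s+2) = 1700 * X ∧ f1 (r+1) (s) = 1360 * X ∧ f1 (r+1) (s+1) =
      2720 * X ∧ f1 (r+1) (s+2) = 6800 * X ∧ f1 (r+2) (s) = 5780 * X ∧ f1 (r+2) (s+1) = 14450 * X ∧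
      f1 (r+2) (s+2) = 28900 * X)) := by
  have hs : s = 2 * (s / 2) ∨ s = 2 * (s / 2) + 1 := by omega
  have hr : r = 0 ∨ r = 2 * ((r - 1) / 2) + 1 ∨ r = 2 * ((r - 2) / 2) + 2 := by omega
  generalize s / 2 = b at hs
  generalize (r - 1) / 2 = a at hr
  generalize (r - 2) / 2 = a' at hr

  have e1 : ∀ n, (2 * n) % 2 = 0 := fun n => by omega
  have e2 : ∀ n, (2 * n + 1) % 2 = 1 := fun n => by omega
  have e3 : ∀ n, (2 * n + 2) % 2 = 0 := fun n => by omega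
  have e4 : ∀ n, (2 * n + 3) % 2 = 1 := fun n => by omega
  have e5 : ∀ n, (2 * n + 4) % 2 = 0 := fun n => by omega
  have d1 : ∀ n, (2 * n) / 2 = n := fun n => by omega
  have d2 : ∀ n, (2 * n + 1) / 2 = n := fun n => by omega
  have d3 : ∀ n, (2 * n + 2) / 2 = n + 1 := fun n => by omega
  have d4 : ∀ n, (2 * n + 3) / 2 = n + 1 := fun n => by omega
  have d5 : ∀ n, (2 * n + 4) / 2 = n + 2 := fun n => by omega
  have p17 : ∀ n, 1 ≤ 17 ^ n := fun n => Nat.one_le_pow _ _ (by omega)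
  have p5 : ∀ n, 1 ≤ 5 ^ n := fun n => Nat.one_le_pow _ _ (by omega)
  rcases hr with rfl | rfl | rfl <;> rcases hs with rfl | rfl
  · refine ⟨5 ^ b, by first | exact p5 _ | exact Nat.mul_pos (p17 _) (p5 _), Or.inl <| ⟨by omega, ?_⟩⟩
    refine ⟨?_, ?_, ?_, ?_, ?_, ?_, ?_, ?_, ?_, ?_, ?_, ?_, ?_, ?_, ?_, ?_, ?_, ?_⟩ <;>
      simp [f0, f1, e1, e2, e3, e4, e5, d1, d2, d3, d4, d5, add_assoc] <;> ring
  · refine ⟨5 ^ b, by first | exact p5 _ | exact Nat.mul_pos (p17 _) (p5 _), Or.inr <| Or.inl <| ⟨by omega, ?_⟩⟩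
    refine ⟨?_, ?_, ?_, ?_, ?_, ?_, ?_, ?_, ?_, ?_, ?_, ?_, ?_, ?_, ?_, ?_, ?_, ?_⟩ <;>
      simp [f0, f1, e1, e2, e3, e4, e5, d1, d2, d3, d4, d5, add_assoc] <;> ring
  · refine ⟨17 ^ a * 5 ^ b, by first | exact p5 _ | exact Nat.mul_pos (p17 _) (p5 _), Or.inr <| Or.inr <| Or.inl <| ⟨by omega, ?_⟩⟩
    refine ⟨?_, ?_, ?_, ?_, ?_, ?_, ?_, ?_, ?_, ?_, ?_, ?_, ?_, ?_, ?_, ?_, ?_, ?_⟩ <;>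
      simp [f0, f1, e1, e2, e3, e4, e5, d1, d2, d3, d4, d5, add_assoc] <;> ring
  · refine ⟨17 ^ a * 5 ^ b, by first | exact p5 _ | exact Nat.mul_pos (p17 _) (p5 _), Or.inr <| Or.inr <| Or.inr <| Or.inl <| ⟨by omega, ?_⟩⟩
    refine ⟨?_, ?_, ?_, ?_, ?_, ?_, ?_, ?_, ?_, ?_, ?_, ?_, ?_, ?_, ?_, ?_, ?_, ?_⟩ <;>
      simp [f0, f1, e1, e2, e3, e4, e5, d1, d2, d3, d4, d5, add_assoc] <;> ring
  · refine ⟨17 ^ a' * 5 ^ b, by first | exact p5 _ | exact Nat.mul_pos (p17 _) (p5 _), Or.inr <| Or.inr <| Or.inr <| Or.inr <| Or.inl <| ⟨by omega, ?_⟩⟩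
    refine ⟨?_, ?_, ?_, ?_, ?_, ?_, ?_, ?_, ?_, ?_, ?_, ?_, ?_, ?_, ?_, ?_, ?_, ?_⟩ <;>
      simp [f0, f1, e1, e2, e3, e4, e5, d1, d2, d3, d4, d5, add_assoc] <;> ring
  · refine ⟨17 ^ a' * 5 ^ b, by first | exact p5 _ | exact Nat.mul_pos (p17 _) (p5 _), Or.inr <| Or.inr <| Or.inr <| Or.inr <| Or.inr <| ⟨by omega, ?_⟩⟩
    refine ⟨?_, ?_, ?_, ?_, ?_, ?_, ?_, ?_, ?_, ?_, ?_, ?_, ?_, ?_, ?_, ?_, ?_, ?_⟩ <;>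
      simp [f0, f1, e1, e2, e3, e4, e5, d1, d2, d3, d4, d5, add_assoc] <;> ring

theorem phi_succ (p r s : ℕ) : phi (p + 1) r s = f1 r s := by simp [phi]

theorem phi_or (p : ℕ) : (∀ r s, phi p r s = f0 r s) ∨ (∀ r s, phi p r s = f1 r s) := by
  rcases Nat.eq_zero_or_pos p with h | h
  · left; intro r s; simp [phi, h]
  · right; intro r s; rw [phi, if_neg (by omega)]

theorem phi_numA (p r s : ℕ) :
    phi p r s ≤ phi (p + 1) r s ∧ phi p r s + 5 ≤ phi p (r + 1) s ∧
    phi p r s ≤ phi p r (s + 1) ∧ 5 ≤ phi p r s ∧ 10 ≤ phi (p + 1) r s ∧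
    2 * phi p r s ≤ phi p r (s + 1) ∧
    phi p r (s + 1) + phi p r s ≤ phi p (r + 1) s ∧ 2 * phi (p + 1) r s ≤ phi p (r + 1) s ∧
    2 * phi p r s + 5 ≤ phi p (r + 1) s ∧ phi (p + 1) r s + 10 ≤ phi p (r + 1) s ∧
    5 * phi p r s ≤ phi p r (s + 2) ∧
    6 * phi p r s + 5 ≤ phi p (r + 1) (s + 1) ∧
    phi p r (s + 1) + phi p (r + 1) s + phi (p + 1) (r + 1) s ≤ phi p (r + 2) s ∧
    12 * phi p r s + 10 ≤ phi p (r + 2) s := by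
  simp only [phi_succ]
  obtain ⟨X, hX, h⟩ := tab r s
  rcases phi_or p with hp | hp <;> simp only [hp] <;>
    rcases h with h | h | h | h | h | h <;>
    (obtain ⟨-, a1, a2, a3, a4, a5, a6, a7, a8, a9, b1, b2, b3, b4, b5, b6, b7, b8, b9⟩ := h
     refine ⟨?_, ?_, ?_, ?_, ?_, ?_, ?_, ?_, ?_, ?_, ?_, ?_, ?_, ?_⟩ <;> omega)

theorem phi_HT (p r s : ℕ) :
    (∀ n, n ≤ phi p (r + 1) s → (n ≤ phi p r (s + 1) + phi p r s ∨ n ≤ 2 * phi (p + 1) r s ∨ n ≤ 20) →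
      phi p r (s + 1) + 2 * phi p r s + n ≤ phi p (r + 1) (s + 1)) ∧
    (∀ n, n ≤ phi p (r + 1) s → (n ≤ 2 * phi (p + 1) r s ∨ n ≤ 3 * phi p r s ∨ n ≤ 20) →
      3 * phi (p + 1) r s + n ≤ phi p (r + 1) (s + 1)) ∧
    8 * phi p r s ≤ phi p (r + 1) (s + 1) ∧
    (10 * phi p r s ≤ phi p (r + 1) (s + 1) ∨ 10 ≤ phi p r s) := by
  simp only [phi_succ]
  obtain ⟨X, hX, h⟩ := tab r s
  rcases phi_or p with hp | hp <;> simp only [hp] <;>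
    rcases h with h | h | h | h | h | h <;>
    (obtain ⟨-, a1, a2, a3, a4, a5, a6, a7, a8, a9, b1, b2, b3, b4, b5, b6, b7, b8, b9⟩ := h
     refine ⟨?_, ?_, ?_, ?_⟩
     · intro n h1 h2; omega
     · intro n h1 h2; omega
     · omega
     · omega)

theorem phi_HH (p r s : ℕ) :
    phi p r (s + 2) + 2 * (phi (p + 1) r (s + 1) + phi (p + 1) r s) ≤ phi p (r + 2) s ∧
    30 ≤ phi (p + 1) r (s + 1) + phi (p + 1) r s ∧
    (∀ n, (n ≤ phi p r (s + 1) + phi p r s + 5 ∨ n ≤ 2 * phi (p + 1) r s ∨ n ≤ 20) →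
      phi p r (s + 1) + n + phi p (r + 1) (s + 1) ≤ phi p (r + 2) s) ∧
    4 * phi (p + 1) r s + phi p (r + 1) (s + 1) ≤ phi p (r + 2) s ∧
    17 * phi p r s ≤ phi p (r + 2) s ∧
    (21 * phi p r s ≤ phi p (r + 2) s ∨ 10 ≤ phi p r s) := by
  simp only [phi_succ]
  obtain ⟨X, hX, h⟩ := tab r s
  rcases phi_or p with hp | hp <;> simp only [hp] <;>
    rcases h with h | h | h | h | h | h <;>
    (obtain ⟨-, a1, a2, a3, a4, a5, a6, a7, a8, a9, b1, b2, b3, b4, b5, b6, b7, b8, b9⟩ := h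
     refine ⟨?_, ?_, ?_, ?_, ?_, ?_⟩
     · omega
     · omega
     · intro n h2; omega
     · omega
     · omega
     · omega)

theorem phi_base (p r s : ℕ) : 5 * (1 + r) ≤ phi p r s := by
  induction r with
  | zero => have := (phi_numA p 0 s).2.2.2.1; omega
  | succ r ih => have := (phi_numA p r s).2.1; omega

end num

/-! ### Structure of Gallai colourings -/
section gallai
variable {V : Type} {κ : Type}

def IsG (c : V → V → κ) : Prop := (∀ u v, c u v = c v u) ∧
  ∀ u v w, u ≠ v → u ≠ w → v ≠ w → c u v = c u w ∨ c u v = c v w ∨ c u w = c v w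

/-- connected by edges of colours other than `i`, `j` inside `S` -/
def Rch (c : V → V → κ) (S : Finset V) (i j : κ) : V → V → Prop :=
  Relation.ReflTransGen (fun x y => x ∈ S ∧ y ∈ S ∧ x ≠ y ∧ c x y ≠ i ∧ c x y ≠ j)

theorem Rch.symm {c : V → V → κ} (hc : IsG c) {S : Finset V} {i j : κ} {x y : V}
    (h : Rch c S i j x y) : Rch c S i j y x := by
  unfold Rch at *
  induction h with
  | refl => exact Relation.ReflTransGen.refl
  | @tail b d _ h ih =>
    refine Relation.ReflTransGen.head ⟨h.2.1, h.1, h.2.2.1.symm, ?_⟩ ih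
    rw [hc.1 d b]
    exact h.2.2.2

theorem Rch.mem {c : V → V → κ} {S : Finset V} {i j : κ} {x y : V}
    (h : Rch c S i j x y) (hx : x ∈ S) : y ∈ S := by
  induction h with
  | refl => exact hx
  | tail _ h _ => exact h.2.1

theorem Rch.col {c : V → V → κ} {S : Finset V} {i j : κ} {x y : V}
    (hx : x ∈ S) (hy : y ∈ S) (h : ¬ Rch c S i j x y) : c x y = i ∨ c x y = j := by
  by_contra hc
  push Not at hc
  refine h (Relation.ReflTransGen.single ⟨hx, hy, ?_, hc.1, hc.2⟩)
  rintro rfl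
  exact h Relation.ReflTransGen.refl

theorem Rch.hom {c : V → V → κ} (hc : IsG c) {S : Finset V} {i j : κ} {x y w : V}
    (hx : x ∈ S) (hw : w ∈ S) (h : Rch c S i j x y) (hn : ¬ Rch c S i j x w) :
    c w x = c w y := by
  induction h with
  | refl => rfl
  | @tail b d hb hbd ih =>
    rw [ih]
    have h1 : ¬ Rch c S i j b w := fun h => hn (hb.trans h)
    have hd : Rch c S i j x d := hb.tail hbd
    have h2 : ¬ Rch c S i j d w := fun h => hn (hd.trans h)
    have c1 := Rch.col hbd.1 hw h1
    have c2 := Rch.col hbd.2.1 hw h2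
    have n1 : w ≠ b := by rintro rfl; exact hn hb
    have n2 : w ≠ d := by rintro rfl; exact hn hd
    rw [hc.1 b w] at c1
    rw [hc.1 d w] at c2
    rcases hc.2 w b d n1 n2 hbd.2.2.1 with h | h | h
    · exact h
    · rw [h] at c1; rcases c1 with c1 | c1
      · exact absurd c1 hbd.2.2.2.1
      · exact absurd c1 hbd.2.2.2.2
    · rw [h] at c2; rcases c2 with c1 | c1
      · exact absurd c1 hbd.2.2.2.1
      · exact absurd c1 hbd.2.2.2.2

theorem exists_cut {c : V → V → κ} (hc : IsG c) : ∀ (n : ℕ) (S : Finset V), S.card = n + 2 →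
    ∃ i j, ∃ A ⊆ S, A.Nonempty ∧ (∃ y ∈ S, y ∉ A) ∧
      ∀ x ∈ A, ∀ y ∈ S, y ∉ A → c x y = i ∨ c x y = j := by
  classical
  intro n
  induction n with
  | zero =>
    intro S hS
    obtain ⟨a, b, hab, rfl⟩ := Finset.card_eq_two.1 hS
    refine ⟨c a b, c a b, {a}, by simp, by simp, ⟨b, by simp, by simpa using hab.symm⟩, ?_⟩
    intro x hx y hy hyn
    simp at hx hy hyn
    subst hx
    rcases hy with rfl | rfl
    · exact absurd rfl hyn
    · simp
  | succ n ih =>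
    intro S hS
    obtain ⟨v, hv⟩ : S.Nonempty := Finset.card_pos.1 (by omega)
    obtain ⟨i, j, A, hAS, ⟨a0, ha0⟩, ⟨b0, hb0, hb0'⟩, hcut⟩ :=
      ih (S.erase v) (by rw [Finset.card_erase_of_mem hv]; omega)
    set S' := S.erase v with hS'
    have hvS' : v ∉ S' := by simp [hS']
    have hS'S : ∀ x ∈ S', x ∈ S := fun x hx => Finset.mem_of_mem_erase hx
    have hSS' : ∀ x ∈ S, x = v ∨ x ∈ S' := by
      intro x hx
      by_cases h : x = v
      · exact Or.inl h
      · exact Or.inr (Finset.mem_erase.2 ⟨h, hx⟩)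
    let out : V → Prop := fun x => x ∈ S' ∧ c v x ≠ i ∧ c v x ≠ j
    by_cases hR : ∃ y ∈ S', ∀ x, out x → ¬ Rch c S' i j x y
    · obtain ⟨y0, hy0, hy0'⟩ := hR
      refine ⟨i, j, S'.filter (fun y => ∀ x, out x → ¬ Rch c S' i j x y), ?_, ⟨y0, ?_⟩,
        ⟨v, hv, by simp [hvS']⟩, ?_⟩
      · intro x hx; exact hS'S x (Finset.mem_filter.1 hx).1
      · exact Finset.mem_filter.2 ⟨hy0, hy0'⟩
      · intro x hx y hy hyn
        obtain ⟨hx1, hx2⟩ := Finset.mem_filter.1 hx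
        rcases hSS' y hy with rfl | hy
        · by_contra hcc
          push Not at hcc
          rw [hc.1] at hcc
          exact hx2 x ⟨hx1, hcc⟩ Relation.ReflTransGen.refl
        · have : ∃ z, out z ∧ Rch c S' i j z y := by
            by_contra hz
            push Not at hz
            exact hyn (Finset.mem_filter.2 ⟨hy, hz⟩)
          obtain ⟨z, hz, hzy⟩ := this
          apply Rch.col hx1 hy
          intro hxy
          exact hx2 z hz (hzy.trans (hxy.symm hc))
    · push Not at hR
      have hclosed : ∀ x y, x ∈ A → Rch c S' i j x y → y ∈ A := by
        intro x y hx h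
        induction h with
        | refl => exact hx
        | @tail b d _ hbd ih =>
          by_contra hd
          rcases hcut b ih d hbd.2.1 hd with h | h
          · exact hbd.2.2.2.1 h
          · exact hbd.2.2.2.2 h
      obtain ⟨x0, hx0, hx0a⟩ := hR a0 (hAS ha0)
      obtain ⟨y0, hy0, hy0b⟩ := hR b0 hb0
      have hx0A : x0 ∈ A := hclosed a0 x0 ha0 (hx0a.symm hc)
      have hy0A : y0 ∉ A := fun h => hb0' (hclosed y0 b0 h hy0b)
      have hcross : ∀ x y, out x → out y → x ∈ A → y ∉ A → c v x = c v y := by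
        intro x y hx hy hxA hyA
        have n1 : v ≠ x := by rintro rfl; exact hvS' hx.1
        have n2 : v ≠ y := by rintro rfl; exact hvS' hy.1
        have n3 : x ≠ y := by rintro rfl; exact hyA hxA
        have := hcut x hxA y hy.1 hyA
        rcases hc.2 v x y n1 n2 n3 with h | h | h
        · exact h
        · rw [← h] at this; exact absurd this (by have := hx.2; tauto)
        · rw [← h] at this; exact absurd this (by have := hy.2; tauto)
      have hl : ∀ x, out x → c v x = c v x0 := by
        intro x hx
        by_cases hxA : x ∈ A
        · rw [hcross x y0 hx hy0 hxA hy0A, hcross x0 y0 hx0 hy0 hx0A hy0A]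
        · rw [hcross x0 x hx0 hx hx0A hxA]
      have other : ∀ y ∈ S', ∃ w, out w ∧ ¬ Rch c S' i j y w := by
        intro y hy
        by_cases hyA : y ∈ A
        · exact ⟨y0, hy0, fun h => hy0A (hclosed y y0 hyA h)⟩
        · exact ⟨x0, hx0, fun h => hyA (hclosed x0 y hx0A (h.symm hc))⟩
      have tri : ∀ y w, y ∈ S' → out w → ¬ Rch c S' i j y w → c v y = i ∨ c v y = j →
          c w y = c v y := by
        intro y w hy hw hyw hcy
        have n1 : v ≠ w := by rintro rfl; exact hvS' hw.1
        have n2 : v ≠ y := by rintro rfl; exact hvS' hy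
        have n3 : w ≠ y := by rintro rfl; exact hyw Relation.ReflTransGen.refl
        have h1 := Rch.col hy hw.1 hyw
        rw [hc.1] at h1
        rcases hc.2 v w y n1 n2 n3 with h | h | h
        · rw [← h] at hcy; exact absurd hcy (by have := hw.2; tauto)
        · rw [← h] at h1; exact absurd h1 (by have := hw.2; tauto)
        · exact h.symm
      have key : ∀ y z, y ∈ S' → z ∈ S' → c v y = i → c v z = j → i = j := by
        intro y z hy hz hyi hzj
        by_cases hyz : Rch c S' i j y z
        · obtain ⟨w, hw, hwn⟩ := other y hy
          have h1 := tri y w hy hw hwn (Or.inl hyi)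
          have h2 := tri z w hz hw (fun h => hwn (hyz.trans h)) (Or.inr hzj)
          have h3 := Rch.hom hc hy hw.1 hyz hwn
          rw [← hyi, ← hzj, ← h1, ← h2, h3]
        · obtain ⟨w, hw, hwy⟩ := hR y hy
          obtain ⟨w', hw', hwz⟩ := hR z hz
          have m1 : ¬ Rch c S' i j z w := fun h => hyz (Rch.symm hc (h.trans hwy))
          have m2 : ¬ Rch c S' i j y w' := fun h => hyz (h.trans hwz)
          have h1 := tri z w hz hw m1 (Or.inr hzj)
          have h2 := tri y w' hy hw' m2 (Or.inl hyi)
          have h3 := Rch.hom hc hz hw.1 (hwz.symm hc) m1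
          have h4 := Rch.hom hc hy hw'.1 (hwy.symm hc) m2
          rw [← hyi, ← hzj, ← h1, ← h2, h3, h4, hc.1]
      have hfin : ∀ l : κ, (∀ y ∈ S', c v y = c v x0 ∨ c v y = l) →
        ∃ i j, ∃ A ⊆ S, A.Nonempty ∧ (∃ y ∈ S, y ∉ A) ∧
          ∀ x ∈ A, ∀ y ∈ S, y ∉ A → c x y = i ∨ c x y = j := by
        intro l h
        refine ⟨c v x0, l, {v}, by simpa using hv, by simp, ⟨b0, hS'S _ hb0, ?_⟩, ?_⟩
        · simp only [Finset.mem_singleton]; rintro rfl; exact hvS' hb0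
        · intro x hx y hy hyv
          rw [Finset.mem_singleton] at hx hyv
          subst hx
          exact h y ((hSS' y hy).resolve_left hyv)
      have hall : ∀ y ∈ S', c v y = c v x0 ∨ c v y = i ∨ c v y = j := by
        intro y hy
        by_cases h : out y
        · exact Or.inl (hl y h)
        · right; by_contra h'; push Not at h'; exact h ⟨hy, h'⟩
      by_cases hj : ∃ z ∈ S', c v z = j
      · obtain ⟨z, hz, hzj⟩ := hj
        apply hfin j
        intro y hy
        rcases hall y hy with h | h | h
        · exact Or.inl h
        · right; rw [h]; exact key y z hy hz h hzj
        · exact Or.inr h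
      · apply hfin i
        intro y hy
        rcases hall y hy with h | h | h
        · exact Or.inl h
        · exact Or.inr h
        · exact absurd ⟨y, hy, h⟩ hj

/-- a two-coloured quotient structure in which every part sees both colours -/
structure Gal (c : V → V → κ) (S : Finset V) (i j : κ) (e : V → V → Prop) : Prop where
  refl : ∀ x, e x x
  symm : ∀ x y, e x y → e y x
  trans : ∀ x y z, e x y → e y z → e x z
  ne : i ≠ j
  col : ∀ x ∈ S, ∀ y ∈ S, ¬ e x y → c x y = i ∨ c x y = j
  hom : ∀ x ∈ S, ∀ y ∈ S, ∀ w ∈ S, e x y → ¬ e x w → c w x = c w y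
  exi : ∀ x ∈ S, ∃ y ∈ S, ¬ e x y ∧ c x y = i
  exj : ∀ x ∈ S, ∃ y ∈ S, ¬ e x y ∧ c x y = j

theorem Gal.swap {c : V → V → κ} {S : Finset V} {i j : κ} {e : V → V → Prop}
    (h : Gal c S i j e) : Gal c S j i e :=
  ⟨h.refl, h.symm, h.trans, h.ne.symm, fun x hx y hy hn => (h.col x hx y hy hn).symm, h.hom,
    h.exj, h.exi⟩

theorem gallai_structure {c : V → V → κ} (hc : IsG c) {S : Finset V} (hS : 2 ≤ S.card) :
    (∃ i, ∃ A ⊆ S, A.Nonempty ∧ (∃ y ∈ S, y ∉ A) ∧ ∀ x ∈ A, ∀ y ∈ S, y ∉ A → c x y = i) ∨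
    ∃ i j e, Gal c S i j e := by
  classical
  obtain ⟨i, j, A, hAS, ⟨a, ha⟩, ⟨b, hb, hbA⟩, hcut⟩ := exists_cut hc (S.card - 2) S (by omega)
  by_cases hij : i = j
  · subst hij
    exact Or.inl ⟨i, A, hAS, ⟨a, ha⟩, ⟨b, hb, hbA⟩, by simpa using hcut⟩
  have hclosed : ∀ x y, x ∈ A → Rch c S i j x y → y ∈ A := by
    intro x y hx h
    induction h with
    | refl => exact hx
    | @tail b d _ hbd ih =>
      by_contra hd
      rcases hcut b ih d hbd.2.1 hd with h | h
      · exact hbd.2.2.2.1 h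
      · exact hbd.2.2.2.2 h
  have hab : ¬ Rch c S i j a b := fun h => hbA (hclosed a b ha h)
  by_cases h : ∃ l, (l = i ∨ l = j) ∧ ∃ x ∈ S, ∀ y ∈ S, ¬ Rch c S i j x y → c x y = l
  · left
    obtain ⟨l, -, x, hx, hxl⟩ := h
    refine ⟨l, S.filter (fun y => Rch c S i j x y), Finset.filter_subset _ _,
      ⟨x, Finset.mem_filter.2 ⟨hx, Relation.ReflTransGen.refl⟩⟩, ?_, ?_⟩
    · by_cases hxa : Rch c S i j x a
      · exact ⟨b, hb, fun h => hab ((hxa.symm hc).trans (Finset.mem_filter.1 h).2)⟩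
      · exact ⟨a, hAS ha, fun h => hxa (Finset.mem_filter.1 h).2⟩
    · intro z hz y hy hyn
      have hz := (Finset.mem_filter.1 hz).2
      have hyn : ¬ Rch c S i j x y := fun h => hyn (Finset.mem_filter.2 ⟨hy, h⟩)
      rw [hc.1, ← Rch.hom hc hx hy hz hyn, hc.1]
      exact hxl y hy hyn
  · right
    push Not at h
    refine ⟨i, j, Rch c S i j, fun x => Relation.ReflTransGen.refl, fun x y h => h.symm hc,
      fun x y z h1 h2 => h1.trans h2, hij, fun x hx y hy hn => Rch.col hx hy hn,
      fun x hx y hy w hw h1 h2 => Rch.hom hc hx hw h1 h2, ?_, ?_⟩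
    · intro x hx
      obtain ⟨y, hy, h1, h2⟩ := h j (Or.inr rfl) x hx
      exact ⟨y, hy, h1, (Rch.col hx hy h1).resolve_right h2⟩
    · intro x hx
      obtain ⟨y, hy, h1, h2⟩ := h i (Or.inl rfl) x hx
      exact ⟨y, hy, h1, (Rch.col hx hy h1).resolve_left h2⟩

end gallai

/-! ### Local states, induction hypotheses and joins -/
section states
variable {V : Type} {κ : Type}

inductive St
  | E | P | T | D | H

/-- `x y` is an edge of colour `i` -/
def cj (c : V → V → κ) (i : κ) (x y : V) : Prop := x ≠ y ∧ c x y = i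

theorem cj.symm {c : V → V → κ} (hc : IsG c) {i : κ} {x y : V} (h : cj c i x y) : cj c i y x :=
  ⟨h.1.symm, by rw [hc.1]; exact h.2⟩

/-- in the set `A`, colour `i` contains no edge / `P₃` / `K₃` / `K₄ - e` / `K₅ - e` -/
def okc (c : V → V → κ) (A : Finset V) (i : κ) : St → Prop
  | .E => ∀ x ∈ A, ∀ y ∈ A, ¬ cj c i x y
  | .P => ∀ a ∈ A, ∀ x ∈ A, ∀ y ∈ A, x ≠ y → cj c i a x → ¬ cj c i a y
  | .T => ∀ a ∈ A, ∀ b ∈ A, ∀ x ∈ A, cj c i a b → cj c i a x → ¬ cj c i b x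
  | .D => ∀ a ∈ A, ∀ b ∈ A, ∀ x ∈ A, ∀ y ∈ A, x ≠ y → cj c i a b → cj c i a x → cj c i b x →
      cj c i a y → ¬ cj c i b y
  | .H => ∀ a ∈ A, ∀ b ∈ A, ∀ d ∈ A, ∀ x ∈ A, ∀ y ∈ A, x ≠ y → cj c i a b → cj c i a d →
      cj c i b d → cj c i a x → cj c i b x → cj c i d x → cj c i a y → cj c i b y → ¬ cj c i d y

theorem okc.sub {c : V → V → κ} {A B : Finset V} {i : κ} {X : St} (h : okc c A i X)
    (hB : B ⊆ A) : okc c B i X := by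
  cases X
  · intro x hx y hy; exact h x (hB hx) y (hB hy)
  · intro a ha x hx y hy; exact h a (hB ha) x (hB hx) y (hB hy)
  · intro a ha x hx y hy; exact h a (hB ha) x (hB hx) y (hB hy)
  · intro a ha b hb x hx y hy; exact h a (hB ha) b (hB hb) x (hB hx) y (hB hy)
  · intro a ha b hb d hd x hx y hy; exact h a (hB ha) b (hB hb) d (hB hd) x (hB hx) y (hB hy)

theorem okc.EP {c : V → V → κ} {A : Finset V} {i : κ} (h : okc c A i .E) : okc c A i .P := by
  intro a ha x hx y hy _ h1 _; exact h a ha x hx h1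
theorem okc.PT {c : V → V → κ} {A : Finset V} {i : κ} (h : okc c A i .P) : okc c A i .T := by
  intro a ha b hb x hx h1 h2 h3; exact h a ha b hb x hx h3.1 h1 h2
theorem okc.TD {c : V → V → κ} {A : Finset V} {i : κ} (h : okc c A i .T) : okc c A i .D := by
  intro a ha b hb x hx y hy _ h1 h2 h3; exact absurd h3 (h a ha b hb x hx h1 h2)
theorem okc.DH {c : V → V → κ} {A : Finset V} {i : κ} (h : okc c A i .D) : okc c A i .H := by
  intro a ha b hb d hd x hx y hy hn h1 h2 h3 h4 h5 h6 h7 h8 h9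
  exact h a ha b hb x hx y hy hn h1 h4 h5 h7 h8

def wr : St → ℕ
  | .D => 1 | .H => 1 | _ => 0
def ws : St → ℕ
  | .T => 1 | _ => 0
def wd : St → ℕ
  | .D => 1 | _ => 0
def wp : St → ℕ
  | .P => 1 | _ => 0

def IH1 (c : V → V → κ) (S : Finset V) (i : κ) (p r s d : ℕ) : Prop :=
  ∀ A ⊆ S, A.card < S.card → ∀ X, okc c A i X →
    5 * (A.card + d + wd X) ≤ phi (p + wp X) (r + wr X) (s + ws X)

def IH2 (c : V → V → κ) (S : Finset V) (i j : κ) (p r s d : ℕ) : Prop :=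
  ∀ A ⊆ S, A.card < S.card → ∀ X Y, okc c A i X → okc c A j Y →
    5 * (A.card + d + wd X + wd Y) ≤ phi (p + wp X + wp Y) (r + wr X + wr Y) (s + ws X + ws Y)

/-- complete join in colour `i` -/
def Jn (c : V → V → κ) (i : κ) (A B : Finset V) : Prop := ∀ x ∈ A, ∀ y ∈ B, cj c i x y

theorem Jn.symm {c : V → V → κ} (hc : IsG c) {i : κ} {A B : Finset V} (h : Jn c i A B) :
    Jn c i B A := fun x hx y hy => (h y hy x hx).symm hc

section join
variable {c : V → V → κ} {S A B : Finset V} {i : κ}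

theorem jP (hX : okc c S i .P) (hA : A ⊆ S) (hB : B ⊆ S) (hJ : Jn c i A B) (h : A.Nonempty) :
    B.card ≤ 1 := by
  obtain ⟨a, ha⟩ := h
  rw [Finset.card_le_one]
  intro x hx y hy
  by_contra hn
  exact hX a (hA ha) x (hB hx) y (hB hy) hn (hJ a ha x hx) (hJ a ha y hy)

theorem jT (hX : okc c S i .T) (hA : A ⊆ S) (hB : B ⊆ S) (hJ : Jn c i A B) (h : B.Nonempty) :
    okc c A i .E := by
  obtain ⟨b, hb⟩ := h
  intro x hx y hy hxy
  exact hX x (hA hx) y (hA hy) b (hB hb) hxy (hJ x hx b hb) (hJ y hy b hb)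

theorem jD1 (hc : IsG c) (hX : okc c S i .D) (hA : A ⊆ S) (hB : B ⊆ S) (hJ : Jn c i A B)
    (h : B.Nonempty) : okc c A i .P := by
  obtain ⟨b, hb⟩ := h
  intro a ha x hx y hy hn h1 h2
  exact hX a (hA ha) b (hB hb) x (hA hx) y (hA hy) hn (hJ a ha b hb) h1
    ((hJ x hx b hb).symm hc) h2 ((hJ y hy b hb).symm hc)

theorem jD2 (hX : okc c S i .D) (hA : A ⊆ S) (hB : B ⊆ S) (hJ : Jn c i A B)
    (h : 2 ≤ B.card) : okc c A i .E := by
  obtain ⟨b, hb, b', hb', hn⟩ := Finset.one_lt_card.1 h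
  intro x hx y hy hxy
  exact hX x (hA hx) y (hA hy) b (hB hb) b' (hB hb') hn hxy (hJ x hx b hb) (hJ y hy b hb)
    (hJ x hx b' hb') (hJ y hy b' hb')

theorem jH1 (hc : IsG c) (hX : okc c S i .H) (hA : A ⊆ S) (hB : B ⊆ S) (hJ : Jn c i A B)
    (h : B.Nonempty) : okc c A i .D := by
  obtain ⟨u, hu⟩ := h
  intro a ha b hb x hx y hy hn h1 h2 h3 h4 h5
  exact hX a (hA ha) b (hA hb) u (hB hu) x (hA hx) y (hA hy) hn h1 (hJ a ha u hu) (hJ b hb u hu)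
    h2 h3 ((hJ x hx u hu).symm hc) h4 h5 ((hJ y hy u hu).symm hc)

theorem jH2 (hX : okc c S i .H) (hA : A ⊆ S) (hB : B ⊆ S) (hJ : Jn c i A B)
    (h : 2 ≤ B.card) : okc c A i .T := by
  obtain ⟨u, hu, u', hu', hn⟩ := Finset.one_lt_card.1 h
  intro x hx y hy z hz h1 h2 h3
  exact hX x (hA hx) y (hA hy) z (hA hz) u (hB hu) u' (hB hu') hn h1 h2 h3
    (hJ x hx u hu) (hJ y hy u hu) (hJ z hz u hu) (hJ x hx u' hu') (hJ y hy u' hu') (hJ z hz u' hu')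

theorem jH3 (hc : IsG c) (hX : okc c S i .H) (hA : A ⊆ S) (hB : B ⊆ S) (hJ : Jn c i A B)
    (h : ¬ okc c B i .E) : okc c A i .P := by
  simp only [okc] at h
  push Not at h
  obtain ⟨u, hu, v, hv, huv⟩ := h
  intro a ha x hx y hy hn h1 h2
  exact hX a (hA ha) u (hB hu) v (hB hv) x (hA hx) y (hA hy) hn (hJ a ha u hu) (hJ a ha v hv) huv
    h1 ((hJ x hx u hu).symm hc) ((hJ x hx v hv).symm hc)
    h2 ((hJ y hy u hu).symm hc) ((hJ y hy v hv).symm hc)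

theorem jH4 (hX : okc c S i .H) (hA : A ⊆ S) (hB : B ⊆ S) (hJ : Jn c i A B)
    (h : ¬ okc c B i .P) : okc c A i .E := by
  simp only [okc] at h
  push Not at h
  obtain ⟨u, hu, x, hx, y, hy, hn, h1, h2⟩ := h
  intro a ha b hb hab
  exact hX a (hA ha) b (hA hb) u (hB hu) x (hB hx) y (hB hy) hn hab (hJ a ha u hu) (hJ b hb u hu)
    (hJ a ha x hx) (hJ b hb x hx) h1 (hJ a ha y hy) (hJ b hb y hy) h2

theorem jHH (hc : IsG c) (hX : okc c S i .H) (hA : A ⊆ S) (hB : B ⊆ S) (hJ : Jn c i A B)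
    (hA2 : 2 ≤ A.card) (hB2 : 2 ≤ B.card) :
    (okc c A i .T ∧ okc c B i .E) ∨ (okc c A i .E ∧ okc c B i .T) ∨
    (okc c A i .P ∧ okc c B i .P) := by
  by_cases h1 : okc c A i .E
  · exact Or.inr (Or.inl ⟨h1, jH2 hX hB hA (hJ.symm hc) hA2⟩)
  · by_cases h2 : okc c B i .E
    · exact Or.inl ⟨jH2 hX hA hB hJ hB2, h2⟩
    · exact Or.inr (Or.inr ⟨jH3 hc hX hA hB hJ h2, jH3 hc hX hB hA (hJ.symm hc) h1⟩)

theorem okc_ext {A0 : Finset V} (hc : IsG c)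
    (hA : ∀ x ∈ A, ∀ y ∈ A, cj c i x y → x ∈ A0 ∧ y ∈ A0) {X : St} (h : okc c A0 i X) :
    okc c A i X := by
  cases X
  · intro x hx y hy hxy
    have := hA x hx y hy hxy
    exact h x this.1 y this.2 hxy
  · intro a ha x hx y hy hn h1 h2
    exact h a (hA a ha x hx h1).1 x (hA a ha x hx h1).2 y (hA a ha y hy h2).2 hn h1 h2
  · intro a ha b hb x hx h1 h2 h3
    exact h a (hA a ha b hb h1).1 b (hA a ha b hb h1).2 x (hA a ha x hx h2).2 h1 h2 h3
  · intro a ha b hb x hx y hy hn h1 h2 h3 h4 h5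
    exact h a (hA a ha b hb h1).1 b (hA a ha b hb h1).2 x (hA a ha x hx h2).2 y
      (hA a ha y hy h4).2 hn h1 h2 h3 h4 h5
  · intro a ha b hb d hd x hx y hy hn h1 h2 h3 h4 h5 h6 h7 h8 h9
    exact h a (hA a ha b hb h1).1 b (hA a ha b hb h1).2 d (hA a ha d hd h2).2 x (hA a ha x hx h4).2 y
      (hA a ha y hy h7).2 hn h1 h2 h3 h4 h5 h6 h7 h8 h9

theorem phi_base1 (p r s : ℕ) : 5 * (2 + r) ≤ phi (p + 1) r s := by
  induction r with
  | zero => have := (phi_numA p 0 s).2.2.2.2.1; omega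
  | succ r ih => have := (phi_numA (p + 1) r s).2.1; omega

variable {p r s d : ℕ}

theorem LT (hI : IH1 c S i p r s d) (hS : S.card = A.card + B.card) (hAS : A ⊆ S) (hBS : B ⊆ S)
    (hA : A.Nonempty) (hB : B.Nonempty) (h1 : okc c A i .E) (h2 : okc c B i .E) :
    5 * (S.card + d) ≤ phi p r (s + 1) := by
  have a1 := hA.card_pos
  have b1 := hB.card_pos
  have h3 := hI A hAS (by omega) .E h1
  have h4 := hI B hBS (by omega) .E h2
  have := (phi_numA p r s).2.2.2.2.2.1
  simp only [wd, wr, ws, wp, Nat.add_zero] at h3 h4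
  omega

theorem GJ {A0 : Finset V} {X : St} (hc : IsG c) (hI : IH1 c S i p r s d) (hdr : d ≤ r)
    (hX : okc c S i X)
    (hS : S.card = A.card + B.card) (hAS : A ⊆ S) (hBS : B ⊆ S)
    (hA0 : A0.Nonempty) (hAA : A0 ⊆ A) (hB : B.Nonempty) (hJ : Jn c i A0 B)
    (hA : ∀ x ∈ A, ∀ y ∈ A, cj c i x y → x ∈ A0 ∧ y ∈ A0) (h2 : 2 ≤ A0.card ∨ A = A0) :
    5 * (S.card + d + wd X) ≤ phi (p + wp X) (r + wr X) (s + ws X) := by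
  have a1 := hA0.card_pos
  have b1 := hB.card_pos
  have aa := Finset.card_le_card hAA
  have hA0S := hAA.trans hAS
  have IA := hI A hAS (by omega)
  have IB := hI B hBS (by omega)
  have n := phi_numA p r s
  have ext : ∀ {X}, okc c A0 i X → okc c A i X := fun h => okc_ext hc hA h
  cases X
  · obtain ⟨a, ha⟩ := hA0
    obtain ⟨b, hb⟩ := hB
    exact absurd (hJ a ha b hb) (hX a (hA0S ha) b (hBS hb))
  · have e1 := jP hX hA0S hBS hJ hA0
    have e2 := jP hX hBS hA0S (hJ.symm hc) hB
    have : A.card = 1 := by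
      rcases h2 with h2 | h2
      · omega
      · subst h2; omega
    have := phi_base1 p r s
    simp only [wd, wr, ws, wp, Nat.add_zero]
    omega
  · have e1 := IA .E (ext (jT hX hA0S hBS hJ hB))
    have e2 := IB .E (jT hX hBS hA0S (hJ.symm hc) hA0)
    simp only [wd, wr, ws, wp, Nat.add_zero] at e1 e2 ⊢
    omega
  · by_cases hb : 2 ≤ B.card
    · have e1 := IA .E (ext (jD2 hX hA0S hBS hJ hb))
      by_cases ha : 2 ≤ A0.card
      · have e2 := IB .E (jD2 hX hBS hA0S (hJ.symm hc) ha)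
        simp only [wd, wr, ws, wp, Nat.add_zero] at e1 e2 ⊢
        omega
      · have : A = A0 := by tauto
        have e2 := IB .P (jD1 hc hX hBS hA0S (hJ.symm hc) hA0)
        subst this
        simp only [wd, wr, ws, wp, Nat.add_zero] at e1 e2 ⊢
        omega
    · have e1 := IA .P (ext (jD1 hc hX hA0S hBS hJ hB))
      simp only [wd, wr, ws, wp, Nat.add_zero] at e1 ⊢
      omega
  · by_cases hb : 2 ≤ B.card
    · by_cases ha : 2 ≤ A0.card
      · rcases jHH hc hX hA0S hBS hJ ha hb with ⟨x, y⟩ | ⟨x, y⟩ | ⟨x, y⟩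
        all_goals
          have e1 := IA _ (ext x)
          have e2 := IB _ y
          simp only [wd, wr, ws, wp, Nat.add_zero] at e1 e2 ⊢
          omega
      · have : A = A0 := by tauto
        have e2 := IB .D (jH1 hc hX hBS hA0S (hJ.symm hc) hA0)
        subst this
        simp only [wd, wr, ws, wp, Nat.add_zero] at e2 ⊢
        omega
    · have e1 := IA .D (ext (jH1 hc hX hA0S hBS hJ hB))
      simp only [wd, wr, ws, wp, Nat.add_zero] at e1 ⊢
      omega

end join
end states

/-! ### Counting edges among representatives -/
section counting
variable {V : Type} {κ : Type}

theorem b2n_or (b : Bool) : (b = true ∧ b.toNat = 1) ∨ b.toNat = 0 := by cases b <;> simp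

theorem ec3 (A : V → V → Bool) (a b x : V) :
    ec A [a, b, x] = (A a b).toNat + (A a x).toNat + (A b x).toNat := by
  cases h1 : A a b <;> cases h2 : A a x <;> cases h3 : A b x <;> simp [ec, h1, h2, h3]

theorem cntP_cons (f : V → Bool) (a : V) (l : List V) :
    (a :: l).countP f = l.countP f + (f a).toNat := by
  rw [List.countP_cons]; cases f a <;> simp

theorem ec4 (A : V → V → Bool) (a b x y : V) :
    ec A [a, b, x, y] = (A a b).toNat + (A a x).toNat + (A a y).toNat + (A b x).toNat +
      (A b y).toNat + (A x y).toNat := by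
  simp only [ec, cntP_cons, List.countP_nil]; omega

theorem ec5 (A : V → V → Bool) (a b d x y : V) :
    ec A [a, b, d, x, y] = (A a b).toNat + (A a d).toNat + (A a x).toNat + (A a y).toNat +
      (A b d).toNat + (A b x).toNat + (A b y).toNat + (A d x).toNat + (A d y).toNat +
      (A x y).toNat := by
  simp only [ec, cntP_cons, List.countP_nil]; omega

variable {c : V → V → κ} {R : Finset V} {i : κ} {A : V → V → Bool}

theorem ec_T (hA : ∀ x ∈ R, ∀ y ∈ R, A x y = true → cj c i x y) (hX : okc c R i .T) (l : List V)
    (hR : ∀ x ∈ l, x ∈ R) (h3 : l.length = 3) : ec A l ≤ 2 := by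
  match l, h3 with
  | [a, b, x], _ =>
    simp only [List.mem_cons, List.not_mem_nil, or_false, forall_eq_or_imp, forall_eq] at hR
    obtain ⟨ha, hb, hx⟩ := hR
    rw [ec3]
    rcases b2n_or (A a b) with h1 | h1
    · rcases b2n_or (A a x) with h2 | h2
      · rcases b2n_or (A b x) with h3 | h3
        · exact absurd (hA _ hb _ hx h3.1)
            (hX a ha b hb x hx (hA _ ha _ hb h1.1) (hA _ ha _ hx h2.1))
        · omega
      · have := Bool.toNat_le (A b x); omega
    · have := Bool.toNat_le (A b x); have := Bool.toNat_le (A a x); omega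

theorem ec_K4 (hA : ∀ x ∈ R, ∀ y ∈ R, A x y = true → cj c i x y)
    (hX : ∀ a ∈ R, ∀ b ∈ R, ∀ x ∈ R, ∀ y ∈ R, cj c i a b → cj c i a x → cj c i a y → cj c i b x →
      cj c i b y → ¬ cj c i x y) (l : List V)
    (hR : ∀ x ∈ l, x ∈ R) (h3 : l.length = 4) : ec A l ≤ 5 := by
  match l, h3 with
  | [a, b, x, y], _ =>
    simp only [List.mem_cons, List.not_mem_nil, or_false, forall_eq_or_imp, forall_eq] at hR
    obtain ⟨ha, hb, hx, hy⟩ := hR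
    rw [ec4]
    by_contra hn
    have := Bool.toNat_le (A a b)
    have := Bool.toNat_le (A a x)
    have := Bool.toNat_le (A a y)
    have := Bool.toNat_le (A b x)
    have := Bool.toNat_le (A b y)
    have := Bool.toNat_le (A x y)
    have g : ∀ u ∈ R, ∀ v ∈ R, 1 ≤ (A u v).toNat → cj c i u v := by
      intro u hu v hv h
      refine hA u hu v hv ?_
      rcases b2n_or (A u v) with h1 | h1
      · exact h1.1
      · omega
    exact hX a ha b hb x hx y hy (g a ha b hb (by omega)) (g a ha x hx (by omega))
      (g a ha y hy (by omega)) (g b hb x hx (by omega)) (g b hb y hy (by omega))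
      (g x hx y hy (by omega))

theorem five {b1 b2 b3 b4 b5 : Bool}
    (h : b1 = true → b2 = true → b3 = true → b4 = true → b5 = true → False) :
    b1.toNat + b2.toNat + b3.toNat + b4.toNat + b5.toNat ≤ 4 := by
  revert h; cases b1 <;> cases b2 <;> cases b3 <;> cases b4 <;> cases b5 <;> simp

theorem nine {b1 b2 b3 b4 b5 b6 b7 b8 b9 : Bool}
    (h : b1 = true → b2 = true → b3 = true → b4 = true → b5 = true → b6 = true → b7 = true →
      b8 = true → b9 = true → False) :
    b1.toNat + b2.toNat + b3.toNat + b4.toNat + b5.toNat + b6.toNat + b7.toNat + b8.toNat +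
      b9.toNat ≤ 8 := by
  have := Bool.toNat_le b1
  have := Bool.toNat_le b2
  have := Bool.toNat_le b3
  have := Bool.toNat_le b4
  have := Bool.toNat_le b5
  have := Bool.toNat_le b6
  have := Bool.toNat_le b7
  have := Bool.toNat_le b8
  have := Bool.toNat_le b9
  by_contra hn
  have g : ∀ b : Bool, 1 ≤ b.toNat → b = true := by decide
  exact h (g _ (by omega)) (g _ (by omega)) (g _ (by omega)) (g _ (by omega)) (g _ (by omega))
    (g _ (by omega)) (g _ (by omega)) (g _ (by omega)) (g _ (by omega))

theorem ec_D (hc : IsG c) (hA : ∀ x ∈ R, ∀ y ∈ R, A x y = true → cj c i x y) (hX : okc c R i .D)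
    (l : List V) (hl : l.Nodup)
    (hR : ∀ x ∈ l, x ∈ R) (h3 : l.length = 4) : ec A l ≤ 4 := by
  match l, h3 with
  | [a, b, x, y], _ =>
    simp only [List.mem_cons, List.not_mem_nil, or_false, forall_eq_or_imp, forall_eq] at hR
    obtain ⟨ha, hb, hx, hy⟩ := hR
    simp only [List.nodup_cons, List.mem_cons, List.not_mem_nil, or_false, not_or] at hl
    obtain ⟨⟨n1, n2, n3⟩, ⟨n4, n5⟩, n6, -⟩ := hl
    rw [ec4]
    have key : ∀ a ∈ R, ∀ b ∈ R, ∀ x ∈ R, ∀ y ∈ R, x ≠ y → cj c i a b → cj c i a x → cj c i b x →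
      cj c i a y → cj c i b y → False := hX
    have s : ∀ {x y}, cj c i x y → cj c i y x := fun h => h.symm hc
    have ab := hA a ha b hb
    have ax := hA a ha x hx
    have ay := hA a ha y hy
    have bx := hA b hb x hx
    have bY := hA b hb y hy
    have xy := hA x hx y hy
    have e1 := @five (A a b) (A a x) (A a y) (A b x) (A b y) (fun h1 h2 h3 h4 h5 =>
      key a ha b hb x hx y hy n6 (ab h1) (ax h2) (bx h4) (ay h3) (bY h5))
    have e2 := @five (A a b) (A a x) (A a y) (A b x) (A x y) (fun h1 h2 h3 h4 h5 =>
      key a ha x hx b hb y hy n5 (ax h2) (ab h1) (s (bx h4)) (ay h3) (xy h5))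
    have e3 := @five (A a b) (A a x) (A a y) (A b y) (A x y) (fun h1 h2 h3 h4 h5 =>
      key a ha y hy b hb x hx n4 (ay h3) (ab h1) (s (bY h4)) (ax h2) (s (xy h5)))
    have e4 := @five (A a b) (A a x) (A b x) (A b y) (A x y) (fun h1 h2 h3 h4 h5 =>
      key b hb x hx a ha y hy n3 (bx h3) (s (ab h1)) (s (ax h2)) (bY h4) (xy h5))
    have e5 := @five (A a b) (A a y) (A b x) (A b y) (A x y) (fun h1 h2 h3 h4 h5 =>
      key b hb y hy a ha x hx n2 (bY h4) (s (ab h1)) (s (ay h2)) (bx h3) (s (xy h5)))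
    have e6 := @five (A a x) (A a y) (A b x) (A b y) (A x y) (fun h1 h2 h3 h4 h5 =>
      key x hx y hy a ha b hb n1 (xy h5) (s (ax h1)) (s (ay h2)) (s (bx h3)) (s (bY h4)))
    omega

theorem ec_H (hc : IsG c) (hA : ∀ x ∈ R, ∀ y ∈ R, A x y = true → cj c i x y) (hX : okc c R i .H)
    (l : List V) (hl : l.Nodup)
    (hR : ∀ x ∈ l, x ∈ R) (h3 : l.length = 5) : ec A l ≤ 8 := by
  match l, h3 with
  | [a, b, d, x, y], _ =>
    simp only [List.mem_cons, List.not_mem_nil, or_false, forall_eq_or_imp, forall_eq] at hR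
    obtain ⟨ha, hb, hd, hx, hy⟩ := hR
    simp only [List.nodup_cons, List.mem_cons, List.not_mem_nil, or_false, not_or] at hl
    obtain ⟨⟨n0, n1, n2, n3⟩, ⟨n4, n5, n6⟩, ⟨n7, n8⟩, n9, -⟩ := hl
    rw [ec5]
    have key : ∀ a b d x y, a ∈ R → b ∈ R → d ∈ R → x ∈ R → y ∈ R → x ≠ y →
        ∀ h1 : A a b = true ∨ A b a = true, ∀ h2 : A a d = true ∨ A d a = true,
        ∀ h3 : A b d = true ∨ A d b = true, ∀ h4 : A a x = true ∨ A x a = true,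
        ∀ h5 : A b x = true ∨ A x b = true, ∀ h6 : A d x = true ∨ A x d = true,
        ∀ h7 : A a y = true ∨ A y a = true, ∀ h8 : A b y = true ∨ A y b = true,
        ∀ h9 : A d y = true ∨ A y d = true, False := by
      intro a b d x y ha hb hd hx hy hn h1 h2 h3 h4 h5 h6 h7 h8 h9
      have s : ∀ {x y}, x ∈ R → y ∈ R → A x y = true ∨ A y x = true → cj c i x y := by
        intro x y hx hy h
        rcases h with h | h
        · exact hA x hx y hy h
        · exact (hA y hy x hx h).symm hc
      exact hX a ha b hb d hd x hx y hy hn (s ha hb h1) (s ha hd h2) (s hb hd h3) (s ha hx h4)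
        (s hb hx h5) (s hd hx h6) (s ha hy h7) (s hb hy h8) (s hd hy h9)
    have e0 := @nine (A a d) (A a x) (A a y) (A b d) (A b x) (A b y) (A d x) (A d y) (A x y)
      (fun had hax hay hbd hbx hby hdx hdy hxy =>
        key d x y a b hd hx hy ha hb n0
          (Or.inl hdx) (Or.inl hdy) (Or.inl hxy) (Or.inr had) (Or.inr hax) (Or.inr hay) (Or.inr hbd) (Or.inr hbx) (Or.inr hby))
    have e1 := @nine (A a b) (A a x) (A a y) (A b d) (A b x) (A b y) (A d x) (A d y) (A x y)
      (fun hab hax hay hbd hbx hby hdx hdy hxy =>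
        key b x y a d hb hx hy ha hd n1
          (Or.inl hbx) (Or.inl hby) (Or.inl hxy) (Or.inr hab) (Or.inr hax) (Or.inr hay) (Or.inl hbd) (Or.inr hdx) (Or.inr hdy))
    have e2 := @nine (A a b) (A a d) (A a y) (A b d) (A b x) (A b y) (A d x) (A d y) (A x y)
      (fun hab had hay hbd hbx hby hdx hdy hxy =>
        key b d y a x hb hd hy ha hx n2
          (Or.inl hbd) (Or.inl hby) (Or.inl hdy) (Or.inr hab) (Or.inr had) (Or.inr hay) (Or.inl hbx) (Or.inl hdx) (Or.inr hxy))
    have e3 := @nine (A a b) (A a d) (A a x) (A b d) (A b x) (A b y) (A d x) (A d y) (A x y)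
      (fun hab had hax hbd hbx hby hdx hdy hxy =>
        key b d x a y hb hd hx ha hy n3
          (Or.inl hbd) (Or.inl hbx) (Or.inl hdx) (Or.inr hab) (Or.inr had) (Or.inr hax) (Or.inl hby) (Or.inl hdy) (Or.inl hxy))
    have e4 := @nine (A a b) (A a d) (A a x) (A a y) (A b x) (A b y) (A d x) (A d y) (A x y)
      (fun hab had hax hay hbx hby hdx hdy hxy =>
        key a x y b d ha hx hy hb hd n4
          (Or.inl hax) (Or.inl hay) (Or.inl hxy) (Or.inl hab) (Or.inr hbx) (Or.inr hby) (Or.inl had) (Or.inr hdx) (Or.inr hdy))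
    have e5 := @nine (A a b) (A a d) (A a x) (A a y) (A b d) (A b y) (A d x) (A d y) (A x y)
      (fun hab had hax hay hbd hby hdx hdy hxy =>
        key a d y b x ha hd hy hb hx n5
          (Or.inl had) (Or.inl hay) (Or.inl hdy) (Or.inl hab) (Or.inr hbd) (Or.inr hby) (Or.inl hax) (Or.inl hdx) (Or.inr hxy))
    have e6 := @nine (A a b) (A a d) (A a x) (A a y) (A b d) (A b x) (A d x) (A d y) (A x y)
      (fun hab had hax hay hbd hbx hdx hdy hxy =>
        key a d x b y ha hd hx hb hy n6
          (Or.inl had) (Or.inl hax) (Or.inl hdx) (Or.inl hab) (Or.inr hbd) (Or.inr hbx) (Or.inl hay) (Or.inl hdy) (Or.inl hxy))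
    have e7 := @nine (A a b) (A a d) (A a x) (A a y) (A b d) (A b x) (A b y) (A d y) (A x y)
      (fun hab had hax hay hbd hbx hby hdy hxy =>
        key a b y d x ha hb hy hd hx n7
          (Or.inl hab) (Or.inl hay) (Or.inl hby) (Or.inl had) (Or.inl hbd) (Or.inr hdy) (Or.inl hax) (Or.inl hbx) (Or.inr hxy))
    have e8 := @nine (A a b) (A a d) (A a x) (A a y) (A b d) (A b x) (A b y) (A d x) (A x y)
      (fun hab had hax hay hbd hbx hby hdx hxy =>
        key a b x d y ha hb hx hd hy n8
          (Or.inl hab) (Or.inl hax) (Or.inl hbx) (Or.inl had) (Or.inl hbd) (Or.inr hdx) (Or.inl hay) (Or.inl hby) (Or.inl hxy))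
    have e9 := @nine (A a b) (A a d) (A a x) (A a y) (A b d) (A b x) (A b y) (A d x) (A d y)
      (fun hab had hax hay hbd hbx hby hdx hdy =>
        key a b d x y ha hb hd hx hy n9
          (Or.inl hab) (Or.inl had) (Or.inl hbd) (Or.inl hax) (Or.inl hbx) (Or.inl hdx) (Or.inl hay) (Or.inl hby) (Or.inl hdy))
    omega

end counting

/-! ### Ramsey bounds for the set of representatives -/
section reps
variable {V : Type} {κ : Type} {c : V → V → κ} {R : Finset V} {i j : κ}

open Classical in
noncomputable def Ai (c : V → V → κ) (i : κ) (x y : V) : Bool := decide (cj c i x y)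

theorem Ai_symm (hc : IsG c) (x y : V) : Ai c i x y = Ai c i y x := by
  unfold Ai
  rw [decide_eq_decide]
  exact ⟨fun h => h.symm hc, fun h => h.symm hc⟩

theorem Ai_irr (x : V) : Ai c i x x = false := by simp [Ai, cj]

theorem Ai_cj {x y : V} (h : Ai c i x y = true) : cj c i x y := by simpa [Ai] using h

open Classical in
theorem co_cj (hR : ∀ x ∈ R, ∀ y ∈ R, x ≠ y → c x y = i ∨ c x y = j) {x y : V} (hx : x ∈ R)
    (hy : y ∈ R) (h : co (Ai c i) x y = true) : cj c j x y := by
  simp only [co, Ai, Bool.and_eq_true, Bool.not_eq_true', decide_eq_false_iff_not] at h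
  have h2 : ¬ cj c i x y := by simpa using h.2
  exact ⟨h.1, (hR x hx y hy h.1).resolve_left (fun h3 => h2 ⟨h.1, h3⟩)⟩

/-- no `K₄` in colour `i` -/
def noK4 (c : V → V → κ) (R : Finset V) (i : κ) : Prop :=
  ∀ a ∈ R, ∀ b ∈ R, ∀ x ∈ R, ∀ y ∈ R, cj c i a b → cj c i a x → cj c i a y → cj c i b x →
      cj c i b y → ¬ cj c i x y


theorem rep_TT (hc : IsG c) (hR : ∀ x ∈ R, ∀ y ∈ R, x ≠ y → c x y = i ∨ c x y = j)
    (h1 : okc c R i .T) (h2 : okc c R j .T) : R.card < 6 := by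
  classical
  refine clK336.empty (Ai_symm (i := i) hc) Ai_irr (R := R) ?_
  unfold PK33
  refine good_cons.2 ⟨?_, good_nil _ _⟩
  intro l hl hm h3
  have a1 := ec_T (A := Ai c i) (fun x _ y _ => Ai_cj) h1 l hm h3
  have a2 := ec_T (A := co (Ai c i)) (fun x hx y hy => co_cj hR hx hy) h2 l hm h3
  have := ec_co (Ai c i) l hl
  rw [h3] at this
  have e3 : Nat.choose 3 2 = 3 := by decide
  have e4 : Nat.choose 4 2 = 6 := by decide
  have e5 : Nat.choose 5 2 = 10 := by decide
  dsimp only at this ⊢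
  norm_num only at this
  omega

theorem rep_TD (hc : IsG c) (hR : ∀ x ∈ R, ∀ y ∈ R, x ≠ y → c x y = i ∨ c x y = j)
    (h1 : okc c R i .T) (h2 : okc c R j .D) : R.card < 7 := by
  classical
  refine clW7.empty (Ai_symm (i := i) hc) Ai_irr (R := R) ?_
  unfold PW
  refine good_cons.2 ⟨?_, good_cons.2 ⟨?_, good_nil _ _⟩⟩
  · intro l hl hm h3
    exact ⟨Nat.zero_le _, ec_T (A := Ai c i) (fun x _ y _ => Ai_cj) h1 l hm h3⟩
  · intro l hl hm h3
    have a2 := ec_D (A := co (Ai c i)) hc (fun x hx y hy => co_cj hR hx hy) h2 l hl hm h3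
    have := ec_co (Ai c i) l hl
    rw [h3] at this
    have e3 : Nat.choose 3 2 = 3 := by decide
    have e4 : Nat.choose 4 2 = 6 := by decide
    have e5 : Nat.choose 5 2 = 10 := by decide
    dsimp only at this ⊢
    norm_num only at this
    omega

theorem rep_DH (hc : IsG c) (hR : ∀ x ∈ R, ∀ y ∈ R, x ≠ y → c x y = i ∨ c x y = j)
    (h1 : okc c R i .D) (h2 : okc c R j .H) : R.card < 13 := by
  classical
  refine r13 (Ai_symm (i := i) hc) Ai_irr (R := R) ?_
  unfold PA
  refine good_cons.2 ⟨?_, good_cons.2 ⟨?_, good_nil _ _⟩⟩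
  · intro l hl hm h3
    exact ⟨Nat.zero_le _, ec_D (A := Ai c i) hc (fun x _ y _ => Ai_cj) h1 l hl hm h3⟩
  · intro l hl hm h3
    have a2 := ec_H (A := co (Ai c i)) hc (fun x hx y hy => co_cj hR hx hy) h2 l hl hm h3
    have := ec_co (Ai c i) l hl
    rw [h3] at this
    have e3 : Nat.choose 3 2 = 3 := by decide
    have e4 : Nat.choose 4 2 = 6 := by decide
    have e5 : Nat.choose 5 2 = 10 := by decide
    dsimp only at this ⊢
    norm_num only at this
    omega

theorem rep_TH (hc : IsG c) (hR : ∀ x ∈ R, ∀ y ∈ R, x ≠ y → c x y = i ∨ c x y = j)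
    (h1 : okc c R i .T) (h2 : okc c R j .H) : R.card < 11 := by
  classical
  refine clK3H11.empty (Ai_symm (i := i) hc) Ai_irr (R := R) ?_
  unfold PK3H
  refine good_cons.2 ⟨?_, good_cons.2 ⟨?_, good_nil _ _⟩⟩
  · intro l hl hm h3
    exact ⟨Nat.zero_le _, ec_T (A := Ai c i) (fun x _ y _ => Ai_cj) h1 l hm h3⟩
  · intro l hl hm h3
    have a2 := ec_H (A := co (Ai c i)) hc (fun x hx y hy => co_cj hR hx hy) h2 l hl hm h3
    have := ec_co (Ai c i) l hl
    rw [h3] at this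
    have e3 : Nat.choose 3 2 = 3 := by decide
    have e4 : Nat.choose 4 2 = 6 := by decide
    have e5 : Nat.choose 5 2 = 10 := by decide
    dsimp only at this ⊢
    norm_num only at this
    omega

theorem rep_TK4 (hc : IsG c) (hR : ∀ x ∈ R, ∀ y ∈ R, x ≠ y → c x y = i ∨ c x y = j)
    (h1 : okc c R i .T) (h2 : noK4 c R j) : R.card < 9 := by
  classical
  refine clK349.empty (Ai_symm (i := i) hc) Ai_irr (R := R) ?_
  unfold PK34
  refine good_cons.2 ⟨?_, good_cons.2 ⟨?_, good_nil _ _⟩⟩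
  · intro l hl hm h3
    exact ⟨Nat.zero_le _, ec_T (A := Ai c i) (fun x _ y _ => Ai_cj) h1 l hm h3⟩
  · intro l hl hm h3
    have a2 := ec_K4 (A := co (Ai c i)) (fun x hx y hy => co_cj hR hx hy) h2 l hm h3
    have := ec_co (Ai c i) l hl
    rw [h3] at this
    have e3 : Nat.choose 3 2 = 3 := by decide
    have e4 : Nat.choose 4 2 = 6 := by decide
    have e5 : Nat.choose 5 2 = 10 := by decide
    dsimp only at this ⊢
    norm_num only at this
    omega

theorem rep_HH (hc : IsG c) (hR : ∀ x ∈ R, ∀ y ∈ R, x ≠ y → c x y = i ∨ c x y = j)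
    (h1 : okc c R i .H) (h2 : okc c R j .H) : R.card < 22 := by
  classical
  refine r22 (Ai_symm (i := i) hc) Ai_irr (R := R) ?_
  unfold PH
  refine good_cons.2 ⟨?_, good_nil _ _⟩
  intro l hl hm h3
  have a1 := ec_H (A := Ai c i) hc (fun x _ y _ => Ai_cj) h1 l hl hm h3
  have a2 := ec_H (A := co (Ai c i)) hc (fun x hx y hy => co_cj hR hx hy) h2 l hl hm h3
  have := ec_co (Ai c i) l hl
  rw [h3] at this
  have e3 : Nat.choose 3 2 = 3 := by decide
  have e4 : Nat.choose 4 2 = 6 := by decide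
  have e5 : Nat.choose 5 2 = 10 := by decide
  dsimp only at this ⊢
  norm_num only at this
  omega

theorem rep_KK (hc : IsG c) (hR : ∀ x ∈ R, ∀ y ∈ R, x ≠ y → c x y = i ∨ c x y = j)
    (h1 : noK4 c R i) (h2 : noK4 c R j) : R.card < 18 := by
  classical
  refine r18 (Ai_symm (i := i) hc) Ai_irr (R := R) ?_
  refine good_cons.2 ⟨?_, good_nil _ _⟩
  intro l hl hm h3
  have a1 := ec_K4 (A := Ai c i) (fun x _ y _ => Ai_cj) h1 l hm h3
  have a2 := ec_K4 (A := co (Ai c i)) (fun x hx y hy => co_cj hR hx hy) h2 l hm h3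
  have := ec_co (Ai c i) l hl
  rw [h3] at this
  have e3 : Nat.choose 3 2 = 3 := by decide
  have e4 : Nat.choose 4 2 = 6 := by decide
  have e5 : Nat.choose 5 2 = 10 := by decide
  dsimp only at this ⊢
  norm_num only at this
  omega

end reps

/-! ### The two-coloured quotient: easy types -/
section quot
set_option linter.unusedSimpArgs false
variable {V : Type} {κ : Type}

open Classical in
/-- the part of `x` -/
noncomputable def pt (S : Finset V) (e : V → V → Prop) (x : V) : Finset V := S.filter (fun y => e x y)

open Classical in
/-- the union of the parts joined to `x` in colour `i` -/
noncomputable def nn (c : V → V → κ) (S : Finset V) (e : V → V → Prop) (i : κ) (x : V) : Finset V :=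
  S.filter (fun y => ¬ e x y ∧ c x y = i)

variable {c : V → V → κ} {S : Finset V} {i j : κ} {e : V → V → Prop} {p r s d : ℕ}

theorem mem_pt {x y : V} : y ∈ pt S e x ↔ y ∈ S ∧ e x y := by simp [pt]
theorem mem_nn {x y : V} : y ∈ nn c S e i x ↔ y ∈ S ∧ ¬ e x y ∧ c x y = i := by simp [nn]
theorem pt_sub {x : V} : pt S e x ⊆ S := fun _ hy => (mem_pt.1 hy).1
theorem nn_sub {x : V} : nn c S e i x ⊆ S := fun _ hy => (mem_nn.1 hy).1

structure Cx (c : V → V → κ) (S : Finset V) (i j : κ) (e : V → V → Prop) (p r s d : ℕ) : Prop where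
  hc : IsG c
  g : Gal c S i j e
  hdr : d ≤ r
  ih : IH2 c S i j p r s d

theorem Cx.swap (C : Cx c S i j e p r s d) : Cx c S j i e p r s d := by
  refine ⟨C.hc, C.g.swap, C.hdr, ?_⟩
  intro A hA hl X Y hX hY
  have := C.ih A hA hl Y X hY hX
  rw [Nat.add_right_comm p, Nat.add_right_comm r, Nat.add_right_comm s]
  omega

/-- the desired conclusion -/
def Gl (S : Finset V) (p r s d : ℕ) (X Y : St) : Prop :=
  5 * (S.card + d + wd X + wd Y) ≤ phi (p + wp X + wp Y) (r + wr X + wr Y) (s + ws X + ws Y)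

theorem Gl.swap {X Y : St} (h : Gl S p r s d X Y) : Gl S p r s d Y X := by
  unfold Gl at *
  rw [Nat.add_right_comm p, Nat.add_right_comm r, Nat.add_right_comm s]
  omega

theorem Cx.ih1 (C : Cx c S i j e p r s d) {X : St} (hX : okc c S i X) :
    IH1 c S j (p + wp X) (r + wr X) (s + ws X) (d + wd X) := by
  intro A hA hl Y hY
  have := C.ih A hA hl X Y (hX.sub hA) hY
  omega

theorem wd_le_wr (X : St) : wd X ≤ wr X := by cases X <;> simp [wd, wr]

theorem two_E {A : Finset V} (h : ¬ okc c A i .E) : 2 ≤ A.card := by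
  simp only [okc] at h
  push Not at h
  obtain ⟨x, hx, y, hy, hxy⟩ := h
  exact Finset.one_lt_card.2 ⟨x, hx, y, hy, hxy.1⟩

theorem union_E [DecidableEq V] (hc : IsG c) {A B : Finset V} (hA : okc c A j .E)
    (hB : okc c B j .E) (hJ : Jn c i A B) (hij : i ≠ j) : okc c (A ∪ B) j .E := by
  intro x hx y hy hxy
  rcases Finset.mem_union.1 hx with hx | hx <;> rcases Finset.mem_union.1 hy with hy | hy
  · exact hA x hx y hy hxy
  · exact hij ((hJ x hx y hy).2.symm.trans hxy.2)
  · exact hij ((hJ y hy x hx).2.symm.trans (hxy.symm hc).2)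
  · exact hB x hx y hy hxy

section

theorem Cx.homs (C : Cx c S i j e p r s d) {x : V} (hx : x ∈ S)
    {y x' y' : V} (hy : y ∈ S) (hx' : x' ∈ S) (hy' : y' ∈ S) (h1 : e x x') (h2 : e y y')
    (h : ¬ e x y) : c x' y' = c x y := by
  have a := C.g.hom x hx x' hx' y hy h1 h
  have b := C.g.hom y hy y' hy' x' hx' h2 (fun h' => h (C.g.trans _ _ _ h1 (C.g.symm _ _ h')))
  rw [← b, C.hc.1 x' y, ← a, C.hc.1]

theorem Cx.self (C : Cx c S i j e p r s d) {x : V} (hx : x ∈ S)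
    : x ∈ pt S e x := mem_pt.2 ⟨hx, C.g.refl x⟩

theorem Cx.nne (C : Cx c S i j e p r s d) {x : V} (hx : x ∈ S)
    : (nn c S e i x).Nonempty := by
  obtain ⟨y, hy, h⟩ := C.g.exi x hx
  exact ⟨y, mem_nn.2 ⟨hy, h⟩⟩

theorem Cx.jn (C : Cx c S i j e p r s d) {x : V} (hx : x ∈ S)
    : Jn c i (pt S e x) (nn c S e i x) := by
  intro y hy z hz
  rw [mem_pt] at hy
  rw [mem_nn] at hz
  refine ⟨?_, ?_⟩
  · rintro rfl; exact hz.2.1 hy.2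
  · rw [C.homs hx hz.1 hy.1 hz.1 hy.2 (C.g.refl z) hz.2.1]; exact hz.2.2

theorem Cx.card3 (C : Cx c S i j e p r s d) {x : V} (hx : x ∈ S)
    : S.card = (pt S e x).card + (nn c S e i x).card + (nn c S e j x).card ∧
    1 ≤ (pt S e x).card ∧ 1 ≤ (nn c S e i x).card ∧ 1 ≤ (nn c S e j x).card := by
  classical
  refine ⟨?_, Finset.card_pos.2 ⟨x, C.self hx⟩, (C.nne hx).card_pos, (C.swap.nne hx).card_pos⟩
  have hS : S = pt S e x ∪ nn c S e i x ∪ nn c S e j x := by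
    ext y
    simp only [Finset.mem_union, mem_pt, mem_nn]
    have := C.g.col x hx y
    tauto
  conv_lhs => rw [hS]
  rw [Finset.card_union_of_disjoint, Finset.card_union_of_disjoint]
  · rw [Finset.disjoint_left]; intro y h1 h2
    rw [mem_pt] at h1; rw [mem_nn] at h2; tauto
  · rw [Finset.disjoint_left]; intro y h1 h2
    simp only [Finset.mem_union, mem_pt, mem_nn] at h1 h2
    rcases h1 with h1 | h1
    · tauto
    · exact C.g.ne (h1.2.2.symm.trans h2.2.2)

theorem Cx.special (C : Cx c S i j e p r s d) {x : V} (hx : x ∈ S)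
    {X Y : St} (hX : okc c S i X) (hY : okc c S j Y) (h2 : 2 ≤ (pt S e x).card)
    (h1 : (nn c S e i x).card ≤ 1) : Gl S p r s d X Y := by
  classical
  obtain ⟨h3, h4, h5, h6⟩ := C.card3 hx
  have := GJ (A := pt S e x ∪ nn c S e i x) (A0 := pt S e x) (B := nn c S e j x) C.hc
    (C.ih1 hX) (by have := wd_le_wr X; have := C.hdr; omega) hY ?_
    (Finset.union_subset pt_sub nn_sub) nn_sub ⟨x, C.self hx⟩ Finset.subset_union_left
    (C.swap.nne hx) (C.swap.jn hx) ?_ (Or.inl h2)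
  · unfold Gl; omega
  · rw [Finset.card_union_of_disjoint]
    · exact h3
    · rw [Finset.disjoint_left]; intro y h1 h2
      rw [mem_pt] at h1; rw [mem_nn] at h2; tauto
  · intro y hy z hz hyz
    have J := C.jn hx
    rcases Finset.mem_union.1 hy with hy | hy <;> rcases Finset.mem_union.1 hz with hz | hz
    · exact ⟨hy, hz⟩
    · exact absurd ((J y hy z hz).2.symm.trans hyz.2) C.g.ne
    · exact absurd ((J z hz y hy).2.symm.trans (hyz.symm C.hc).2) C.g.ne
    · exact absurd (Finset.card_le_one.1 h1 y hy z hz) hyz.1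

theorem Cx.caseE (C : Cx c S i j e p r s d) {x : V} (hx : x ∈ S)
    {X Y : St} (hX : okc c S i .E) : Gl S p r s d X Y := by
  obtain ⟨y, hy⟩ := C.nne hx
  exact absurd (C.jn hx x (C.self hx) y hy) (hX x hx y (nn_sub hy))

theorem Cx.caseP (C : Cx c S i j e p r s d) {x : V} (hx : x ∈ S)
    {Y : St} (hX : okc c S i .P) (hY : okc c S j Y) : Gl S p r s d .P Y := by
  classical
  obtain ⟨h3, h4, h5, h6⟩ := C.card3 hx
  have one : ∀ x ∈ S, (pt S e x).card ≤ 1 ∧ (nn c S e i x).card ≤ 1 := by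
    intro x hx
    exact ⟨jP hX nn_sub pt_sub ((C.jn hx).symm C.hc) (C.nne hx),
      jP hX pt_sub nn_sub (C.jn hx) ⟨x, C.self hx⟩⟩
  obtain ⟨y, hy⟩ := C.nne hx
  have hy' := mem_nn.1 hy
  have hxy : x ≠ y := by rintro rfl; exact hy'.2.1 (C.g.refl x)
  have hxn : x ∈ nn c S e i y := mem_nn.2 ⟨hx, fun h => hy'.2.1 (C.g.symm _ _ h),
    by rw [C.hc.1]; exact hy'.2.2⟩
  have h2 : ({x, y} : Finset V).card = 2 := Finset.card_pair hxy
  have := GJ (A := {x, y}) (A0 := {x, y}) (B := nn c S e j x) C.hc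
    (C.ih1 hX) (by have := wd_le_wr .P; have := C.hdr; omega) hY
    (by have := one x hx; omega) (by intro z; simp; rintro (rfl | rfl); exacts [hx, hy'.1])
    nn_sub (by simp) (Finset.Subset.refl _) (C.swap.nne hx) ?_ (fun _ h1 _ h2 _ => ⟨h1, h2⟩)
    (Or.inr rfl)
  · unfold Gl; omega
  · intro z hz w hw
    simp only [Finset.mem_insert, Finset.mem_singleton] at hz
    rcases hz with rfl | rfl
    · exact C.swap.jn hx z (C.self hx) w hw
    · have hw' := mem_nn.1 hw
      have hyw : ¬ e z w := by
        intro h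
        have := Finset.card_le_one.1 (one z hy'.1).1 z (C.self hy'.1) w (mem_pt.2 ⟨hw'.1, h⟩)
        subst this
        exact C.g.ne (hy'.2.2.symm.trans hw'.2.2)
      refine ⟨by rintro rfl; exact hyw (C.g.refl _), ?_⟩
      refine (C.g.col z hy'.1 w hw'.1 hyw).resolve_left fun h => ?_
      have := Finset.card_le_one.1 (one z hy'.1).2 x hxn w (mem_nn.2 ⟨hw'.1, hyw, h⟩)
      subst this
      exact hw'.2.1 (C.g.refl x)

end

/-- pairwise in different parts -/
def Ind (e : V → V → Prop) (R : Finset V) : Prop := ∀ x ∈ R, ∀ y ∈ R, x ≠ y → ¬ e x y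

theorem Gal.reps (g : Gal c S i j e) : ∃ R ⊆ S, (∀ x ∈ R, ∀ y ∈ R, x ≠ y → ¬ e x y) ∧
    S.card ≤ ∑ x ∈ R, (pt S e x).card := by
  classical
  obtain ⟨R, hR, hmax⟩ := Finset.exists_max_image
    (S.powerset.filter (fun R => Ind e R)) Finset.card
    ⟨∅, Finset.mem_filter.2 ⟨by simp, fun x hx => by simp at hx⟩⟩
  rw [Finset.mem_filter, Finset.mem_powerset] at hR
  refine ⟨R, hR.1, hR.2, ?_⟩
  refine le_trans (Finset.card_le_card ?_) Finset.card_biUnion_le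
  intro y hy
  rw [Finset.mem_biUnion]
  by_contra hn
  push Not at hn
  have hn' : ∀ x ∈ R, ¬ e x y := fun x hx h => hn x hx (mem_pt.2 ⟨hy, h⟩)
  have hyR : y ∉ R := fun h => hn' y h (g.refl y)
  have := hmax (insert y R) (by
    rw [Finset.mem_filter, Finset.mem_powerset]
    refine ⟨Finset.insert_subset hy hR.1, ?_⟩
    intro a ha b hb hab
    rw [Finset.mem_insert] at ha hb
    rcases ha with rfl | ha <;> rcases hb with rfl | hb
    · exact absurd rfl hab
    · exact fun h => hn' b hb (g.symm _ _ h)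
    · exact hn' a ha
    · exact hR.2 a ha b hb hab)
  rw [Finset.card_insert_of_notMem hyR] at this
  omega

theorem Cx.unl (C : Cx c S i j e p r s d) (hS : S.Nonempty)
    (h : ∀ x ∈ S, okc c (pt S e x) i .E ∧ okc c (pt S e x) j .E) {R : Finset V} (hR : R ⊆ S)
    (hsum : S.card ≤ ∑ x ∈ R, (pt S e x).card) {q : ℕ} (hq : R.card ≤ q) :
    5 * (S.card + d) ≤ q * phi p r s := by
  classical
  have hb : ∀ x ∈ R, 5 * ((pt S e x).card + d) ≤ phi p r s := by
    intro x hx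
    have := C.card3 (hR hx)
    have := C.ih (pt S e x) pt_sub (by omega) .E .E (h x (hR hx)).1 (h x (hR hx)).2
    simpa only [wd, wr, ws, wp, Nat.add_zero, Nat.add_assoc, Nat.reduceAdd] using this
  have h1 : ∑ x ∈ R, 5 * ((pt S e x).card + d) ≤ R.card * phi p r s := by
    have := Finset.sum_le_card_nsmul R _ _ hb
    simpa using this
  rw [← Finset.mul_sum, Finset.sum_add_distrib, Finset.sum_const, smul_eq_mul] at h1
  have hne : 1 ≤ R.card := by
    rcases R.eq_empty_or_nonempty with rfl | h
    · have := hS.card_pos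
      rw [Finset.sum_empty] at hsum
      omega
    · exact h.card_pos
  have h2 : d ≤ R.card * d := Nat.le_mul_of_pos_left d hne
  have h3 := Nat.mul_le_mul_right (phi p r s) hq
  omega

theorem okc_E1 {A : Finset V} (h : A.card ≤ 1) : okc c A i .E := by
  by_contra hn
  have := two_E hn
  omega

theorem Gal.colR (g : Gal c S i j e) {R : Finset V} (hR : R ⊆ S)
    (h : ∀ x ∈ R, ∀ y ∈ R, x ≠ y → ¬ e x y) : ∀ x ∈ R, ∀ y ∈ R, x ≠ y → c x y = i ∨ c x y = j :=
  fun x hx y hy hxy => g.col x (hR hx) y (hR hy) (h x hx y hy hxy)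

theorem Cx.caseTT (C : Cx c S i j e p r s d) (hS : S.Nonempty) (hX : okc c S i .T)
    (hY : okc c S j .T) : Gl S p r s d .T .T := by
  obtain ⟨R, hR, hi, hsum⟩ := C.g.reps
  have hq := rep_TT C.hc (C.g.colR hR hi) (hX.sub hR) (hY.sub hR)
  have := C.unl hS (fun x hx => ⟨jT hX pt_sub nn_sub (C.jn hx) (C.nne hx),
    jT hY pt_sub nn_sub (C.swap.jn hx) (C.swap.nne hx)⟩) hR hsum (q := 5) (by omega)
  have n := phi_numA p r s
  simp only [Gl, wd, wr, ws, wp, Nat.add_zero, Nat.add_assoc, Nat.reduceAdd]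
  omega

/-- `LT` for a part whose first neighbourhood has no edge of the triangle colour -/
theorem Cx.LTj (C : Cx c S i j e p r s d) {X : St} (hX : okc c S i X) (hY : okc c S j .T)
    {x : V} (hx : x ∈ S) (h : okc c (nn c S e i x) j .E) : Gl S p r s d X .T := by
  classical
  obtain ⟨h3, h4, h5, h6⟩ := C.card3 hx
  have := LT (A := pt S e x ∪ nn c S e i x) (B := nn c S e j x) (C.ih1 hX) ?_
    (Finset.union_subset pt_sub nn_sub) nn_sub ⟨x, Finset.mem_union_left _ (C.self hx)⟩
    (C.swap.nne hx)
    (union_E C.hc (jT hY pt_sub nn_sub (C.swap.jn hx) (C.swap.nne hx)) h (C.jn hx) C.g.ne)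
    (jT hY nn_sub pt_sub ((C.swap.jn hx).symm C.hc) ⟨x, C.self hx⟩)
  · simp only [Gl, wd, wr, ws, wp, Nat.add_zero, Nat.add_assoc, Nat.reduceAdd] at *
    omega
  · rw [Finset.card_union_of_disjoint]
    · exact h3
    · rw [Finset.disjoint_left]; intro y h1 h2
      rw [mem_pt] at h1; rw [mem_nn] at h2; tauto

theorem Cx.caseDT (C : Cx c S i j e p r s d) (hS : S.Nonempty) (hX : okc c S i .D)
    (hY : okc c S j .T) (sp : ∀ x ∈ S, 2 ≤ (pt S e x).card → 2 ≤ (nn c S e i x).card) :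
    Gl S p r s d .D .T := by
  obtain ⟨R, hR, hi, hsum⟩ := C.g.reps
  have hq := rep_TD C.hc (C.swap.g.colR hR hi) (hY.sub hR) (hX.sub hR)
  have := C.unl hS (fun x hx => ⟨?_,
    jT hY pt_sub nn_sub (C.swap.jn hx) (C.swap.nne hx)⟩) hR hsum (q := 6) (by omega)
  · have n := phi_numA p r s
    simp only [Gl, wd, wr, ws, wp, Nat.add_zero, Nat.add_assoc, Nat.reduceAdd]
    omega
  · by_cases h : 2 ≤ (pt S e x).card
    · exact jD2 hX pt_sub nn_sub (C.jn hx) (sp x hx h)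
    · exact okc_E1 (by omega)

theorem Cx.caseDH (C : Cx c S i j e p r s d) (hS : S.Nonempty) (hX : okc c S i .D) {Y : St}
    (hY : okc c S j Y) (hYY : Y = .D ∨ Y = .H)
    (sp : ∀ x ∈ S, 2 ≤ (pt S e x).card → 2 ≤ (nn c S e i x).card)
    (sp' : ∀ x ∈ S, 2 ≤ (pt S e x).card → 2 ≤ (nn c S e j x).card) :
    Gl S p r s d .D Y := by
  have hE : ∀ x ∈ S, okc c (pt S e x) i .E := by
    intro x hx
    by_cases h : 2 ≤ (pt S e x).card
    · exact jD2 hX pt_sub nn_sub (C.jn hx) (sp x hx h)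
    · exact okc_E1 (by omega)
  have hH : okc c S j .H := by
    rcases hYY with rfl | rfl
    · exact hY.DH
    · exact hY
  have n := phi_numA p r s
  by_cases hall : ∀ x ∈ S, okc c (pt S e x) j .E
  · obtain ⟨R, hR, hi, hsum⟩ := C.g.reps
    have hq := rep_DH C.hc (C.g.colR hR hi) (hX.sub hR) (hH.sub hR)
    have := C.unl hS (fun x hx => ⟨hE x hx, hall x hx⟩) hR hsum (q := 12) (by omega)
    rcases hYY with rfl | rfl <;>
    · simp only [Gl, wd, wr, ws, wp, Nat.add_zero, Nat.add_assoc, Nat.reduceAdd]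
      omega
  · push Not at hall
    obtain ⟨x, hx, hn⟩ := hall
    have h2 := two_E hn
    have hj := sp' x hx h2
    obtain ⟨h3, h4, h5, h6⟩ := C.card3 hx
    rcases hYY with rfl | rfl
    · exact absurd (jD2 hY pt_sub nn_sub (C.swap.jn hx) hj) hn
    · have a1 := C.ih _ (pt_sub (x := x)) (by omega) .E .T (hE x hx)
        (jH2 hY pt_sub nn_sub (C.swap.jn hx) hj)
      have a2 := C.ih _ (nn_sub (x := x)) (by omega) .E .H
        (jD2 hX nn_sub pt_sub ((C.jn hx).symm C.hc) h2) (hY.sub nn_sub)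
      have a3 := C.ih (nn c S e j x) nn_sub (by omega) .D .P (hX.sub nn_sub)
        (jH3 C.hc hY nn_sub pt_sub ((C.swap.jn hx).symm C.hc) hn)
      simp only [Gl, wd, wr, ws, wp, Nat.add_zero, Nat.add_assoc, Nat.reduceAdd] at *
      omega

end quot

/-! ### The type `(K₅ - e, K₃)` -/
section typeHT
set_option linter.unusedSimpArgs false
variable {V : Type} {κ : Type}
variable {c : V → V → κ} {S : Finset V} {i j : κ} {e : V → V → Prop} {p r s d : ℕ}

theorem not_noK4 (hc : IsG c) {W : Finset V} (h : ¬ noK4 c W i) :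
    ∃ Q ⊆ W, Q.card = 4 ∧ ∀ u ∈ Q, ∀ v ∈ Q, u ≠ v → cj c i u v := by
  classical
  simp only [noK4] at h
  push Not at h
  obtain ⟨a, ha, b, hb, x, hx, y, hy, h1, h2, h3, h4, h5, h6⟩ := h
  refine ⟨{a, b, x, y}, ?_, ?_, ?_⟩
  · intro z hz
    simp only [Finset.mem_insert, Finset.mem_singleton] at hz
    rcases hz with rfl | rfl | rfl | rfl <;> assumption
  · rw [Finset.card_insert_of_notMem, Finset.card_insert_of_notMem, Finset.card_pair h6.1]
    · simp [h4.1, h5.1]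
    · simp [h1.1, h2.1, h3.1]
  · intro u hu v hv huv
    simp only [Finset.mem_insert, Finset.mem_singleton] at hu hv
    have s : ∀ {x y}, cj c i x y → cj c i y x := fun h => h.symm hc
    rcases hu with rfl | rfl | rfl | rfl <;> rcases hv with rfl | rfl | rfl | rfl <;>
      first | exact absurd rfl huv | assumption | (apply s; assumption)

theorem clique4 (hc : IsG c) {Q : Finset V} (hX : okc c Q i .H)
    (h : ∀ u ∈ Q, ∀ v ∈ Q, u ≠ v → cj c i u v) : Q.card ≤ 4 := by
  classical
  by_contra hn
  obtain ⟨Q', hQ', h5⟩ := Finset.exists_subset_card_eq (show 5 ≤ Q.card by omega)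
  obtain ⟨a, ha⟩ : Q'.Nonempty := Finset.card_pos.1 (by omega)
  obtain ⟨b, hb⟩ : (Q'.erase a).Nonempty :=
    Finset.card_pos.1 (by rw [Finset.card_erase_of_mem ha]; omega)
  have h3 : ((Q'.erase a).erase b).card = 3 := by
    rw [Finset.card_erase_of_mem hb, Finset.card_erase_of_mem ha]; omega
  obtain ⟨x, y, z, xy, xz, yz, he⟩ := Finset.card_eq_three.1 h3
  have hm : ∀ w, w ∈ ({x, y, z} : Finset V) → w ∈ Q ∧ w ≠ a ∧ w ≠ b := by
    intro w hw
    rw [← he, Finset.mem_erase, Finset.mem_erase] at hw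
    exact ⟨hQ' hw.2.2, hw.2.1, hw.1⟩
  have mx := hm x (by simp)
  have my := hm y (by simp)
  have mz := hm z (by simp)
  have hb' := Finset.mem_erase.1 hb
  have ma := hQ' ha
  have mb := hQ' hb'.2
  exact hX x mx.1 y my.1 z mz.1 a ma b mb hb'.1.symm (h _ mx.1 _ my.1 xy) (h _ mx.1 _ mz.1 xz)
    (h _ my.1 _ mz.1 yz) (h _ mx.1 _ ma mx.2.1) (h _ my.1 _ ma my.2.1) (h _ mz.1 _ ma mz.2.1)
    (h _ mx.1 _ mb mx.2.2) (h _ my.1 _ mb my.2.2) (h _ mz.1 _ mb mz.2.2)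

theorem Cx.heavyQ (C : Cx c S i j e p r s d) (hX : okc c S i .H) {Q : Finset V} (hQ : Q ⊆ S)
    (hI : Ind e Q) (h4 : Q.card = 4) (h : ∀ u ∈ Q, ∀ v ∈ Q, u ≠ v → cj c i u v) {a : V}
    (ha : a ∈ Q) : (pt S e a).card ≤ 1 := by
  classical
  by_contra hn
  obtain ⟨a', ha', hne⟩ := Finset.exists_mem_ne (show 1 < (pt S e a).card by omega) a
  rw [mem_pt] at ha'
  have h3 : (Q.erase a).card = 3 := by
    rw [Finset.card_erase_of_mem ha]; omega
  obtain ⟨x, y, z, xy, xz, yz, he⟩ := Finset.card_eq_three.1 h3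
  have hm : ∀ w, w ∈ ({x, y, z} : Finset V) → w ∈ Q ∧ w ≠ a ∧ cj c i w a' := by
    intro w hw
    rw [← he, Finset.mem_erase] at hw
    have n1 : ¬ e a w := hI a ha w hw.2 hw.1.symm
    refine ⟨hw.2, hw.1, ?_, ?_⟩
    · rintro rfl; exact n1 ha'.2
    · rw [C.hc.1, C.homs (hQ ha) (hQ hw.2) ha'.1 (hQ hw.2) ha'.2 (C.g.refl w) n1]
      exact (h a ha w hw.2 hw.1.symm).2
  have mx := hm x (by simp)
  have my := hm y (by simp)
  have mz := hm z (by simp)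
  exact hX x (hQ mx.1) y (hQ my.1) z (hQ mz.1) a (hQ ha) a' ha'.1 hne.symm (h _ mx.1 _ my.1 xy)
    (h _ mx.1 _ mz.1 xz)
    (h _ my.1 _ mz.1 yz) (h _ mx.1 _ ha mx.2.1) (h _ my.1 _ ha my.2.1) (h _ mz.1 _ ha mz.2.1)
    mx.2.2 my.2.2 mz.2.2

open Classical in
/-- the non-singleton parts among representatives -/
noncomputable def hv (S : Finset V) (e : V → V → Prop) (R : Finset V) : Finset V :=
  R.filter (fun x => 2 ≤ (pt S e x).card)

theorem mem_hv {R : Finset V} {x : V} : x ∈ hv S e R ↔ x ∈ R ∧ 2 ≤ (pt S e x).card := by simp [hv]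

/-- a small window containing many heavy parts has no `K₄` -/
theorem Cx.window (C : Cx c S i j e p r s d) (hX : okc c S i .H) {W G : Finset V} (hW : W ⊆ S)
    (hI : Ind e W) (hG : ∀ x ∈ G, 2 ≤ (pt S e x).card) (hGW : G ⊆ W) (hcard : W.card ≤ G.card + 3) :
    noK4 c W i := by
  classical
  by_contra hn
  obtain ⟨Q, hQ, h4, hcl⟩ := not_noK4 C.hc hn
  have hd : Disjoint Q G := by
    rw [Finset.disjoint_left]
    intro x hx hxG
    have := C.heavyQ hX (hQ.trans hW) (fun a ha b hb => hI a (hQ ha) b (hQ hb)) h4 hcl hx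
    have := hG x hxG
    omega
  have := Finset.card_le_card (Finset.union_subset hQ hGW)
  rw [Finset.card_union_of_disjoint hd] at this
  omega

theorem Cx.hl (C : Cx c S i j e p r s d)
    (h : ∀ x ∈ S, okc c (pt S e x) i .E ∧ okc c (pt S e x) j .E) {R : Finset V} (hR : R ⊆ S)
    (hsum : S.card ≤ ∑ x ∈ R, (pt S e x).card) :
    (hv S e R).card ≤ R.card ∧
    (1 ≤ (hv S e R).card → 5 * (S.card + d) ≤ (hv S e R).card * phi p r s +
      5 * (R.card - (hv S e R).card)) ∧
    ((hv S e R).card = 0 → S.card ≤ R.card) := by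
  classical
  have hsub : hv S e R ⊆ R := fun x hx => (mem_hv.1 hx).1
  have hb : ∀ x ∈ hv S e R, 5 * ((pt S e x).card + d) ≤ phi p r s := by
    intro x hx
    have hx := hsub hx
    have := C.card3 (hR hx)
    have := C.ih (pt S e x) pt_sub (by omega) .E .E (h x (hR hx)).1 (h x (hR hx)).2
    simpa only [wd, wr, ws, wp, Nat.add_zero] using this
  have h1 : ∑ x ∈ hv S e R, 5 * ((pt S e x).card + d) ≤ (hv S e R).card * phi p r s := by
    have := Finset.sum_le_card_nsmul (hv S e R) _ _ hb
    simpa using this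
  rw [← Finset.mul_sum, Finset.sum_add_distrib, Finset.sum_const, smul_eq_mul] at h1
  have h2 : ∑ x ∈ R \ hv S e R, (pt S e x).card ≤ R.card - (hv S e R).card := by
    have := Finset.sum_le_card_nsmul (R \ hv S e R) (fun x => (pt S e x).card) 1 (by
      intro x hx
      rw [Finset.mem_sdiff, mem_hv] at hx
      have := hx.2
      simp only [hx.1, true_and] at this
      omega)
    rw [Finset.card_sdiff_of_subset hsub] at this
    simpa using this
  rw [← Finset.sum_sdiff hsub] at hsum
  have hle := Finset.card_le_card hsub
  refine ⟨hle, fun hh => ?_, fun hh => ?_⟩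
  · have h2 : d ≤ (hv S e R).card * d := Nat.le_mul_of_pos_left d hh
    omega
  · rw [Finset.card_eq_zero] at hh
    rw [hh] at hsum h2
    simp only [Finset.sum_empty, Finset.card_empty] at *
    omega

theorem window_exists {R G : Finset V} (hG : G ⊆ R) {a n : ℕ} (h1 : a ≤ G.card) (h2 : n ≤ R.card)
    (han : a ≤ n) : ∃ W ⊆ R, ∃ G' ⊆ G, G' ⊆ W ∧ G'.card = a ∧ W.card = n := by
  obtain ⟨G', hG', ha⟩ := Finset.exists_subset_card_eq h1
  obtain ⟨W, hW1, hW2, hW3⟩ := Finset.exists_subsuperset_card_eq (hG'.trans hG)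
    (show G'.card ≤ n by omega) h2
  exact ⟨W, hW2, G', hG', hW1, ha, hW3⟩

theorem Cx.F5 (C : Cx c S i j e p r s d) {x : V} (hx : x ∈ S) : 5 * (1 + d) ≤ phi p r s := by
  have := C.card3 hx
  have := C.ih {x} (by simpa using hx) (by simp; omega) .E .E (okc_E1 (by simp)) (okc_E1 (by simp))
  simpa [wd, wr, ws, wp] using this

theorem Cx.unlHT (C : Cx c S i j e p r s d) (hS : S.Nonempty) (hX : okc c S i .H)
    (hY : okc c S j .T)
    (h : ∀ x ∈ S, okc c (pt S e x) i .E ∧ okc c (pt S e x) j .E) : Gl S p r s d .H .T := by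
  obtain ⟨x0, hx0⟩ := hS
  obtain ⟨R, hR, hi, hsum⟩ := C.g.reps
  have hq := rep_TH C.hc (C.swap.g.colR hR hi) (hY.sub hR) (hX.sub hR)
  have n := phi_HT p r s
  have hF := C.F5 hx0
  simp only [Gl, wd, wr, ws, wp, Nat.add_zero, Nat.add_assoc, Nat.reduceAdd]
  by_cases h8 : R.card ≤ 8
  · have := C.unl ⟨x0, hx0⟩ h hR hsum h8
    omega
  rcases n.2.2.2 with n4 | n4
  · have := C.unl ⟨x0, hx0⟩ h hR hsum (q := 10) (by omega)
    omega
  have h5 : (hv S e R).card ≤ 5 := by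
    by_contra hn
    obtain ⟨W, hW, G, hG, hGW, g6, w9⟩ := window_exists (R := R) (G := hv S e R)
      (fun x hx => (mem_hv.1 hx).1) (show 6 ≤ _ by omega) (show 9 ≤ _ by omega) (by omega)
    have hIW : Ind e W := fun a ha b hb => hi a (hW ha) b (hW hb)
    have := rep_TK4 C.hc (C.swap.g.colR (hW.trans hR) hIW) (hY.sub (hW.trans hR))
      (C.window hX (hW.trans hR) hIW (fun x hx => (mem_hv.1 (hG hx)).2) hGW (by omega))
    omega
  obtain ⟨l1, l2, l3⟩ := C.hl h hR hsum
  generalize (hv S e R).card = hh at *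
  rcases Nat.eq_zero_or_pos hh with h0 | h0
  · have := l3 h0
    omega
  · have := l2 h0
    interval_cases hh <;> omega

/-- closed under parts -/
def Cls (S : Finset V) (e : V → V → Prop) (N : Finset V) : Prop := ∀ y ∈ N, pt S e y ⊆ N

theorem Cx.nnCls (C : Cx c S i j e p r s d) {x : V} (hx : x ∈ S) : Cls S e (nn c S e i x) := by
  intro y hy z hz
  rw [mem_nn] at hy ⊢
  rw [mem_pt] at hz
  refine ⟨hz.1, fun h => hy.2.1 (C.g.trans _ _ _ h (C.g.symm _ _ hz.2)), ?_⟩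
  rw [C.homs hx hy.1 hx hz.1 (C.g.refl x) hz.2 hy.2.1]
  exact hy.2.2

theorem Cx.jsp [DecidableEq V] (C : Cx c S i j e p r s d) {N : Finset V} (hN : N ⊆ S)
    (hcl : Cls S e N) (hE : okc c N j .E) {y : V} (hy : y ∈ N) :
    Jn c i (pt S e y) (N \ pt S e y) ∧ N.card = (pt S e y).card + (N \ pt S e y).card := by
  constructor
  · intro a ha b hb
    rw [Finset.mem_sdiff] at hb
    have ha' := mem_pt.1 ha
    have hn : ¬ e a b := fun h => hb.2 (mem_pt.2 ⟨hN hb.1, C.g.trans _ _ _ ha'.2 h⟩)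
    have hne : a ≠ b := by rintro rfl; exact hn (C.g.refl a)
    refine ⟨hne, (C.g.col a ha'.1 b (hN hb.1) hn).resolve_right fun h => ?_⟩
    exact hE a (hcl y hy ha) b hb.1 ⟨hne, h⟩
  · have := Finset.card_sdiff_add_card_eq_card (hcl y hy)
    omega

/-- structure of a set of parts pairwise joined in colour `i` -/
theorem Cx.jsplit [DecidableEq V] (C : Cx c S i j e p r s d) (hX : okc c S i .H) {N : Finset V}
    (hN : N ⊆ S)
    (hcl : Cls S e N) (hE : okc c N j .E) :
    N.card ≤ 4 ∨ ∃ y ∈ N, 2 ≤ (pt S e y).card ∧ Jn c i (pt S e y) (N \ pt S e y) ∧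
      N.card = (pt S e y).card + (N \ pt S e y).card := by
  by_cases h : ∃ y ∈ N, 2 ≤ (pt S e y).card
  · obtain ⟨y, hy, h2⟩ := h
    exact Or.inr ⟨y, hy, h2, C.jsp hN hcl hE hy⟩
  · left
    push Not at h
    refine clique4 C.hc (hX.sub hN) ?_
    intro u hu v hv huv
    have hn : ¬ e u v := by
      intro he
      have := h u hu
      exact huv (Finset.card_le_one.1 (show (pt S e u).card ≤ 1 by omega) u (C.self (hN hu)) v
        (mem_pt.2 ⟨hN hv, he⟩))
    exact ⟨huv, (C.g.col u (hN hu) v (hN hv) hn).resolve_right fun h => hE u hu v hv ⟨huv, h⟩⟩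

theorem Cx.caseHT (C : Cx c S i j e p r s d) (hS : S.Nonempty) (hX : okc c S i .H)
    (hY : okc c S j .T) : Gl S p r s d .H .T := by
  classical
  by_cases hLT : ∃ x ∈ S, okc c (nn c S e i x) j .E
  · obtain ⟨x, hx, h⟩ := hLT
    exact C.LTj hX hY hx h
  push Not at hLT
  have hTi : ∀ x ∈ S, okc c (pt S e x) i .T := fun x hx =>
    jH2 hX pt_sub nn_sub (C.jn hx) (two_E (hLT x hx))
  have hEj : ∀ x ∈ S, okc c (pt S e x) j .E := fun x hx =>
    jT hY pt_sub nn_sub (C.swap.jn hx) (C.swap.nne hx)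
  by_cases hU : ∀ x ∈ S, okc c (pt S e x) i .E
  · exact C.unlHT hS hX hY (fun x hx => ⟨hU x hx, hEj x hx⟩)
  push Not at hU
  have na := phi_numA p r s
  have nh := phi_HT p r s
  -- splitting the first neighbourhood of a loaded part
  have split : ∀ x ∈ S, okc c (nn c S e i x) i .P → ∃ A ⊆ nn c S e i x, ∃ B ⊆ nn c S e i x,
      okc c A j .E ∧ okc c B j .E ∧ (nn c S e i x).card = A.card + B.card := by
    intro x hx hP
    obtain ⟨u, hu⟩ := C.nne hx
    have huS := nn_sub hu
    refine ⟨(nn c S e i x).filter (fun w => cj c j w u), Finset.filter_subset _ _,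
      (nn c S e i x).filter (fun w => ¬ cj c j w u), Finset.filter_subset _ _, ?_, ?_, ?_⟩
    · intro a ha b hb hab
      rw [Finset.mem_filter] at ha hb
      exact hY a (nn_sub ha.1) b (nn_sub hb.1) u huS hab ha.2 hb.2
    · intro a ha b hb hab
      rw [Finset.mem_filter] at ha hb
      have hi : ∀ w ∈ nn c S e i x, ¬ cj c j w u → ¬ e u w → cj c i u w := by
        intro w hw h1 h2
        have hne : u ≠ w := by rintro rfl; exact h2 (C.g.refl u)
        refine ⟨hne, (C.g.col u huS w (nn_sub hw) h2).resolve_right fun h => h1 ?_⟩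
        exact ⟨hne.symm, by rw [C.hc.1]; exact h⟩
      have mix : ∀ a b, a ∈ nn c S e i x → b ∈ nn c S e i x → ¬ cj c j b u → e u a → ¬ e u b →
          ¬ cj c j a b := by
        intro a b ha hb hbu h1 h2 hab
        have h3 := hi b hb hbu h2
        have h4 := C.homs huS (nn_sub hb) (nn_sub ha) (nn_sub hb) h1 (C.g.refl b) h2
        exact C.g.ne (h3.2.symm.trans (h4.symm.trans hab.2))
      by_cases ea : e u a <;> by_cases eb : e u b
      · exact hEj u huS a (mem_pt.2 ⟨nn_sub ha.1, ea⟩) b (mem_pt.2 ⟨nn_sub hb.1, eb⟩) hab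
      · exact mix a b ha.1 hb.1 hb.2 ea eb hab
      · exact mix b a hb.1 ha.1 ha.2 eb ea (hab.symm C.hc)
      · exact hP u hu a ha.1 b hb.1 hab.1 (hi a ha.1 ha.2 ea) (hi b hb.1 hb.2 eb)
    · rw [Finset.card_filter_add_card_filter_not]
  simp only [Gl, wd, wr, ws, wp, Nat.add_zero, Nat.add_assoc, Nat.reduceAdd]
  by_cases hP3 : ∃ x ∈ S, ¬ okc c (pt S e x) i .P
  · obtain ⟨x, hx, hP⟩ := hP3
    have hN1 := jH4 hX nn_sub pt_sub ((C.jn hx).symm C.hc) hP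
    obtain ⟨A, hA, B, hB, eA, eB, hAB⟩ := split x hx hN1.EP
    obtain ⟨h3, h4, h5, h6⟩ := C.card3 hx
    have a1 := C.ih (pt S e x) pt_sub (by omega) .T .E (hTi x hx) (hEj x hx)
    have a2 := C.ih A (hA.trans nn_sub) (by omega) .E .E (hN1.sub hA) eA
    have a3 := C.ih B (hB.trans nn_sub) (by omega) .E .E (hN1.sub hB) eB
    have hN2 : okc c (nn c S e j x) j .E :=
      jT hY nn_sub pt_sub ((C.swap.jn hx).symm C.hc) ⟨x, C.self hx⟩
    have a4 := C.ih (nn c S e j x) nn_sub (by omega) .H .E (hX.sub nn_sub) hN2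
    simp only [wd, wr, ws, wp, Nat.add_zero, Nat.add_assoc, Nat.reduceAdd] at a1 a2 a3 a4
    have key := nh.1 (5 * (nn c S e j x).card) (by omega) ?_
    · omega
    rcases C.jsplit hX nn_sub (C.swap.nnCls hx) hN2 with h | ⟨y, hy, hy2, hJ, hsum⟩
    · omega
    set M := nn c S e j x \ pt S e y with hM
    have hMS : M ⊆ S := Finset.sdiff_subset.trans nn_sub
    have hMj : okc c M j .E := hN2.sub Finset.sdiff_subset
    have hyS := nn_sub hy
    by_cases hb : 2 ≤ M.card
    · rcases jHH C.hc hX pt_sub hMS hJ hy2 hb with ⟨u, v⟩ | ⟨u, v⟩ | ⟨u, v⟩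
      all_goals
        have b1 := C.ih (pt S e y) pt_sub (by omega) _ .E u (hEj y hyS)
        have b2 := C.ih M hMS (by omega) _ .E v hMj
        simp only [wd, wr, ws, wp, Nat.add_zero, Nat.add_assoc, Nat.reduceAdd] at b1 b2
        omega
    · have b1 := C.ih (pt S e y) pt_sub (by omega) .T .E (hTi y hyS) (hEj y hyS)
      simp only [wd, wr, ws, wp, Nat.add_zero, Nat.add_assoc, Nat.reduceAdd] at b1
      omega
  · push Not at hP3
    obtain ⟨x, hx, hE⟩ := hU
    have hN1 := jH3 C.hc hX nn_sub pt_sub ((C.jn hx).symm C.hc) hE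
    obtain ⟨A, hA, B, hB, eA, eB, hAB⟩ := split x hx hN1
    obtain ⟨h3, h4, h5, h6⟩ := C.card3 hx
    have a1 := C.ih (pt S e x) pt_sub (by omega) .P .E (hP3 x hx) (hEj x hx)
    have a2 := C.ih A (hA.trans nn_sub) (by omega) .P .E (hN1.sub hA) eA
    have a3 := C.ih B (hB.trans nn_sub) (by omega) .P .E (hN1.sub hB) eB
    have hN2 : okc c (nn c S e j x) j .E :=
      jT hY nn_sub pt_sub ((C.swap.jn hx).symm C.hc) ⟨x, C.self hx⟩
    have a4 := C.ih (nn c S e j x) nn_sub (by omega) .H .E (hX.sub nn_sub) hN2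
    simp only [wd, wr, ws, wp, Nat.add_zero, Nat.add_assoc, Nat.reduceAdd] at a1 a2 a3 a4
    have key := nh.2.1 (5 * (nn c S e j x).card) (by omega) ?_
    · omega
    rcases C.jsplit hX nn_sub (C.swap.nnCls hx) hN2 with h | ⟨y, hy, hy2, hJ, hsum⟩
    · omega
    set M := nn c S e j x \ pt S e y with hM
    have hMS : M ⊆ S := Finset.sdiff_subset.trans nn_sub
    have hMj : okc c M j .E := hN2.sub Finset.sdiff_subset
    have hyS := nn_sub hy
    have b1 := C.ih (pt S e y) pt_sub (by omega) .P .E (hP3 y hyS) (hEj y hyS)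
    simp only [wd, wr, ws, wp, Nat.add_zero, Nat.add_assoc, Nat.reduceAdd] at b1
    by_cases hb : 2 ≤ M.card
    · by_cases hyE : okc c (pt S e y) i .E
      · have b2 := C.ih (pt S e y) pt_sub (by omega) .E .E hyE (hEj y hyS)
        simp only [wd, wr, ws, wp, Nat.add_zero, Nat.add_assoc, Nat.reduceAdd] at b2
        have hMT : okc c M i .T := jH2 hX hMS pt_sub (hJ.symm C.hc) hy2
        have hMcl : Cls S e M := by
          intro z hz w hw
          rw [hM, Finset.mem_sdiff] at hz ⊢
          refine ⟨C.swap.nnCls hx z hz.1 hw, fun h => hz.2 ?_⟩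
          rw [mem_pt] at h hw ⊢
          exact ⟨nn_sub hz.1, C.g.trans _ _ _ h.2 (C.g.symm _ _ hw.2)⟩
        obtain ⟨z, hz⟩ : M.Nonempty := Finset.card_pos.1 (by omega)
        obtain ⟨hJ', hsum'⟩ := C.jsp hMS hMcl hMj hz
        by_cases hne : (M \ pt S e z).Nonempty
        · have hzS := hMS hz
          have hs : M \ pt S e z ⊆ M := Finset.sdiff_subset
          have e1 := jT hMT (hMcl z hz) hs hJ' hne
          have e2 := jT hMT hs (hMcl z hz) (hJ'.symm C.hc) ⟨z, C.self hzS⟩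
          have c1 := C.card3 hzS
          have c2 := hne.card_pos
          have b3 := C.ih (pt S e z) pt_sub (by omega) .E .E e1 (hEj z hzS)
          have b4 := C.ih (M \ pt S e z) (hs.trans hMS) (by omega) .E .E e2 (hMj.sub hs)
          simp only [wd, wr, ws, wp, Nat.add_zero, Nat.add_assoc, Nat.reduceAdd] at b3 b4
          omega
        · rw [Finset.not_nonempty_iff_eq_empty] at hne
          have hz0 : (M \ pt S e z).card = 0 := by rw [hne]; rfl
          have c1 := C.card3 (hMS hz)
          have b3 := C.ih (pt S e z) pt_sub (by omega) .P .E (hP3 z (hMS hz)) (hEj z (hMS hz))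
          simp only [wd, wr, ws, wp, Nat.add_zero, Nat.add_assoc, Nat.reduceAdd] at b3
          omega
      · have hMP := jH3 C.hc hX hMS pt_sub (hJ.symm C.hc) hyE
        have b2 := C.ih M hMS (by omega) .P .E hMP hMj
        simp only [wd, wr, ws, wp, Nat.add_zero, Nat.add_assoc, Nat.reduceAdd] at b2
        omega
    · omega

end typeHT

/-! ### The type `(K₅ - e, K₅ - e)` -/
section typeHH
set_option linter.unusedSimpArgs false
variable {V : Type} {κ : Type}
variable {c : V → V → κ} {S : Finset V} {i j : κ} {e : V → V → Prop} {p r s d : ℕ}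

open Classical in
/-- the block of `u` in `N` -/
noncomputable def bk (c : V → V → κ) (e : V → V → Prop) (i : κ) (N : Finset V) (u : V) : Finset V :=
  N.filter (fun w => e u w ∨ c u w = i)

theorem mem_bk {N : Finset V} {u w : V} : w ∈ bk c e i N u ↔ w ∈ N ∧ (e u w ∨ c u w = i) := by
  simp [bk]

theorem bk_sub {N : Finset V} {u : V} : bk c e i N u ⊆ N := fun _ h => (mem_bk.1 h).1

section

theorem Cx.bkJ [DecidableEq V] (C : Cx c S i j e p r s d) {N : Finset V} (hN : N ⊆ S) (hP : okc c N i .P) {u : V} (hu : u ∈ N)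
    : Jn c j (bk c e i N u) (N \ bk c e i N u) := by
  intro a ha b hb
  rw [mem_bk] at ha
  rw [Finset.mem_sdiff, mem_bk] at hb
  have hb2 : ¬ e u b ∧ c u b ≠ i := by tauto
  have huS := hN hu
  have haS := hN ha.1
  have hbS := hN hb.1
  have hub := (C.g.col u huS b hbS hb2.1).resolve_left hb2.2
  by_cases hea : e u a
  · have hne : ¬ e a b := fun h => hb2.1 (C.g.trans _ _ _ hea h)
    refine ⟨?_, ?_⟩
    · rintro rfl; exact hne (C.g.refl a)
    · rw [C.homs huS hbS haS hbS hea (C.g.refl b) hb2.1]; exact hub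
  · have hua := ha.2.resolve_left hea
    have hne : ¬ e a b := by
      intro h
      have := C.homs huS haS huS hbS (C.g.refl u) h hea
      exact C.g.ne (hua.symm.trans (this.symm.trans hub))
    have hab : a ≠ b := by rintro rfl; exact hne (C.g.refl a)
    refine ⟨hab, (C.g.col a haS b hbS hne).resolve_left fun h => ?_⟩
    have hnu : u ≠ b := by rintro rfl; exact hb2.1 (C.g.refl u)
    have hau : a ≠ u := by rintro rfl; exact hea (C.g.refl a)
    exact hP a ha.1 u hu b hb.1 hnu ⟨hau, by rw [C.hc.1]; exact hua⟩ ⟨hab, h⟩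

theorem Cx.bkS [DecidableEq V] (C : Cx c S i j e p r s d) {N : Finset V} (hN : N ⊆ S) (hP : okc c N i .P) {u : V} (hu : u ∈ N)
    : bk c e i N u ⊆ pt S e u ∨ okc c (bk c e i N u) j .E := by
  by_cases h : bk c e i N u ⊆ pt S e u
  · exact Or.inl h
  right
  obtain ⟨w, hw, hw'⟩ := Finset.not_subset.1 h
  rw [mem_bk] at hw
  have huS := hN hu
  have hwS := hN hw.1
  have hew : ¬ e u w := fun h => hw' (mem_pt.2 ⟨hwS, h⟩)
  have huw := hw.2.resolve_left hew
  have hne : u ≠ w := by rintro rfl; exact hew (C.g.refl u)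
  have all : ∀ a ∈ bk c e i N u, a = u ∨ a = w := by
    intro a ha
    rw [mem_bk] at ha
    by_contra hn
    push Not at hn
    by_cases hea : e u a
    · have h1 := C.homs huS hwS (hN ha.1) hwS hea (C.g.refl w) hew
      refine hP w hw.1 u hu a ha.1 hn.1.symm ⟨hne.symm, by rw [C.hc.1]; exact huw⟩
        ⟨hn.2.symm, by rw [C.hc.1, h1]; exact huw⟩
    · exact hP u hu a ha.1 w hw.1 hn.2 ⟨hn.1.symm, ha.2.resolve_left hea⟩ ⟨hne, huw⟩
  intro a ha b hb hab
  rcases all a ha with rfl | rfl <;> rcases all b hb with rfl | rfl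
  · exact hab.1 rfl
  · exact C.g.ne (huw.symm.trans hab.2)
  · exact C.g.ne (huw.symm.trans (hab.symm C.hc).2)
  · exact hab.1 rfl

theorem Cx.bkself [DecidableEq V] (C : Cx c S i j e p r s d) {N : Finset V} (hN : N ⊆ S) (hP : okc c N i .P) {u : V} (hu : u ∈ N)
    : u ∈ bk c e i N u := mem_bk.2 ⟨hu, Or.inl (C.g.refl u)⟩

theorem Cx.bkcard [DecidableEq V] (C : Cx c S i j e p r s d) {N : Finset V} (hN : N ⊆ S) (hP : okc c N i .P) {u : V} (hu : u ∈ N)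
    : N.card = (bk c e i N u).card + (N \ bk c e i N u).card := by
  have := Finset.card_sdiff_add_card_eq_card (bk_sub : bk c e i N u ⊆ N)
  omega
end

/-- blocks in `N`, with the dichotomy on the large block -/
theorem Cx.blk [DecidableEq V] (C : Cx c S i j e p r s d) (hY : okc c S j .H) {N : Finset V}
    (hN : N ⊆ S) (hP : okc c N i .P) :
    N.card ≤ 4 ∨ ∃ u ∈ N, 2 ≤ (bk c e i N u).card := by
  by_cases h : ∃ u ∈ N, 2 ≤ (bk c e i N u).card
  · exact Or.inr h
  left
  push Not at h
  refine clique4 C.hc (hY.sub hN) ?_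
  intro u hu v hv huv
  refine C.bkJ hN hP hu u (C.bkself hN hP hu) v (Finset.mem_sdiff.2 ⟨hv, fun hb => huv ?_⟩)
  have := h u hu
  exact Finset.card_le_one.1 (show (bk c e i N u).card ≤ 1 by omega) u (C.bkself hN hP hu) v hb

section

theorem Cx.blk1 [DecidableEq V] (C : Cx c S i j e p r s d) (hY : okc c S j .H) {N : Finset V} (hN : N ⊆ S) (hNl : N.card < S.card)
    (hT : ∀ x ∈ S, okc c (pt S e x) j .T) (hP : okc c N i .P) :
    5 * N.card ≤ phi (p + 1) r (s + 1) + phi (p + 1) r s := by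
  have na := phi_numA (p + 1) r s
  have nh := phi_HH p r s
  rcases C.blk hY hN hP with h | ⟨u, hu, h2⟩
  · omega
  have hsum := C.bkcard hN hP hu
  have hJ := C.bkJ hN hP hu
  have hTB : okc c (bk c e i N u) j .T := by
    rcases C.bkS hN hP hu with h | h
    · exact (hT u (hN hu)).sub h
    · exact h.EP.PT
  have hB : bk c e i N u ⊆ N := bk_sub
  have hB' : N \ bk c e i N u ⊆ N := Finset.sdiff_subset
  by_cases hb : 2 ≤ (N \ bk c e i N u).card
  · rcases jHH C.hc (hY.sub hN) hB hB' hJ h2 hb with ⟨v, w⟩ | ⟨v, w⟩ | ⟨v, w⟩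
    all_goals
      have b1 := C.ih _ (hB.trans hN) (by omega) .P _ (hP.sub hB) v
      have b2 := C.ih _ (hB'.trans hN) (by omega) .P _ (hP.sub hB') w
      simp only [wd, wr, ws, wp, Nat.add_zero, phi_succ] at b1 b2 na nh ⊢
      omega
  · have b1 := C.ih _ (hB.trans hN) (by omega) .P .T (hP.sub hB) hTB
    simp only [wd, wr, ws, wp, Nat.add_zero, phi_succ] at b1 na nh ⊢
    omega

theorem Cx.blk2 [DecidableEq V] (C : Cx c S i j e p r s d) (hY : okc c S j .H) {N : Finset V} (hN : N ⊆ S) (hNl : N.card < S.card)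
    (hT : ∀ x ∈ S, okc c (pt S e x) j .T) (hP : okc c N i .E) :
    5 * N.card ≤ phi p r (s + 1) + phi p r s + 5 ∨ 5 * N.card ≤ 2 * phi (p + 1) r s ∨
      5 * N.card ≤ 20 := by
  rcases C.blk hY hN hP.EP with h | ⟨u, hu, h2⟩
  · omega
  have hsum := C.bkcard hN hP.EP hu
  have hJ := C.bkJ hN hP.EP hu
  have hTB : okc c (bk c e i N u) j .T := by
    rcases C.bkS hN hP.EP hu with h | h
    · exact (hT u (hN hu)).sub h
    · exact h.EP.PT
  have hB : bk c e i N u ⊆ N := bk_sub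
  have hB' : N \ bk c e i N u ⊆ N := Finset.sdiff_subset
  by_cases hb : 2 ≤ (N \ bk c e i N u).card
  · rcases jHH C.hc (hY.sub hN) hB hB' hJ h2 hb with ⟨v, w⟩ | ⟨v, w⟩ | ⟨v, w⟩
    all_goals
      have b1 := C.ih _ (hB.trans hN) (by omega) .E _ (hP.sub hB) v
      have b2 := C.ih _ (hB'.trans hN) (by omega) .E _ (hP.sub hB') w
      simp only [wd, wr, ws, wp, Nat.add_zero] at b1 b2
      omega
  · have b1 := C.ih _ (hB.trans hN) (by omega) .E .T (hP.sub hB) hTB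
    simp only [wd, wr, ws, wp, Nat.add_zero] at b1
    omega

theorem Cx.blk3 [DecidableEq V] (C : Cx c S i j e p r s d) (hY : okc c S j .H) {N : Finset V} (hN : N ⊆ S) (hNl : N.card < S.card)
    (hPP : ∀ x ∈ S, okc c (pt S e x) j .P) (hP : okc c N i .P) :
    5 * N.card ≤ 3 * phi (p + 1) r s := by
  have na := phi_numA p r s
  rcases C.blk hY hN hP with h | ⟨u, hu, h2⟩
  · omega
  have hsum := C.bkcard hN hP hu
  have hJ := C.bkJ hN hP hu
  have small : ∀ M ⊆ N, okc c M j .P → 5 * M.card ≤ phi (p + 1) r s := by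
    intro M hM h
    have := Finset.card_le_card hM
    have b1 := C.ih M (hM.trans hN) (by omega) .P .P (hP.sub hM) h
    simp only [wd, wr, ws, wp, Nat.add_zero, phi_succ] at b1 ⊢
    omega
  have hbP : ∀ M ⊆ N, ∀ u ∈ M, okc c (bk c e i M u) j .P := by
    intro M hM u hu
    rcases C.bkS (hM.trans hN) (hP.sub hM) hu with h | h
    · exact (hPP u (hN (hM hu))).sub h
    · exact h.EP
  have hB : bk c e i N u ⊆ N := bk_sub
  have hB' : N \ bk c e i N u ⊆ N := Finset.sdiff_subset
  have s1 := small _ hB (hbP N subset_rfl u hu)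
  have hT : okc c (N \ bk c e i N u) j .T := jH2 (hY.sub hN) hB' hB (hJ.symm C.hc) h2
  set M := N \ bk c e i N u
  rcases M.eq_empty_or_nonempty with h0 | ⟨v, hv⟩
  · rw [h0, Finset.card_empty] at hsum
    omega
  have hMP := hP.sub hB'
  have hMS := hB'.trans hN
  have hsum' := C.bkcard hMS hMP hv
  have hJ' := C.bkJ hMS hMP hv
  have s2 := small _ (bk_sub.trans hB') (hbP M hB' v hv)
  have hs : M \ bk c e i M v ⊆ M := Finset.sdiff_subset
  have s3 := small _ (hs.trans hB')
    (jT hT hs bk_sub (hJ'.symm C.hc) ⟨v, C.bkself hMS hMP hv⟩).EP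
  omega
end

/-- the four light vertices beside 14 heavy ones form a monochromatic clique -/
theorem Cx.light4 [DecidableEq V] (C : Cx c S i j e p r s d) (hX : okc c S i .H)
    (hY : okc c S j .H) {R L : Finset V} (hR : R ⊆ S) (hI : Ind e R)
    (h14 : 14 ≤ (hv S e R).card) (hL : L ⊆ R \ hv S e R) (h4 : L.card = 4) :
    ∃ k, (k = i ∨ k = j) ∧ ∀ u ∈ L, ∀ v ∈ L, u ≠ v → cj c k u v := by
  have hsub : hv S e R ⊆ R := fun x hx => (mem_hv.1 hx).1
  have hLR : L ⊆ R := hL.trans Finset.sdiff_subset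
  have hW : hv S e R ∪ L ⊆ R := Finset.union_subset hsub hLR
  have hd : Disjoint (hv S e R) L := by
    rw [Finset.disjoint_left]
    intro x hx hx'
    exact (Finset.mem_sdiff.1 (hL hx')).2 hx
  have hcard := Finset.card_union_of_disjoint hd
  have hIW : Ind e (hv S e R ∪ L) := fun a ha b hb => hI a (hW ha) b (hW hb)
  have key : ∀ {k : κ} {l : κ}, Cx c S k l e p r s d → okc c S k .H → ¬ noK4 c (hv S e R ∪ L) k →
      ∀ u ∈ L, ∀ v ∈ L, u ≠ v → cj c k u v := by
    intro k l C hX hn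
    obtain ⟨Q, hQ, hQ4, hcl⟩ := not_noK4 C.hc hn
    have hQL : Q ⊆ L := by
      intro x hx
      rcases Finset.mem_union.1 (hQ hx) with h | h
      · have := C.heavyQ hX ((hQ.trans hW).trans hR)
          (fun a ha b hb => hIW a (hQ ha) b (hQ hb)) hQ4 hcl hx
        have := (mem_hv.1 h).2
        omega
      · exact h
    have : Q = L := Finset.eq_of_subset_of_card_le hQL (by omega)
    rw [← this]
    exact hcl
  by_cases h1 : noK4 c (hv S e R ∪ L) i
  · by_cases h2 : noK4 c (hv S e R ∪ L) j
    · have := rep_KK C.hc (C.g.colR (hW.trans hR) hIW) h1 h2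
      omega
    · exact ⟨j, Or.inr rfl, key C.swap hY h2⟩
  · exact ⟨i, Or.inl rfl, key C hX h1⟩

theorem Cx.unlHH (C : Cx c S i j e p r s d) (hS : S.Nonempty) (hX : okc c S i .H)
    (hY : okc c S j .H)
    (h : ∀ x ∈ S, okc c (pt S e x) i .E ∧ okc c (pt S e x) j .E) : Gl S p r s d .H .H := by
  classical
  obtain ⟨x0, hx0⟩ := hS
  obtain ⟨R, hR, hi, hsum⟩ := C.g.reps
  have hq := rep_HH C.hc (C.g.colR hR hi) (hX.sub hR) (hY.sub hR)
  have n := phi_HH p r s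
  have hF := C.F5 hx0
  simp only [Gl, wd, wr, ws, wp, Nat.add_zero, Nat.add_assoc, Nat.reduceAdd]
  by_cases h8 : R.card ≤ 17
  · have := C.unl ⟨x0, hx0⟩ h hR hsum h8
    omega
  rcases n.2.2.2.2.2 with n4 | n4
  · have := C.unl ⟨x0, hx0⟩ h hR hsum (q := 21) (by omega)
    omega
  have hsub : hv S e R ⊆ R := fun x hx => (mem_hv.1 hx).1
  have h14 : (hv S e R).card ≤ 14 := by
    by_contra hn
    obtain ⟨W, hW, G, hG, hGW, g6, w9⟩ := window_exists (R := R) (G := hv S e R)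
      hsub (show 15 ≤ _ by omega) (show 18 ≤ _ by omega) (by omega)
    have hIW : Ind e W := fun a ha b hb => hi a (hW ha) b (hW hb)
    have := rep_KK C.hc (C.g.colR (hW.trans hR) hIW)
      (C.window hX (hW.trans hR) hIW (fun x hx => (mem_hv.1 (hG hx)).2) hGW (by omega))
      (C.swap.window hY (hW.trans hR) hIW (fun x hx => (mem_hv.1 (hG hx)).2) hGW (by omega))
    omega
  have h13 : 19 ≤ R.card → (hv S e R).card ≤ 13 := by
    intro h19
    by_contra hn
    have hl : 5 ≤ (R \ hv S e R).card := by
      rw [Finset.card_sdiff_of_subset hsub]; omega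
    obtain ⟨L, hL, h5⟩ := Finset.exists_subset_card_eq hl
    obtain ⟨a, ha⟩ : L.Nonempty := Finset.card_pos.1 (by omega)
    obtain ⟨b, hb⟩ : (L.erase a).Nonempty :=
      Finset.card_pos.1 (by rw [Finset.card_erase_of_mem ha]; omega)
    have h3 : ((L.erase a).erase b).card = 3 := by
      rw [Finset.card_erase_of_mem hb, Finset.card_erase_of_mem ha]; omega
    obtain ⟨x, y, z, xy, xz, yz, he⟩ := Finset.card_eq_three.1 h3
    have hb' := Finset.mem_erase.1 hb
    obtain ⟨k1, hk1, q1⟩ := C.light4 hX hY hR hi (by omega) ((Finset.erase_subset a L).trans hL)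
      (by rw [Finset.card_erase_of_mem ha]; omega)
    obtain ⟨k2, hk2, q2⟩ := C.light4 hX hY hR hi (by omega) ((Finset.erase_subset b L).trans hL)
      (by rw [Finset.card_erase_of_mem hb'.2]; omega)
    have hm : ∀ w, w ∈ ({x, y, z} : Finset V) → w ∈ L.erase a ∧ w ∈ L.erase b := by
      intro w hw
      rw [← he, Finset.mem_erase, Finset.mem_erase] at hw
      exact ⟨Finset.mem_erase.2 hw.2, Finset.mem_erase.2 ⟨hw.1, hw.2.2⟩⟩
    have mx := hm x (by simp)
    have my := hm y (by simp)
    have mz := hm z (by simp)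
    have hk : k1 = k2 := (q1 x mx.1 y my.1 xy).2.symm.trans (q2 x mx.2 y my.2 xy).2
    subst hk
    have ab : a ∈ L.erase b := Finset.mem_erase.2 ⟨hb'.1.symm, ha⟩
    have LS : L ⊆ S := (hL.trans Finset.sdiff_subset).trans hR
    have ms : ∀ w ∈ L.erase a, w ∈ S := fun w hw => LS (Finset.mem_erase.1 hw).2
    have hH : okc c S k1 .H := by rcases hk1 with rfl | rfl <;> assumption
    exact hH x (ms x mx.1) y (ms y my.1) z (ms z mz.1) a (LS ha) b (LS hb'.2) hb'.1.symm
      (q1 _ mx.1 _ my.1 xy) (q1 _ mx.1 _ mz.1 xz) (q1 _ my.1 _ mz.1 yz)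
      (q2 _ mx.2 _ ab (Finset.mem_erase.1 mx.1).1) (q2 _ my.2 _ ab (Finset.mem_erase.1 my.1).1)
      (q2 _ mz.2 _ ab (Finset.mem_erase.1 mz.1).1)
      (q1 _ mx.1 _ hb (Finset.mem_erase.1 mx.2).1) (q1 _ my.1 _ hb (Finset.mem_erase.1 my.2).1)
      (q1 _ mz.1 _ hb (Finset.mem_erase.1 mz.2).1)
  obtain ⟨l1, l2, l3⟩ := C.hl h hR hsum
  generalize (hv S e R).card = hh at *
  rcases Nat.eq_zero_or_pos hh with h0 | h0
  · have := l3 h0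
    omega
  · have := l2 h0
    interval_cases hh <;> omega

/-- a part loaded in colour `i`, not in colour `j` -/
theorem Cx.caseHH1 (C : Cx c S i j e p r s d) (hX : okc c S i .H) (hY : okc c S j .H)
    (hTi : ∀ x ∈ S, okc c (pt S e x) i .T) (hTj : ∀ x ∈ S, okc c (pt S e x) j .T)
    {x : V} (hx : x ∈ S) (hE : okc c (pt S e x) j .E)
    (h : ¬ okc c (pt S e x) i .P ∨ ¬ okc c (pt S e x) i .E ∧ ∀ x ∈ S, okc c (pt S e x) j .P) :
    Gl S p r s d .H .H := by
  classical
  have nh := phi_HH p r s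
  obtain ⟨h3, h4, h5, h6⟩ := C.card3 hx
  have hE' : ¬ okc c (pt S e x) i .E := by
    rcases h with h | h
    · exact fun h' => h h'.EP
    · exact h.1
  have a4 := C.ih (nn c S e j x) nn_sub (by omega) .H .T (hX.sub nn_sub)
    (jH2 hY nn_sub pt_sub ((C.swap.jn hx).symm C.hc) (two_E hE'))
  by_cases hP : okc c (pt S e x) i .P
  · have hPj := (h.resolve_left (not_not.2 hP)).2
    have a1 := C.ih (pt S e x) pt_sub (by omega) .P .E hP hE
    have a2 := C.blk3 hY nn_sub (by omega) hPj
      (jH3 C.hc hX nn_sub pt_sub ((C.jn hx).symm C.hc) hE')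
    simp only [Gl, wd, wr, ws, wp, Nat.add_zero, Nat.add_assoc, Nat.reduceAdd] at a1 a4 ⊢
    omega
  · have a1 := C.ih (pt S e x) pt_sub (by omega) .T .E (hTi x hx) hE
    have a2 := C.blk2 hY nn_sub (by omega) hTj (jH4 hX nn_sub pt_sub ((C.jn hx).symm C.hc) hP)
    have a3 := nh.2.2.1 _ a2
    simp only [Gl, wd, wr, ws, wp, Nat.add_zero, Nat.add_assoc, Nat.reduceAdd] at a1 a4 ⊢
    omega

theorem Cx.caseHH (C : Cx c S i j e p r s d) (hS : S.Nonempty) (hX : okc c S i .H)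
    (hY : okc c S j .H)
    (sp : ∀ x ∈ S, 2 ≤ (pt S e x).card → 2 ≤ (nn c S e i x).card)
    (sp' : ∀ x ∈ S, 2 ≤ (pt S e x).card → 2 ≤ (nn c S e j x).card) : Gl S p r s d .H .H := by
  classical
  have hTi : ∀ x ∈ S, okc c (pt S e x) i .T := by
    intro x hx
    by_cases h : 2 ≤ (pt S e x).card
    · exact jH2 hX pt_sub nn_sub (C.jn hx) (sp x hx h)
    · exact (okc_E1 (by omega)).EP.PT
  have hTj : ∀ x ∈ S, okc c (pt S e x) j .T := by
    intro x hx
    by_cases h : 2 ≤ (pt S e x).card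
    · exact jH2 hY pt_sub nn_sub (C.swap.jn hx) (sp' x hx h)
    · exact (okc_E1 (by omega)).EP.PT
  by_cases hA : ∃ x ∈ S, ¬ okc c (pt S e x) i .E ∧ ¬ okc c (pt S e x) j .E
  · obtain ⟨x, hx, hi, hj⟩ := hA
    have nh := phi_HH p r s
    obtain ⟨h3, h4, h5, h6⟩ := C.card3 hx
    have a1 := C.ih (pt S e x) pt_sub (by omega) .T .T (hTi x hx) (hTj x hx)
    have a2 := C.blk1 hY nn_sub (by omega) hTj
      (jH3 C.hc hX nn_sub pt_sub ((C.jn hx).symm C.hc) hi)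
    have a3 := C.swap.blk1 hX nn_sub (by omega) hTi
      (jH3 C.hc hY nn_sub pt_sub ((C.swap.jn hx).symm C.hc) hj)
    simp only [Gl, wd, wr, ws, wp, Nat.add_zero, Nat.add_assoc, Nat.reduceAdd] at a1 ⊢
    omega
  push Not at hA
  by_cases hB : ∃ x ∈ S, ¬ okc c (pt S e x) i .P
  · obtain ⟨x, hx, hP⟩ := hB
    exact C.caseHH1 hX hY hTi hTj hx (hA x hx fun h => hP h.EP) (Or.inl hP)
  by_cases hB' : ∃ x ∈ S, ¬ okc c (pt S e x) j .P
  · obtain ⟨x, hx, hP⟩ := hB'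
    exact (C.swap.caseHH1 hY hX hTj hTi hx (by
      by_contra h; exact hP (hA x hx h).EP) (Or.inl hP)).swap
  push Not at hB hB'
  by_cases hC : ∃ x ∈ S, ¬ okc c (pt S e x) i .E
  · obtain ⟨x, hx, hE⟩ := hC
    exact C.caseHH1 hX hY hTi hTj hx (hA x hx hE) (Or.inr ⟨hE, hB'⟩)
  by_cases hC' : ∃ x ∈ S, ¬ okc c (pt S e x) j .E
  · obtain ⟨x, hx, hE⟩ := hC'
    exact (C.swap.caseHH1 hY hX hTj hTi hx (by
      by_contra h; exact hE (hA x hx h)) (Or.inr ⟨hE, hB⟩)).swap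
  push Not at hC hC'
  exact C.unlHH hS hX hY (fun x hx => ⟨hC x hx, hC' x hx⟩)

end typeHH

/-! ### The main induction -/
section main
variable {V : Type} {κ : Type}

section
variable [Fintype κ] [DecidableEq κ]

def sm (w : St → ℕ) (t : κ → St) : ℕ := ∑ l, w (t l)

theorem sm1 (w : St → ℕ) (t : κ → St) (i : κ) (X : St) :
    sm w (Function.update t i X) = ∑ l ∈ Finset.univ.erase i, w (t l) + w X := by
  unfold sm
  rw [← Finset.sum_erase_add _ _ (Finset.mem_univ i), Function.update_self]
  congr 1
  refine Finset.sum_congr rfl fun l hl => ?_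
  rw [Function.update_of_ne (Finset.mem_erase.1 hl).1]

theorem sm2 (w : St → ℕ) (t : κ → St) {i j : κ} (hij : i ≠ j) (X Y : St) :
    sm w (Function.update (Function.update t i X) j Y) =
      ∑ l ∈ (Finset.univ.erase i).erase j, w (t l) + w X + w Y := by
  rw [sm1, Finset.erase_right_comm,
    ← Finset.sum_erase_add (Finset.univ.erase j) _ (Finset.mem_erase.2 ⟨hij, Finset.mem_univ i⟩),
    Function.update_self]
  congr 2
  refine Finset.sum_congr rfl fun l hl => ?_
  rw [Function.update_of_ne (Finset.mem_erase.1 hl).1]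

theorem Cx.final {c : V → V → κ} {S : Finset V} {i j : κ} {e : V → V → Prop} {p r s d : ℕ}
    (C : Cx c S i j e p r s d) (hS : S.Nonempty) {X Y : St} (hX : okc c S i X) (hY : okc c S j Y) :
    Gl S p r s d X Y := by
  obtain ⟨x, hx⟩ := hS
  by_cases h1 : ∃ x ∈ S, 2 ≤ (pt S e x).card ∧ (nn c S e i x).card ≤ 1
  · obtain ⟨x, hx, a, b⟩ := h1
    exact C.special hx hX hY a b
  by_cases h2 : ∃ x ∈ S, 2 ≤ (pt S e x).card ∧ (nn c S e j x).card ≤ 1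
  · obtain ⟨x, hx, a, b⟩ := h2
    exact (C.swap.special hx hY hX a b).swap
  have sp : ∀ x ∈ S, 2 ≤ (pt S e x).card → 2 ≤ (nn c S e i x).card := by
    intro x hx a
    by_contra hn
    exact h1 ⟨x, hx, a, by omega⟩
  have sp' : ∀ x ∈ S, 2 ≤ (pt S e x).card → 2 ≤ (nn c S e j x).card := by
    intro x hx a
    by_contra hn
    exact h2 ⟨x, hx, a, by omega⟩
  cases X
  · exact C.caseE hx hX
  · exact C.caseP hx hX hY
  · cases Y
    · exact (C.swap.caseE hx hY).swap
    · exact (C.swap.caseP hx hY hX).swap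
    · exact C.caseTT ⟨x, hx⟩ hX hY
    · exact (C.swap.caseDT ⟨x, hx⟩ hY hX sp').swap
    · exact (C.swap.caseHT ⟨x, hx⟩ hY hX).swap
  · cases Y
    · exact (C.swap.caseE hx hY).swap
    · exact (C.swap.caseP hx hY hX).swap
    · exact C.caseDT ⟨x, hx⟩ hX hY sp
    · exact C.caseDH ⟨x, hx⟩ hX hY (Or.inl rfl) sp sp'
    · exact C.caseDH ⟨x, hx⟩ hX hY (Or.inr rfl) sp sp'
  · cases Y
    · exact (C.swap.caseE hx hY).swap
    · exact (C.swap.caseP hx hY hX).swap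
    · exact C.caseHT ⟨x, hx⟩ hX hY
    · exact (C.swap.caseDH ⟨x, hx⟩ hY hX (Or.inr rfl) sp' sp).swap
    · exact C.caseHH ⟨x, hx⟩ hX hY sp sp'

theorem main_bound {c : V → V → κ} (hc : IsG c) : ∀ (n : ℕ) (S : Finset V) (t : κ → St),
    S.card = n → (∀ i, okc c S i (t i)) →
    5 * (S.card + sm wd t) ≤ phi (sm wp t) (sm wr t) (sm ws t) := by
  classical
  intro n
  induction n using Nat.strong_induction_on with
  | _ n ih =>
  intro S t hn ht
  have hdr : ∀ (F : Finset κ), ∑ l ∈ F, wd (t l) ≤ ∑ l ∈ F, wr (t l) :=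
    fun F => Finset.sum_le_sum fun l _ => wd_le_wr _
  by_cases h2 : 2 ≤ S.card
  · rcases gallai_structure hc h2 with ⟨i, A, hAS, hA, ⟨y, hy, hyA⟩, hJ⟩ | ⟨i, j, e, g⟩
    · have hI : IH1 c S i (∑ l ∈ Finset.univ.erase i, wp (t l))
          (∑ l ∈ Finset.univ.erase i, wr (t l)) (∑ l ∈ Finset.univ.erase i, ws (t l))
          (∑ l ∈ Finset.univ.erase i, wd (t l)) := by
        intro B hB hl X hX
        have := ih B.card (by omega) B (Function.update t i X) rfl (by
          intro l
          by_cases h : l = i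
          · subst h; rw [Function.update_self]; exact hX
          · rw [Function.update_of_ne h]; exact (ht l).sub hB)
        simp only [sm1] at this
        omega
      have := GJ (A := A) (A0 := A) (B := S \ A) hc hI (hdr _) (ht i) (by
          have := Finset.card_sdiff_add_card_eq_card hAS
          omega) hAS Finset.sdiff_subset hA subset_rfl ⟨y, Finset.mem_sdiff.2 ⟨hy, hyA⟩⟩
        (by
          intro u hu v hv
          rw [Finset.mem_sdiff] at hv
          refine ⟨?_, hJ u hu v hv.1 hv.2⟩
          rintro rfl
          exact hv.2 hu)
        (fun x hx y hy _ => ⟨hx, hy⟩) (Or.inr rfl)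
      rw [← sm1, ← sm1, ← sm1] at this
      have h4 := sm1 wd t i (t i)
      simp only [Function.update_eq_self] at this h4
      omega
    · have C : Cx c S i j e (∑ l ∈ (Finset.univ.erase i).erase j, wp (t l))
          (∑ l ∈ (Finset.univ.erase i).erase j, wr (t l))
          (∑ l ∈ (Finset.univ.erase i).erase j, ws (t l))
          (∑ l ∈ (Finset.univ.erase i).erase j, wd (t l)) := by
        refine ⟨hc, g, hdr _, ?_⟩
        intro B hB hl X Y hX hY
        have := ih B.card (by omega) B (Function.update (Function.update t i X) j Y) rfl (by
          intro l
          by_cases h : l = j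
          · subst h; rw [Function.update_self]; exact hY
          · rw [Function.update_of_ne h]
            by_cases h : l = i
            · subst h; rw [Function.update_self]; exact hX
            · rw [Function.update_of_ne h]; exact (ht l).sub hB)
        simp only [sm2 _ _ g.ne] at this
        omega
      have := C.final (Finset.card_pos.1 (by omega)) (ht i) (ht j)
      unfold Gl at this
      rw [← sm2 _ _ g.ne, ← sm2 _ _ g.ne, ← sm2 _ _ g.ne] at this
      have h4 := sm2 wd t g.ne (t i) (t j)
      simp only [Function.update_eq_self] at this h4
      omega
  · have := phi_base (sm wp t) (sm wr t) (sm ws t)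
    have h3 : sm wd t ≤ sm wr t := hdr _
    omega
end

end main

/-! ### The lower bound construction -/
section lower

/-- lexicographic product of colourings -/
def lex {W V : Type} [DecidableEq W] (g : W → W → ℕ) (c : V → V → ℕ) (x y : W × V) : ℕ :=
  if x.1 = y.1 then c x.2 y.2 else g x.1 y.1

section
variable {W V : Type} [DecidableEq W] {g : W → W → ℕ} {c : V → V → ℕ}

theorem lex_G (hg : IsG g) (hc : IsG c) : IsG (lex g c) := by
  refine ⟨fun u v => ?_, fun u v w huv huw hvw => ?_⟩
  · unfold lex
    by_cases h : u.1 = v.1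
    · rw [if_pos h, if_pos h.symm, hc.1]
    · rw [if_neg h, if_neg (Ne.symm h), hg.1]
  · unfold lex
    by_cases h1 : u.1 = v.1
    · by_cases h2 : u.1 = w.1
      · have h3 : v.1 = w.1 := h1.symm.trans h2
        rw [if_pos h1, if_pos h2, if_pos h3]
        refine hc.2 _ _ _ ?_ ?_ ?_ <;> intro h
        · exact huv (Prod.ext h1 h)
        · exact huw (Prod.ext h2 h)
        · exact hvw (Prod.ext h3 h)
      · have h3 : ¬ v.1 = w.1 := fun h => h2 (h1.trans h)
        rw [if_neg h2, if_neg h3, h1]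
        exact Or.inr (Or.inr rfl)
    · by_cases h2 : u.1 = w.1
      · have h3 : ¬ v.1 = w.1 := fun h => h1 (h2.trans h.symm)
        rw [if_neg h1, if_neg h3, h2, hg.1 w.1]
        exact Or.inr (Or.inl rfl)
      · by_cases h3 : v.1 = w.1
        · rw [if_neg h1, if_neg h2, h3]
          exact Or.inl rfl
        · rw [if_neg h1, if_neg h2, if_neg h3]
          exact hg.2 _ _ _ h1 h2 h3

variable {l : ℕ}

/-- a colour missing in the outer factor -/
theorem lex_in (hg : ∀ u v, g u v ≠ l) {x y : W × V} (h : cj (lex g c) l x y) :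
    x.1 = y.1 ∧ cj c l x.2 y.2 := by
  obtain ⟨h1, h2⟩ := h
  unfold lex at h2
  by_cases h3 : x.1 = y.1
  · rw [if_pos h3] at h2
    exact ⟨h3, fun h => h1 (Prod.ext h3 h), h2⟩
  · rw [if_neg h3] at h2
    exact absurd h2 (hg _ _)

/-- a colour missing in the inner factor -/
theorem lex_out (hc : ∀ u v, c u v ≠ l) {x y : W × V} (h : cj (lex g c) l x y) :
    cj g l x.1 y.1 := by
  obtain ⟨h1, h2⟩ := h
  unfold lex at h2
  by_cases h3 : x.1 = y.1
  · rw [if_pos h3] at h2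
    exact absurd h2 (hc _ _)
  · rw [if_neg h3] at h2
    exact ⟨h3, h2⟩

variable [Fintype W] [Fintype V]

theorem lex_inT (hg : ∀ u v, g u v ≠ l) (h : okc c Finset.univ l .T) :
    okc (lex g c) Finset.univ l .T := by
  intro a _ b _ x _ h1 h2 h3
  exact h _ (Finset.mem_univ _) _ (Finset.mem_univ _) _ (Finset.mem_univ _) (lex_in hg h1).2
    (lex_in hg h2).2 (lex_in hg h3).2

theorem lex_inH (hg : ∀ u v, g u v ≠ l) (h : okc c Finset.univ l .H) :
    okc (lex g c) Finset.univ l .H := by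
  intro a _ b _ d _ x _ y _ hn h1 h2 h3 h4 h5 h6 h7 h8 h9
  refine h _ (Finset.mem_univ _) _ (Finset.mem_univ _) _ (Finset.mem_univ _) _ (Finset.mem_univ _)
    _ (Finset.mem_univ _) (fun hh => hn (Prod.ext ?_ hh)) (lex_in hg h1).2 (lex_in hg h2).2
    (lex_in hg h3).2 (lex_in hg h4).2 (lex_in hg h5).2 (lex_in hg h6).2 (lex_in hg h7).2
    (lex_in hg h8).2 (lex_in hg h9).2
  exact (lex_in hg h4).1.symm.trans (lex_in hg h7).1

theorem lex_outT (hc : ∀ u v, c u v ≠ l) (h : okc g Finset.univ l .T) :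
    okc (lex g c) Finset.univ l .T := by
  intro a _ b _ x _ h1 h2 h3
  exact h _ (Finset.mem_univ _) _ (Finset.mem_univ _) _ (Finset.mem_univ _) (lex_out hc h1)
    (lex_out hc h2) (lex_out hc h3)

theorem lex_outH (hc : ∀ u v, c u v ≠ l) (h : noK4 g Finset.univ l) :
    okc (lex g c) Finset.univ l .H := by
  intro a _ b _ d _ x _ y _ hn h1 h2 h3 h4 h5 h6 h7 h8 h9
  exact h _ (Finset.mem_univ _) _ (Finset.mem_univ _) _ (Finset.mem_univ _) _ (Finset.mem_univ _)
    (lex_out hc h1) (lex_out hc h2) (lex_out hc h4) (lex_out hc h3) (lex_out hc h5) (lex_out hc h6)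
end

/-- circulant two-colouring -/
def circ {n : ℕ} (q : ZMod n → Bool) (m : ℕ) (x y : ZMod n) : ℕ := if q (x - y) then m else m + 1

theorem circ_G {n : ℕ} {q : ZMod n → Bool} (hq : ∀ x, q (-x) = q x) (m : ℕ) : IsG (circ q m) := by
  constructor
  · intro u v
    unfold circ
    rw [← neg_sub v u, hq]
  · intro u v w _ _ _
    unfold circ
    cases q (u - v) <;> cases q (u - w) <;> cases q (v - w) <;> simp

def pent (x : ZMod 5) : Bool := decide (x = 1 ∨ x = 4)
def paley (x : ZMod 17) : Bool :=
  decide (x = 1 ∨ x = 2 ∨ x = 4 ∨ x = 8 ∨ x = 9 ∨ x = 13 ∨ x = 15 ∨ x = 16)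

theorem pent_T (b : Bool) : ∀ x : ZMod 5, x ≠ 0 → pent x = b → ∀ y, y ≠ 0 → pent y = b →
    y - x ≠ 0 → pent (y - x) ≠ b := by
  revert b; decide

theorem paley_K (b : Bool) : ∀ x : ZMod 17, x ≠ 0 → paley x = b → ∀ y, y ≠ 0 → paley y = b →
    y - x ≠ 0 → paley (y - x) = b → ∀ z, z ≠ 0 → paley z = b → z - x ≠ 0 → paley (z - x) = b →
    z - y ≠ 0 → paley (z - y) ≠ b := by
  revert b; decide +kernel

theorem circ_cj {n : ℕ} {q : ZMod n → Bool} (hq : ∀ x, q (-x) = q x) {m l : ℕ} {x y : ZMod n}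
    (h : cj (circ q m) l x y) : y - x ≠ 0 ∧ q (y - x) = decide (l = m) := by
  obtain ⟨h1, h2⟩ := h
  refine ⟨sub_ne_zero.2 h1.symm, ?_⟩
  unfold circ at h2
  rw [← hq, neg_sub]
  subst h2
  cases q (x - y) <;> simp

theorem pent_ok (m l : ℕ) : okc (circ pent m) Finset.univ l .T := by
  intro a _ b _ x _ h1 h2 h3
  have hq : ∀ x, pent (-x) = pent x := by decide
  have k1 := circ_cj hq h1
  have k2 := circ_cj hq h2
  have k3 := circ_cj hq h3
  rw [← sub_sub_sub_cancel_right x b a] at k3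
  exact pent_T _ _ k1.1 k1.2 _ k2.1 k2.2 k3.1 k3.2

theorem paley_ok (m l : ℕ) : noK4 (circ paley m) Finset.univ l := by
  intro a _ b _ x _ y _ h1 h2 h3 h4 h5 h6
  have hq : ∀ x, paley (-x) = paley x := by decide
  have k1 := circ_cj hq h1
  have k2 := circ_cj hq h2
  have k3 := circ_cj hq h3
  have k4 := circ_cj hq h4
  have k5 := circ_cj hq h5
  have k6 := circ_cj hq h6
  rw [← sub_sub_sub_cancel_right x b a] at k4
  rw [← sub_sub_sub_cancel_right y b a] at k5
  rw [← sub_sub_sub_cancel_right y x a] at k6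
  exact paley_K _ _ k1.1 k1.2 _ k2.1 k2.2 k4.1 k4.2 _ k3.1 k3.2 k5.1 k5.2 k6.1 k6.2

theorem circ_ne {n : ℕ} {q : ZMod n → Bool} {m l : ℕ} (h : l < m ∨ m + 1 < l) (x y : ZMod n) :
    circ q m x y ≠ l := by
  unfold circ
  split <;> omega

theorem circ_le {n : ℕ} {q : ZMod n → Bool} {m : ℕ} (x y : ZMod n) :
    circ q m x y < m + 2 := by
  unfold circ
  split <;> omega

theorem lower_ex (b a : ℕ) : ∃ (V : Type) (_ : Fintype V) (c : V → V → ℕ),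
    Fintype.card V = 4 * 5 ^ a * 17 ^ b ∧ IsG c ∧ (∀ x y, c x y < 2 * b + 1 + 2 * a) ∧
    (∀ l < 2 * b + 1, okc c Finset.univ l .H) ∧ (∀ l, 2 * b + 1 ≤ l → okc c Finset.univ l .T) := by
  induction a with
  | zero =>
    induction b with
    | zero =>
      refine ⟨Fin 4, inferInstance, fun _ _ => 0, by simp, ⟨fun _ _ => rfl, fun _ _ _ _ _ _ =>
        Or.inl rfl⟩, fun _ _ => by simp, fun l _ => ?_, fun l hl => ?_⟩
      · intro a _ b _ d _ x _ y _ hn h1 h2 h3 h4 h5 h6 h7 h8 h9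
        have := h1.1
        have := h2.1
        have := h3.1
        have := h4.1
        have := h5.1
        have := h6.1
        have := h7.1
        have := h8.1
        have := h9.1
        omega
      · intro a _ b _ x _ h1
        have h2 : 0 = l := h1.2
        omega
    | succ b ih =>
      obtain ⟨V, hV, c, h1, h2, h3, h4, h5⟩ := ih
      refine ⟨ZMod 17 × V, inferInstance, lex (circ paley (2 * b + 1)) c, ?_,
        lex_G (circ_G (by decide) _) h2, ?_, ?_, ?_⟩
      · rw [Fintype.card_prod, h1, ZMod.card]; ring
      · intro x y
        unfold lex
        split
        · have := h3 x.2 y.2; omega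
        · have := circ_le (q := paley) (m := 2 * b + 1) x.1 y.1; omega
      · intro l hl
        by_cases h : l < 2 * b + 1
        · exact lex_inH (circ_ne (Or.inl h)) (h4 l h)
        · refine lex_outH (fun u v => ?_) (paley_ok _ _)
          have := h3 u v
          omega
      · intro l hl
        exact lex_inT (circ_ne (Or.inr (by omega))) (h5 l (by omega))
  | succ a ih =>
    obtain ⟨V, hV, c, h1, h2, h3, h4, h5⟩ := ih
    refine ⟨ZMod 5 × V, inferInstance, lex (circ pent (2 * b + 1 + 2 * a)) c, ?_,
      lex_G (circ_G (by decide) _) h2, ?_, ?_, ?_⟩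
    · rw [Fintype.card_prod, h1, ZMod.card]; ring
    · intro x y
      unfold lex
      split
      · have := h3 x.2 y.2; omega
      · have := circ_le (q := pent) (m := 2 * b + 1 + 2 * a) x.1 y.1; omega
    · intro l hl
      exact lex_inH (circ_ne (Or.inl (by omega))) (h4 l hl)
    · intro l hl
      by_cases h : l < 2 * b + 1 + 2 * a
      · exact lex_inT (circ_ne (Or.inl h)) (h5 l hl)
      · refine lex_outT (fun u v => ?_) (pent_ok _ _)
        have := h3 u v
        omega
end lower

end RE

/-! ### Assembly -/
theorem mono_H {n k : ℕ} (c : Fin n → Fin n → Fin k) (hc : ∀ u v, c u v = c v u) (i : Fin k) :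
    HasMonoCopy GH3 c i ↔ ¬ RE.okc c Finset.univ i .H := by
  constructor
  · rintro ⟨f, hf, h⟩ hk
    have key : ∀ a b : Fin 5, GH3.Adj a b → RE.cj c i (f a) (f b) :=
      fun a b hab => ⟨fun he => hab.ne (hf he), h a b hab⟩
    have ad : ∀ a b : Fin 5, a ≠ b → ¬ (a = 0 ∧ b = 1) → ¬ (b = 0 ∧ a = 1) → GH3.Adj a b := by
      intro a b h1 h2 h3
      simp only [GH3, SimpleGraph.sdiff_adj, SimpleGraph.top_adj, SimpleGraph.fromRel_adj]
      tauto
    refine hk (f 2) (Finset.mem_univ _) (f 3) (Finset.mem_univ _) (f 4) (Finset.mem_univ _) (f 0)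
      (Finset.mem_univ _) (f 1) (Finset.mem_univ _) (fun h => absurd (hf h) (by decide))
      (key _ _ ?_) (key _ _ ?_) (key _ _ ?_) (key _ _ ?_) (key _ _ ?_) (key _ _ ?_) (key _ _ ?_)
      (key _ _ ?_) (key _ _ ?_) <;> exact ad _ _ (by decide) (by decide) (by decide)
  · intro h
    simp only [RE.okc, RE.cj] at h
    push Not at h
    obtain ⟨a, -, b, -, d, -, x, -, y, -, hxy, h1, h2, h3, h4, h5, h6, h7, h8, h9⟩ := h
    refine ⟨![x, y, a, b, d], ?_, ?_⟩
    · intro u v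
      fin_cases u <;> fin_cases v <;> simp <;> intro hh <;> simp_all
    · intro u v huv
      simp only [GH3, SimpleGraph.sdiff_adj, SimpleGraph.top_adj, SimpleGraph.fromRel_adj] at huv
      have hs : ∀ {u v}, c u v = i → c v u = i := fun {u v} h => by rw [hc]; exact h
      fin_cases u <;> fin_cases v <;> simp at huv ⊢ <;>
        first | exact h1.2 | exact h2.2 | exact h3.2 | exact h4.2 | exact h5.2 | exact h6.2 |
          exact h7.2 | exact h8.2 | exact h9.2 | exact hs h1.2 | exact hs h2.2 | exact hs h3.2 |
          exact hs h4.2 | exact hs h5.2 | exact hs h6.2 | exact hs h7.2 | exact hs h8.2 |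
          exact hs h9.2

theorem mono_T {n k : ℕ} (c : Fin n → Fin n → Fin k) (hc : ∀ u v, c u v = c v u) (i : Fin k) :
    HasMonoCopy GK3 c i ↔ ¬ RE.okc c Finset.univ i .T := by
  constructor
  · rintro ⟨f, hf, h⟩ hk
    have key : ∀ a b : Fin 3, a ≠ b → RE.cj c i (f a) (f b) :=
      fun a b hab => ⟨fun he => hab (hf he), h a b hab⟩
    exact hk (f 0) (Finset.mem_univ _) (f 1) (Finset.mem_univ _) (f 2) (Finset.mem_univ _)
      (key _ _ (by decide)) (key _ _ (by decide)) (key _ _ (by decide))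
  · intro h
    simp only [RE.okc, RE.cj] at h
    push Not at h
    obtain ⟨a, -, b, -, d, -, h1, h2, h3⟩ := h
    refine ⟨![a, b, d], ?_, ?_⟩
    · intro u v
      fin_cases u <;> fin_cases v <;> simp <;> intro hh <;> simp_all
    · intro u v huv
      have huv : u ≠ v := huv
      have hs : ∀ {u v}, c u v = i → c v u = i := fun {u v} h => by rw [hc]; exact h
      fin_cases u <;> fin_cases v <;> simp at huv ⊢ <;>
        first | exact h1.2 | exact h2.2 | exact h3.2 | exact hs h1.2 | exact hs h2.2 | exact hs h3.2

theorem gal_iff {n k : ℕ} (c : Fin n → Fin n → Fin k) : IsGallaiColoring c ↔ RE.IsG c := by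
  unfold IsGallaiColoring RE.IsG HasRainbowTriangle
  refine and_congr Iff.rfl ?_
  constructor
  · intro h u v w h1 h2 h3
    by_contra hn
    push Not at hn
    exact h ⟨u, v, w, h1, h2, h3, hn⟩
  · rintro h ⟨u, v, w, h1, h2, h3, h4, h5, h6⟩
    rcases h u v w h1 h2 h3 with h | h | h
    · exact h4 h
    · exact h5 h
    · exact h6 h

/-- The states of the colours. -/
def stt (k r : ℕ) (i : Fin k) : RE.St := if (i : ℕ) < r then .H else .T

theorem mono_mix {n k s r : ℕ} (hsr : s + r = k) (c : Fin n → Fin n → Fin k)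
    (hc : ∀ u v, c u v = c v u) (i : Fin k) :
    HasMonoCopy (mixPKH k s r i).2 c i ↔ ¬ RE.okc c Finset.univ i (stt k r i) := by
  by_cases h : (i : ℕ) < r
  · have h1 : mixPKH k s r i = ⟨Fin 5, GH3⟩ := if_pos h
    have h2 : stt k r i = .H := if_pos h
    rw [h1, h2]
    exact mono_H c hc i
  · have h1 : mixPKH k s r i = ⟨Fin 3, GK3⟩ := by
      unfold mixPKH
      rw [if_neg h, if_pos (by omega)]
    have h2 : stt k r i = .T := if_neg h
    rw [h1, h2]
    exact mono_T c hc i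

theorem cnt_lt {k r : ℕ} (h : r ≤ k) : (∑ i : Fin k, if (i : ℕ) < r then 1 else 0) = r := by
  rw [Fin.sum_univ_eq_sum_range (fun i => if i < r then 1 else 0) k, Finset.sum_ite,
    Finset.sum_const_zero, Finset.sum_const, Nat.add_zero, smul_eq_mul, Nat.mul_one]
  have : (Finset.range k).filter (fun i => i < r) = Finset.range r := by
    ext x
    simp only [Finset.mem_filter, Finset.mem_range]
    omega
  rw [this, Finset.card_range]

theorem sums {k s r : ℕ} (hsr : s + r = k) : RE.sm RE.wd (stt k r) = 0 ∧
    RE.sm RE.wp (stt k r) = 0 ∧ RE.sm RE.wr (stt k r) = r ∧ RE.sm RE.ws (stt k r) = s := by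
  have e1 : ∀ i, RE.wd (stt k r i) = 0 := by intro i; unfold stt; split <;> rfl
  have e2 : ∀ i, RE.wp (stt k r i) = 0 := by intro i; unfold stt; split <;> rfl
  have e3 : ∀ i, RE.wr (stt k r i) = if (i : ℕ) < r then 1 else 0 := by
    intro i; unfold stt; split <;> rfl
  have e4 : ∀ i, RE.ws (stt k r i) + RE.wr (stt k r i) = 1 := by intro i; unfold stt; split <;> rfl
  have h3 : RE.sm RE.wr (stt k r) = r := by
    unfold RE.sm
    simp only [e3]
    exact cnt_lt (by omega)
  refine ⟨by simp [RE.sm, e1], by simp [RE.sm, e2], h3, ?_⟩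
  have : RE.sm RE.ws (stt k r) + RE.sm RE.wr (stt k r) = k := by
    unfold RE.sm
    rw [← Finset.sum_add_distrib]
    simp [e4]
  omega

/-- Theorem 1.5, case (b₇): s even, r odd and s + r = k implies
GR_k((k-s-r)P₃, sK₃, rH₃) = 4·5^(s/2)·17^((r-1)/2) + 1. -/
theorem GR_mixPKH_b7 (k s r : ℕ) (hk : 1 ≤ k) (hs : Even s) (hr : Odd r)
    (hsr : s + r = k) :
    GR k (mixPKH k s r) = 4 * 5 ^ (s / 2) * 17 ^ ((r - 1) / 2) + 1 := by
  classical
  obtain ⟨a, rfl⟩ := hs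
  obtain ⟨b, rfl⟩ := hr
  have ea : (a + a) / 2 = a := by omega
  have eb : (2 * b + 1 - 1) / 2 = b := by omega
  rw [ea, eb]
  unfold GR
  have hmem : 4 * 5 ^ a * 17 ^ b + 1 ∈ {n : ℕ | ∀ c : Fin n → Fin n → Fin k,
      IsGallaiColoring c → ∃ i : Fin k, HasMonoCopy (mixPKH k (a + a) (2 * b + 1) i).2 c i} := by
    intro c hc
    by_contra hn
    push Not at hn
    have hG := (gal_iff c).1 hc
    have := RE.main_bound hG _ Finset.univ (stt k (2 * b + 1)) rfl (fun i => by
      have := hn i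
      rw [mono_mix hsr c hG.1 i, not_not] at this
      exact this)
    obtain ⟨h1, h2, h3, h4⟩ := sums hsr
    rw [h1, h2, h3, h4, Finset.card_univ, Fintype.card_fin] at this
    have hv : RE.phi 0 (2 * b + 1) (a + a) = 5 * (4 * 5 ^ a * 17 ^ b) := by
      have m1 : (2 * b + 1) % 2 = 1 := by omega
      have m2 : (a + a) % 2 = 0 := by omega
      simp only [RE.phi, RE.f0, if_true, m1, m2, ea, eb]
      rw [if_neg (by omega)]
      ring
    omega
  apply le_antisymm
  · exact Nat.sInf_le hmem
  · apply le_csInf ⟨_, hmem⟩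
    intro n hn
    by_contra hlt
    obtain ⟨V, hV, c, h1, h2, h3, h4, h5⟩ := RE.lower_ex b a
    have hcard : Fintype.card (Fin n) ≤ Fintype.card V := by
      rw [Fintype.card_fin, h1]; omega
    obtain ⟨f⟩ := Function.Embedding.nonempty_of_card_le hcard
    have hk' : ∀ u v, c u v < k := fun u v => by have := h3 u v; omega
    set c' : Fin n → Fin n → Fin k := fun u v => ⟨c (f u) (f v), hk' _ _⟩ with hc'
    have hG : RE.IsG c' := by
      refine ⟨fun u v => Fin.ext (h2.1 _ _), fun u v w h1 h2' h3 => ?_⟩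
      simp only [hc', Fin.mk.injEq]
      exact h2.2 _ _ _ (f.injective.ne h1) (f.injective.ne h2') (f.injective.ne h3)
    obtain ⟨i, hi⟩ := hn c' ((gal_iff c').2 hG)
    rw [mono_mix hsr c' hG.1 i] at hi
    apply hi
    have hcj : ∀ {u v}, RE.cj c' i u v → RE.cj c i (f u) (f v) := by
      rintro u v ⟨h, h'⟩
      exact ⟨f.injective.ne h, congrArg Fin.val h'⟩
    have mu : ∀ x : V, x ∈ Finset.univ := Finset.mem_univ
    unfold stt
    split
    · rename_i hlt
      intro a _ b _ d _ x _ y _ hn h1 h2 h3 h4' h5 h6 h7 h8 h9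
      exact h4 i hlt _ (mu _) _ (mu _) _ (mu _) _ (mu _) _ (mu _) (f.injective.ne hn) (hcj h1)
        (hcj h2) (hcj h3) (hcj h4') (hcj h5) (hcj h6) (hcj h7) (hcj h8) (hcj h9)
    · rename_i hlt
      intro a _ b _ x _ h1 h2 h3
      exact h5 i (by omega) _ (mu _) _ (mu _) _ (mu _) (hcj h1) (hcj h2) (hcj h3)
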